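/- Let Ω = ℝ²/ℤ² and 1 < p < ∞. There is a constant C(p) such that for all smooth b, f on Ω and i, j ∈ {1,2}, the commutator [b, R_iR_j](f) := b R_iR_j(f) - R_iR_j(bf) satisfies ‖[b, R_iR_j](f)‖_{L^p} ≤ C(p) ‖b‖_{BMO} ‖f‖_{L^p}, where R_i = (-Δ)^{-1/2}∂_i are the Riesz transforms on the torus. -/

import Mathlib

open MeasureTheory Real

noncomputable section

/-- The fundamental domain of the torus `Ω = ℝ²/ℤ²` (unit square). -/
def Q2 : Set (ℝ × ℝ) := Set.Ioo 0 1 ×ˢ Set.Ioo 0 1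

/-- Lebesgue measure on the torus, identified with the unit square. -/
def μΩ : MeasureTheory.Measure (ℝ × ℝ) := MeasureTheory.volume.restrict Q2

/-- `ℤ²`-periodicity of a function on `ℝ²`. -/
def Per {α : Type*} (f : ℝ × ℝ → α) : Prop :=
  (∀ x : ℝ × ℝ, f (x.1 + 1, x.2) = f x) ∧ (∀ x : ℝ × ℝ, f (x.1, x.2 + 1) = f x)

/-- First partial derivative of a scalar function on `ℝ²`. -/
def d1 (f : ℝ × ℝ → ℝ) (x : ℝ × ℝ) : ℝ := fderiv ℝ f x (1, 0)

/-- Second partial derivative of a scalar function on `ℝ²`. -/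
def d2 (f : ℝ × ℝ → ℝ) (x : ℝ × ℝ) : ℝ := fderiv ℝ f x (0, 1)

/-- The character `e^{2πi n·x}` of the torus, `n ∈ ℤ²`. -/
def ch (n : ℤ × ℤ) (x : ℝ × ℝ) : ℂ :=
  Complex.exp (2 * Real.pi * Complex.I * ((n.1 : ℂ) * (x.1 : ℂ) + (n.2 : ℂ) * (x.2 : ℂ)))

/-- Fourier coefficient of a function on the torus. -/
def fc (f : ℝ × ℝ → ℂ) (n : ℤ × ℤ) : ℂ := ∫ x in Q2, f x * (starRingEnd ℂ) (ch n x)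

/-- `i`-th component of a frequency `n ∈ ℤ²`, as a complex number. -/
def nc (n : ℤ × ℤ) : Fin 2 → ℂ := ![(n.1 : ℂ), (n.2 : ℂ)]

/-- The periodic Riesz transform `R_i = (-Δ)^{-1/2} ∂_i`, defined as the Fourier
multiplier with symbol `i n_i / |n|` (and `0` on the zero frequency). -/
def Rz (i : Fin 2) (f : ℝ × ℝ → ℂ) (x : ℝ × ℝ) : ℂ :=
  ∑' n : ℤ × ℤ, if n = 0 then 0 else
    (Complex.I * nc n i / ((Real.sqrt ((n.1 : ℝ) ^ 2 + (n.2 : ℝ) ^ 2) : ℝ) : ℂ)) *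
      fc f n * ch n x

/-- The composition `R_i ∘ R_j` of two periodic Riesz transforms: the Fourier
multiplier with symbol `-n_i n_j / |n|²` (and `0` on the zero frequency). -/
def RRz (i j : Fin 2) (f : ℝ × ℝ → ℂ) (x : ℝ × ℝ) : ℂ :=
  ∑' n : ℤ × ℤ, if n = 0 then 0 else
    (-(nc n i * nc n j) / ((((n.1 : ℝ) ^ 2 + (n.2 : ℝ) ^ 2 : ℝ)) : ℂ)) * fc f n * ch n x

/-- The commutator `[b, R_iR_j](f) = b R_iR_j(f) - R_iR_j(bf)`. -/
def commRR (b f : ℝ × ℝ → ℂ) (i j : Fin 2) (x : ℝ × ℝ) : ℂ :=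
  b x * RRz i j f x - RRz i j (fun y => b y * f y) x

/-- The BMO seminorm of a function on the torus (balls of radius at most `2`,
which exceeds the diameter of the fundamental domain). -/
def bmo (b : ℝ × ℝ → ℝ) : ENNReal :=
  ⨆ (x : ℝ × ℝ) (r : Set.Ioc (0 : ℝ) 2),
    (MeasureTheory.volume (Metric.ball x (r : ℝ)))⁻¹ *
      ∫⁻ y in Metric.ball x (r : ℝ),
        ENNReal.ofReal |b y - ⨍ z in Metric.ball x (r : ℝ), b z|

/-! ### Periodic functions and integrals over squares -/

def Sq (a : ℝ × ℝ) (L : ℝ) : Set (ℝ × ℝ) := Set.Ioc a.1 (a.1 + L) ×ˢ Set.Ioc a.2 (a.2 + L)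

lemma lint1_shift (h : ℝ → ENNReal) (hp : ∀ x, h (x + 1) = h x) (a : ℝ) :
    ∫⁻ x in Set.Ioc a (a + 1), h x = ∫⁻ x in Set.Ioc 0 1, h x := by
  have h1 := (isAddFundamentalDomain_Ioc (T := 1) one_pos a volume)
  have h2 := (isAddFundamentalDomain_Ioc (T := 1) one_pos 0 volume)
  rw [zero_add] at h2
  refine h1.setLIntegral_eq h2 h ?_
  rintro ⟨g, hg⟩ x
  obtain ⟨n, rfl⟩ := AddSubgroup.mem_zmultiples_iff.mp hg
  have hper : Function.Periodic h 1 := hp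
  have := hper.int_mul n x
  simp only [AddSubgroup.vadd_def, vadd_eq_add, zsmul_eq_mul] at *
  rw [add_comm]; simpa using this

lemma lint1_nat (h : ℝ → ENNReal) (hp : ∀ x, h (x + 1) = h x) (a : ℝ) (m : ℕ) :
    ∫⁻ x in Set.Ioc a (a + m), h x = m * ∫⁻ x in Set.Ioc 0 1, h x := by
  induction m with
  | zero => simp
  | succ m ih =>
    have : Set.Ioc a (a + (m + 1 : ℕ)) = Set.Ioc a (a + m) ∪ Set.Ioc (a + m) (a + m + 1) := by
      rw [Set.Ioc_union_Ioc_eq_Ioc (by simp) (by simp)]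
      push_cast; ring_nf
    rw [this, lintegral_union measurableSet_Ioc, ih, lint1_shift h hp]
    · push_cast; ring
    · rw [Set.Ioc_disjoint_Ioc]; simp

lemma Q2_ae : Q2 =ᵐ[volume] Sq 0 1 := by
  unfold Q2 Sq
  simp only [Prod.fst_zero, Prod.snd_zero, zero_add]
  exact Measure.set_prod_ae_eq Ioo_ae_eq_Ioc Ioo_ae_eq_Ioc

lemma lint_Sq (φ : ℝ × ℝ → ENNReal) (hm : Measurable φ) (hp : Per φ) (a : ℝ × ℝ) (m : ℕ) :
    ∫⁻ x in Sq a m, φ x = (m : ENNReal) ^ 2 * ∫⁻ x in Q2, φ x := by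
  have key : ∀ (a : ℝ × ℝ) (m : ℕ), ∫⁻ x in Sq a m, φ x =
      (m : ENNReal) ^ 2 * ∫⁻ x in Set.Ioc (0:ℝ) 1, ∫⁻ y in Set.Ioc (0:ℝ) 1, φ (x, y) := by
    intro a m
    unfold Sq
    rw [Measure.volume_eq_prod, ← Measure.prod_restrict, lintegral_prod _ hm.aemeasurable]
    have h1 : ∀ x, ∫⁻ y in Set.Ioc a.2 (a.2 + m), φ (x, y) =
        m * ∫⁻ y in Set.Ioc (0:ℝ) 1, φ (x, y) := fun x =>
      lint1_nat (fun y => φ (x, y)) (fun y => hp.2 (x, y)) a.2 m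
    simp only [h1]
    rw [lintegral_const_mul' _ _ (by simp), lint1_nat (fun x => ∫⁻ y in Set.Ioc (0:ℝ) 1, φ (x, y))]
    · ring
    · intro x
      refine lintegral_congr fun y => hp.1 (x, y)
  rw [key, setLIntegral_congr Q2_ae]
  have := key 0 1
  simp only [Nat.cast_one, one_pow, one_mul] at this
  rw [this]

lemma cb_eq (a : ℝ × ℝ) (r : ℝ) : Metric.closedBall a r =
    Set.Icc (a.1 - r) (a.1 + r) ×ˢ Set.Icc (a.2 - r) (a.2 + r) := by
  rw [← Real.closedBall_eq_Icc, ← Real.closedBall_eq_Icc, closedBall_prod_same]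

lemma cb_ae (a : ℝ × ℝ) (r : ℝ) :
    Metric.closedBall a r =ᵐ[volume] Sq (a.1 - r, a.2 - r) (2 * r) := by
  rw [cb_eq]; unfold Sq
  have e1 : a.1 - r + 2 * r = a.1 + r := by ring
  have e2 : a.2 - r + 2 * r = a.2 + r := by ring
  simp only [e1, e2]
  exact Measure.set_prod_ae_eq Ioc_ae_eq_Icc.symm Ioc_ae_eq_Icc.symm

lemma vol_cb (a : ℝ × ℝ) (r : ℝ) (hr : 0 ≤ r) :
    volume (Metric.closedBall a r) = ENNReal.ofReal ((2 * r) ^ 2) := by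
  rw [cb_eq, Measure.volume_eq_prod, Measure.prod_prod, Real.volume_Icc, Real.volume_Icc,
    ← ENNReal.ofReal_mul (by linarith)]
  congr 1; ring

lemma vol_cb_real (a : ℝ × ℝ) (r : ℝ) (hr : 0 ≤ r) :
    volume.real (Metric.closedBall a r) = (2 * r) ^ 2 := by
  rw [measureReal_def, vol_cb a r hr, ENNReal.toReal_ofReal (by positivity)]

lemma cb_ball_ae (a : ℝ × ℝ) (r : ℝ) :
    Metric.ball a r =ᵐ[volume] Metric.closedBall a r := by
  rcases le_or_gt r 0 with h | h
  · rcases h.eq_or_lt with rfl | h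
    · simp only [Metric.ball_zero, Metric.closedBall_zero]
      exact (MeasureTheory.ae_eq_empty.mpr (by simp)).symm
    · rw [Metric.ball_eq_empty.mpr h.le, Metric.closedBall_eq_empty.mpr h]
      exact Filter.EventuallyEq.rfl
  · refine ae_eq_of_subset_of_measure_ge Metric.ball_subset_closedBall ?_
      measurableSet_ball.nullMeasurableSet (by rw [vol_cb a r h.le]; simp)
    rw [Measure.addHaar_closedBall_eq_addHaar_ball]

lemma lint_cb_nat (φ : ℝ × ℝ → ENNReal) (hm : Measurable φ) (hp : Per φ) (a : ℝ × ℝ) (m : ℕ) :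
    ∫⁻ x in Metric.closedBall a m, φ x = (4 * (m : ENNReal) ^ 2) * ∫⁻ x in Q2, φ x := by
  rw [setLIntegral_congr (cb_ae a m)]
  have := lint_Sq φ hm hp (a.1 - m, a.2 - m) (2 * m)
  push_cast at this
  rw [this]; ring

lemma lint_cb_half (φ : ℝ × ℝ → ENNReal) (hm : Measurable φ) (hp : Per φ) (a : ℝ × ℝ) :
    ∫⁻ x in Metric.closedBall a (1/2), φ x = ∫⁻ x in Q2, φ x := by
  rw [setLIntegral_congr (cb_ae a (1/2))]
  have := lint_Sq φ hm hp (a.1 - 1/2, a.2 - 1/2) 1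
  norm_num at this
  norm_num [this]

lemma intg_cb {F : Type*} [NormedAddCommGroup F] {h : ℝ × ℝ → F} (hc : Continuous h)
    (a : ℝ × ℝ) (r : ℝ) : IntegrableOn h (Metric.closedBall a r) :=
  hc.continuousOn.integrableOn_compact (isCompact_closedBall a r)

lemma Q2_sub : Q2 ⊆ Metric.closedBall (1/2, 1/2) (1/2) := by
  intro x hx
  rw [cb_eq]
  obtain ⟨⟨h1, h2⟩, ⟨h3, h4⟩⟩ := hx
  constructor <;> constructor <;> norm_num <;> linarith

lemma Q2_meas : MeasurableSet Q2 := measurableSet_Ioo.prod measurableSet_Ioo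

lemma intg_Q2 {F : Type*} [NormedAddCommGroup F] {h : ℝ × ℝ → F} (hc : Continuous h) :
    IntegrableOn h Q2 := (intg_cb hc _ _).mono_set Q2_sub

lemma vol_Q2 : volume Q2 = 1 := by
  unfold Q2
  rw [Measure.volume_eq_prod, Measure.prod_prod]; simp

instance : IsProbabilityMeasure (volume.restrict Q2 : Measure (ℝ × ℝ)) :=
  ⟨by rw [Measure.restrict_apply_univ, vol_Q2]⟩

lemma int_cb_half {h : ℝ × ℝ → ℝ} (hc : Continuous h) (hp : Per h) (h0 : ∀ x, 0 ≤ h x)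
    (a : ℝ × ℝ) : ∫ x in Metric.closedBall a (1/2), h x = ∫ x in Q2, h x := by
  rw [integral_eq_lintegral_of_nonneg_ae (ae_of_all _ h0) hc.aestronglyMeasurable,
    integral_eq_lintegral_of_nonneg_ae (ae_of_all _ h0) hc.aestronglyMeasurable,
    lint_cb_half (fun x => ENNReal.ofReal (h x)) (by fun_prop)
      ⟨fun x => by simp only [hp.1 x], fun x => by simp only [hp.2 x]⟩]

lemma int_cb_nat {h : ℝ × ℝ → ℝ} (hc : Continuous h) (hp : Per h) (h0 : ∀ x, 0 ≤ h x)
    (a : ℝ × ℝ) (m : ℕ) :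
    ∫ x in Metric.closedBall a m, h x = (4 * (m:ℝ)^2) * ∫ x in Q2, h x := by
  rw [integral_eq_lintegral_of_nonneg_ae (ae_of_all _ h0) hc.aestronglyMeasurable,
    integral_eq_lintegral_of_nonneg_ae (ae_of_all _ h0) hc.aestronglyMeasurable,
    lint_cb_nat (fun x => ENNReal.ofReal (h x)) (by fun_prop)
      ⟨fun x => by simp only [hp.1 x], fun x => by simp only [hp.2 x]⟩]
  simp [ENNReal.toReal_mul]

lemma int_cb_mono {h : ℝ × ℝ → ℝ} (hc : Continuous h) (h0 : ∀ x, 0 ≤ h x)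
    {s : Set (ℝ × ℝ)} {a : ℝ × ℝ} {r : ℝ} (hs : s ⊆ Metric.closedBall a r) :
    ∫ x in s, h x ≤ ∫ x in Metric.closedBall a r, h x :=
  setIntegral_mono_set (intg_cb hc a r) (ae_of_all _ h0) (Filter.Eventually.of_forall hs)

/-- Shift invariance of the integral over the torus. -/
lemma intQ2_eq {h : ℝ × ℝ → ℂ} (hc : Continuous h) :
    ∫ x in Q2, h x = ∫ x in (0:ℝ)..1, ∫ y in (0:ℝ)..1, h (x, y) := by
  have : IntegrableOn h (Set.Ioc (0:ℝ) 1 ×ˢ Set.Ioc (0:ℝ) 1) (volume.prod volume) := by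
    have := (intg_Q2 hc).congr_set_ae Q2_ae.symm
    simpa [Sq, Measure.volume_eq_prod] using this
  rw [setIntegral_congr_set Q2_ae]
  unfold Sq
  simp only [Prod.fst_zero, Prod.snd_zero, zero_add]
  rw [Measure.volume_eq_prod, setIntegral_prod _ this]
  simp [intervalIntegral.integral_of_le]

lemma intQ2_shift {h : ℝ × ℝ → ℂ} (hc : Continuous h) (hp : Per h) (z : ℝ × ℝ) :
    ∫ x in Q2, h (x + z) = ∫ x in Q2, h x := by
  have key : ∀ (g : ℝ → ℂ), (∀ x, g (x + 1) = g x) → ∀ c : ℝ,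
      ∫ x in (0:ℝ)..1, g (x + c) = ∫ x in (0:ℝ)..1, g x := by
    intro g hg c
    rw [intervalIntegral.integral_comp_add_right]
    have := Function.Periodic.intervalIntegral_add_eq (f := g) (T := 1) hg c 0
    rw [zero_add] at this ⊢
    rw [add_comm 1 c, this]
  rw [intQ2_eq hc, intQ2_eq (h := fun x => h (x + z)) (by fun_prop)]
  have h2 : ∀ x : ℝ, ∫ y in (0:ℝ)..1, h ((x, y) + z) = ∫ y in (0:ℝ)..1, h (x + z.1, y) :=
    fun x => key (fun y => h (x + z.1, y)) (fun y => hp.2 (x + z.1, y)) z.2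
  simp only [h2]
  exact key (fun x => ∫ y in (0:ℝ)..1, h (x, y)) (fun x => by simp only [hp.1 (x, _)]) z.1

/-- A continuous periodic function is bounded. -/
lemma per_reduce {α : Type*} {h : ℝ × ℝ → α} (hp : Per h) (x : ℝ × ℝ) :
    h x = h (Int.fract x.1, Int.fract x.2) := by
  have h1 : ∀ y : ℝ, Function.Periodic (fun x => h (x, y)) 1 := fun y x => hp.1 (x, y)
  have h2 : ∀ x : ℝ, Function.Periodic (fun y => h (x, y)) 1 := fun x y => hp.2 (x, y)
  have e1 := (h1 x.2).sub_int_mul_eq ⌊x.1⌋ (x := x.1)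
  have e2 := (h2 (Int.fract x.1)).sub_int_mul_eq ⌊x.2⌋ (x := x.2)
  simp only [mul_one] at e1 e2
  rw [show x.1 - ⌊x.1⌋ = Int.fract x.1 from rfl] at e1
  rw [show x.2 - ⌊x.2⌋ = Int.fract x.2 from rfl] at e2
  rw [e2, e1]

lemma per_bdd {F : Type*} [NormedAddCommGroup F] {h : ℝ × ℝ → F} (hc : Continuous h)
    (hp : Per h) : ∃ B, 0 ≤ B ∧ ∀ x, ‖h x‖ ≤ B := by
  obtain ⟨B, hB⟩ := (isCompact_closedBall ((0:ℝ),(0:ℝ)) 1).exists_bound_of_continuousOn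
    hc.continuousOn
  refine ⟨max B 0, le_max_right _ _, fun x => ?_⟩
  rw [per_reduce hp x]
  refine (hB _ ?_).trans (le_max_left _ _)
  rw [cb_eq]
  have := Int.fract_nonneg x.1
  have := (Int.fract_lt_one x.1).le
  have := Int.fract_nonneg x.2
  have := (Int.fract_lt_one x.2).le
  constructor <;> constructor <;> norm_num <;> linarith

/-! ### Abstract dyadic Fefferman-Stein inequality -/

structure Dy {X : Type*} [MeasurableSpace X] (μ : Measure X) where
  D : ℕ → X → Set X
  mem : ∀ k x, x ∈ D k x
  eq : ∀ k x y, y ∈ D k x → D k y = D k x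
  sub : ∀ k x, D (k + 1) x ⊆ D k x
  meas : ∀ k x, MeasurableSet (D k x)
  cnt : ∀ k, (Set.range (D k)).Countable
  pos : ∀ k x, μ (D k x) ≠ 0
  fin : ∀ k x, μ (D k x) ≠ ⊤
  dbl : ∀ k x, μ (D k x) ≤ 4 * μ (D (k + 1) x)

namespace Dy
variable {X : Type*} [MeasurableSpace X] {μ : Measure X} (d : Dy μ)

lemma sub_le {m k : ℕ} (h : m ≤ k) (x : X) : d.D k x ⊆ d.D m x := by
  induction k, h using Nat.le_induction with
  | base => exact subset_rfl
  | succ k _ ih => exact (d.sub k x).trans ih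

lemma eq_le {m k : ℕ} (h : m ≤ k) {x y : X} (hy : y ∈ d.D k x) : d.D m y = d.D m x :=
  d.eq m x y (d.sub_le h x hy)

lemma stp0 (W : Set X) (τ : X → ℕ)
    (hst : ∀ x ∈ W, ∀ y ∈ d.D (τ x) x, y ∈ W ∧ τ y = τ x) (B : Set X) (ν₁ ν₂ : Measure X)
    (h : ∀ x ∈ W, ν₁ (B ∩ d.D (τ x) x) ≤ ν₂ (d.D (τ x) x)) : ν₁ (B ∩ W) ≤ ν₂ W := by
  set P : X → Set X := fun x => d.D (τ x) x with hP
  have hcount : (P '' W).Countable := by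
    refine Set.Countable.mono ?_ (Set.countable_iUnion d.cnt)
    rintro _ ⟨x, _, rfl⟩
    exact Set.mem_iUnion.mpr ⟨τ x, x, rfl⟩
  have hW : W = ⋃ C ∈ P '' W, C := by
    ext x
    simp only [Set.mem_iUnion, Set.mem_image, exists_prop, exists_exists_and_eq_and]
    exact ⟨fun hx => ⟨x, hx, d.mem _ _⟩, fun ⟨y, hy, hxy⟩ => (hst y hy x hxy).1⟩
  have hdisj : (P '' W).PairwiseDisjoint id := by
    rintro _ ⟨x, hx, rfl⟩ _ ⟨y, hy, rfl⟩ hne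
    rw [Function.onFun, Set.disjoint_left]
    intro z hzx hzy
    apply hne
    have e1 : τ z = τ x := (hst x hx z hzx).2
    have e2 : τ z = τ y := (hst y hy z hzy).2
    have a1 : d.D (τ x) z = d.D (τ x) x := d.eq _ _ _ hzx
    have a2 : d.D (τ y) z = d.D (τ y) y := d.eq _ _ _ hzy
    simp only [hP]
    rw [← a1, ← a2, ← e1, ← e2]
  have hmeas : ∀ C ∈ P '' W, MeasurableSet C := by
    rintro _ ⟨x, _, rfl⟩; exact d.meas _ _
  calc ν₁ (B ∩ W) = ν₁ (⋃ C ∈ P '' W, B ∩ C) := by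
        conv_lhs => rw [hW]
        rw [Set.inter_iUnion₂]
    _ ≤ ∑' C : (P '' W), ν₁ (B ∩ C) := measure_biUnion_le _ hcount _
    _ ≤ ∑' C : (P '' W), ν₂ C := by
        refine ENNReal.tsum_le_tsum ?_
        rintro ⟨_, x, hx, rfl⟩
        exact h x hx
    _ = ν₂ (⋃ C ∈ P '' W, C) := (measure_biUnion hcount hdisj hmeas).symm
    _ = ν₂ W := by rw [← hW]

/-- dyadic averages -/
def A (h : X → ENNReal) (k : ℕ) (x : X) : ENNReal := (μ (d.D k x))⁻¹ * ∫⁻ y in d.D k x, h y ∂μ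

lemma A_eq (h : X → ENNReal) {m k : ℕ} (hmk : m ≤ k) {x y : X} (hy : y ∈ d.D k x) :
    d.A h m y = d.A h m x := by unfold A; rw [d.eq_le hmk hy]

lemma A_mul (h : X → ENNReal) (k : ℕ) (x : X) :
    d.A h k x * μ (d.D k x) = ∫⁻ y in d.D k x, h y ∂μ := by
  unfold A
  rw [mul_comm, ← mul_assoc, ENNReal.mul_inv_cancel (d.pos k x) (d.fin k x), one_mul]

lemma A_meas (h : X → ENNReal) (k : ℕ) : Measurable (d.A h k) := by
  intro S _
  have : d.A h k ⁻¹' S = ⋃ C ∈ {C ∈ Set.range (d.D k) | C ⊆ d.A h k ⁻¹' S}, C := by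
    ext x
    simp only [Set.mem_iUnion, Set.mem_setOf_eq, exists_prop]
    constructor
    · intro hx
      refine ⟨d.D k x, ⟨⟨x, rfl⟩, fun y hy => ?_⟩, d.mem k x⟩
      rw [Set.mem_preimage, d.A_eq h le_rfl hy]; exact hx
    · rintro ⟨C, ⟨_, hC⟩, hx⟩; exact hC hx
  rw [this]
  refine MeasurableSet.biUnion ((d.cnt k).mono (Set.sep_subset _ _)) ?_
  rintro _ ⟨⟨x, rfl⟩, _⟩
  exact d.meas k x

lemma weak (h : X → ENNReal) (t : ENNReal) (k₀ : ℕ) (x₀ : X) :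
    t * μ {y ∈ d.D k₀ x₀ | ∃ m, k₀ ≤ m ∧ t < d.A h m y} ≤ ∫⁻ y in d.D k₀ x₀, h y ∂μ := by
  classical
  set W := {y ∈ d.D k₀ x₀ | ∃ m, k₀ ≤ m ∧ t < d.A h m y} with hW
  let τ : X → ℕ := fun y => if hy : ∃ m, k₀ ≤ m ∧ t < d.A h m y then Nat.find hy else 0
  have hτ : ∀ x ∈ W, k₀ ≤ τ x ∧ t < d.A h (τ x) x := by
    intro x hx
    have := Nat.find_spec hx.2
    simp only [τ, dif_pos hx.2]; exact this
  have hst : ∀ x ∈ W, ∀ y ∈ d.D (τ x) x, y ∈ W ∧ τ y = τ x := by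
    intro x hx y hy
    have hyC : y ∈ d.D k₀ x₀ := by
      rw [← d.eq k₀ x₀ x hx.1]; exact d.sub_le (hτ x hx).1 x hy
    have hAt : t < d.A h (τ x) y := by rw [d.A_eq h le_rfl hy]; exact (hτ x hx).2
    have hex : ∃ m, k₀ ≤ m ∧ t < d.A h m y := ⟨τ x, (hτ x hx).1, hAt⟩
    refine ⟨⟨hyC, hex⟩, ?_⟩
    have hy' : τ y = Nat.find hex := by simp only [τ, dif_pos hex]
    have hx' : τ x = Nat.find hx.2 := by simp only [τ, dif_pos hx.2]
    rw [hy', Nat.find_eq_iff]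
    refine ⟨⟨(hτ x hx).1, hAt⟩, fun n hn hcon => ?_⟩
    rw [d.A_eq h hn.le hy] at hcon
    rw [hx'] at hn
    exact Nat.find_min hx.2 hn hcon
  have := d.stp0 W τ hst Set.univ (t • μ) (μ.withDensity h) ?_
  · rw [Set.univ_inter, Measure.smul_apply, smul_eq_mul] at this
    refine this.trans ((measure_mono fun y hy => hy.1).trans ?_)
    rw [withDensity_apply _ (d.meas _ _)]
  · intro x hx
    rw [Set.univ_inter, Measure.smul_apply, smul_eq_mul, withDensity_apply _ (d.meas _ _),
      ← d.A_mul]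
    gcongr
    exact (hτ x hx).2.le

lemma goodl (x₀ : X) (g : X → ℂ) (hg : Measurable g) (v : X → ENNReal)
    (hv0 : ∀ z ∈ d.D 0 x₀, ∫⁻ y in d.D 0 x₀, ‖g y‖ₑ ∂μ ≤ v z * μ (d.D 0 x₀))
    (hv : ∀ k, ∀ x ∈ d.D 0 x₀, ∃ c : ℂ, ∀ z ∈ d.D k x,
      ∫⁻ y in d.D k x, ‖g y - c‖ₑ ∂μ ≤ v z * μ (d.D k x))
    (t γ : ENNReal) (ht : t ≠ 0) (ht' : t ≠ ⊤) (hγ : γ ≤ 1) :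
    μ {x ∈ d.D 0 x₀ | 4 * t < (⨆ k, d.A (fun y => ‖g y‖ₑ) k x) ∧ v x ≤ γ * t} ≤
      2 * γ * μ {x ∈ d.D 0 x₀ | t < ⨆ k, d.A (fun y => ‖g y‖ₑ) k x} := by
  classical
  set G : X → ENNReal := fun y => ‖g y‖ₑ with hG
  set B := {x ∈ d.D 0 x₀ | 4 * t < (⨆ k, d.A G k x) ∧ v x ≤ γ * t} with hB
  set W := {x ∈ d.D 0 x₀ | t < ⨆ k, d.A G k x} with hW
  have hBW : B ⊆ W := fun x hx => ⟨hx.1, lt_of_le_of_lt (le_mul_of_one_le_left' (by norm_num)) hx.2.1⟩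
  have hγ' : γ * t ≤ t := mul_le_of_le_one_left' hγ
  let τ : X → ℕ := fun y => if hy : ∃ m, t < d.A G m y then Nat.find hy else 0
  have hex : ∀ x ∈ W, ∃ m, t < d.A G m x := fun x hx => lt_iSup_iff.mp hx.2
  have hτ : ∀ x ∈ W, t < d.A G (τ x) x := by
    intro x hx
    have := Nat.find_spec (hex x hx)
    simp only [τ, dif_pos (hex x hx)]; exact this
  have hτmin : ∀ x ∈ W, ∀ m < τ x, d.A G m x ≤ t := by
    intro x hx m hm
    simp only [τ, dif_pos (hex x hx)] at hm
    exact not_lt.mp (Nat.find_min (hex x hx) hm)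
  have hst : ∀ x ∈ W, ∀ y ∈ d.D (τ x) x, y ∈ W ∧ τ y = τ x := by
    intro x hx y hy
    have hyC : y ∈ d.D 0 x₀ := by
      rw [← d.eq 0 x₀ x hx.1]; exact d.sub_le (Nat.zero_le _) x hy
    have hAt : t < d.A G (τ x) y := by rw [d.A_eq G le_rfl hy]; exact hτ x hx
    have hyW : y ∈ W := ⟨hyC, lt_iSup_iff.mpr ⟨_, hAt⟩⟩
    refine ⟨hyW, le_antisymm ?_ ?_⟩
    · by_contra hlt
      exact absurd (hτmin y hyW _ (not_le.mp hlt)) (not_le.mpr hAt)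
    · by_contra hlt
      have := hτmin x hx _ (not_le.mp hlt)
      rw [← d.A_eq G (not_le.mp hlt).le hy] at this
      exact absurd this (not_le.mpr (hτ y hyW))
  have := d.stp0 W τ hst B μ ((2 * γ) • μ) ?_
  · rwa [Set.inter_eq_left.mpr hBW, Measure.smul_apply, smul_eq_mul] at this
  intro x hx
  rw [Measure.smul_apply, smul_eq_mul]
  rcases Set.eq_empty_or_nonempty (B ∩ d.D (τ x) x) with he | ⟨z, hzB, hzC⟩
  · rw [he]; simp
  have hτpos : τ x ≠ 0 := by
    intro h0
    have h1 := hτ x hx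
    rw [h0] at h1
    have h2 := hv0 z hzB.1
    rw [← d.eq 0 x₀ x hx.1, ← d.A_mul] at h2
    have h3 := (ENNReal.mul_le_mul_iff_left (d.pos 0 x) (d.fin 0 x)).mp h2
    exact absurd (h3.trans (hzB.2.2.trans hγ')) (not_le.mpr h1)
  obtain ⟨k, hk⟩ := Nat.exists_eq_succ_of_ne_zero hτpos
  rw [hk] at hzC ⊢
  obtain ⟨c, hc⟩ := hv k x hx.1
  have hzP : z ∈ d.D k x := d.sub k x hzC
  have hc1 := (hc z hzP).trans (mul_le_mul_left hzB.2.2 _)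
  have hAk : d.A G k x ≤ t := hτmin x hx k (by rw [hk]; exact Nat.lt_succ_self k)
  have hcn : ‖c‖ₑ ≤ 2 * t := by
    have h1 : ‖c‖ₑ * μ (d.D k x) ≤ (2 * t) * μ (d.D k x) := by
      calc ‖c‖ₑ * μ (d.D k x) = ∫⁻ y in d.D k x, ‖c‖ₑ ∂μ := by simp
        _ ≤ ∫⁻ y in d.D k x, (‖g y‖ₑ + ‖g y - c‖ₑ) ∂μ := by
            refine lintegral_mono fun y => ?_
            calc ‖c‖ₑ = ‖g y - (g y - c)‖ₑ := by congr 1; ring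
              _ ≤ _ := enorm_sub_le
        _ = d.A G k x * μ (d.D k x) + ∫⁻ y in d.D k x, ‖g y - c‖ₑ ∂μ := by
            rw [lintegral_add_left hg.enorm, d.A_mul]
        _ ≤ t * μ (d.D k x) + γ * t * μ (d.D k x) := by gcongr
        _ ≤ t * μ (d.D k x) + t * μ (d.D k x) := by gcongr
        _ = _ := by ring
    exact (ENNReal.mul_le_mul_iff_left (d.pos k x) (d.fin k x)).mp h1
  have hsub : B ∩ d.D (k+1) x ⊆
      {y ∈ d.D (k+1) x | ∃ m, k + 1 ≤ m ∧ 2 * t < d.A (fun y => ‖g y - c‖ₑ) m y} := by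
    rintro y ⟨hyB, hyC⟩
    refine ⟨hyC, ?_⟩
    obtain ⟨m, hm⟩ := lt_iSup_iff.mp hyB.2.1
    have hτy : τ y = k + 1 := by rw [(hst x hx y (by rw [hk]; exact hyC)).2, hk]
    refine ⟨m, ?_, ?_⟩
    · by_contra hlt
      have := hτmin y (hBW hyB) m (by omega)
      have h4 : t ≤ 4 * t := le_mul_of_one_le_left' (by norm_num)
      exact absurd (this.trans h4) (not_le.mpr hm)
    · have h5 : d.A G m y ≤ d.A (fun y => ‖g y - c‖ₑ) m y + ‖c‖ₑ := by
        unfold A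
        calc _ ≤ (μ (d.D m y))⁻¹ * (∫⁻ z in d.D m y, (‖g z - c‖ₑ + ‖c‖ₑ) ∂μ) := by
              gcongr with z
              calc ‖g z‖ₑ = ‖(g z - c) + c‖ₑ := by congr 1; ring
                _ ≤ _ := enorm_add_le _ _
          _ = _ := by
              rw [lintegral_add_right _ measurable_const, mul_add]
              congr 1
              rw [setLIntegral_const, mul_comm, mul_assoc,
                ENNReal.mul_inv_cancel (d.pos m y) (d.fin m y), mul_one]
      by_contra hcon
      have h6 := h5.trans (add_le_add (not_lt.mp hcon) hcn)
      rw [← add_mul] at h6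
      norm_num at h6
      exact absurd h6 (not_le.mpr hm)
  have h2t : (2 * t) ≠ 0 := by simp [ht]
  have h2t' : (2 * t) ≠ ⊤ := ENNReal.mul_ne_top (by simp) ht'
  refine (ENNReal.mul_le_mul_iff_right h2t h2t').mp ?_
  calc 2 * t * μ (B ∩ d.D (k+1) x) ≤ _ := mul_le_mul_right (measure_mono hsub) _
    _ ≤ ∫⁻ y in d.D (k+1) x, ‖g y - c‖ₑ ∂μ := d.weak _ _ _ _
    _ ≤ ∫⁻ y in d.D k x, ‖g y - c‖ₑ ∂μ := lintegral_mono_set (d.sub k x)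
    _ ≤ γ * t * μ (d.D k x) := hc1
    _ ≤ γ * t * (4 * μ (d.D (k+1) x)) := by gcongr; exact d.dbl k x
    _ = 2 * t * (2 * γ * μ (d.D (k+1) x)) := by ring

end Dy

lemma goodlam {X : Type*} [MeasurableSpace X] (μ : Measure X) [IsFiniteMeasure μ]
    (U V : X → ℝ) (hU : Measurable U) (hV : Measurable V) (hU0 : ∀ x, 0 ≤ U x)
    (hV0 : ∀ x, 0 ≤ V x) (B : ℝ) (hB : ∀ᵐ x ∂μ, U x ≤ B) (p γ : ℝ) (hp : 0 < p) (hγ : 0 < γ)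
    (h : ∀ t : ℝ, 0 < t → μ {x | 4 * t < U x ∧ V x ≤ γ * t} ≤
      ENNReal.ofReal (4 ^ (-p) / 2) * μ {x | t < U x}) :
    ∫⁻ x, ENNReal.ofReal (U x ^ p) ∂μ ≤
      ENNReal.ofReal (2 * 4 ^ p * γ ^ (-p)) * ∫⁻ x, ENNReal.ofReal (V x ^ p) ∂μ := by
  set I := ∫⁻ x, ENNReal.ofReal (U x ^ p) ∂μ with hI
  set J := ∫⁻ x, ENNReal.ofReal (V x ^ p) ∂μ with hJ
  have hIfin : I ≠ ⊤ := by
    have : I ≤ ∫⁻ x, ENNReal.ofReal (B ^ p) ∂μ := by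
      refine lintegral_mono_ae ?_
      filter_upwards [hB] with x hx
      exact ENNReal.ofReal_le_ofReal (Real.rpow_le_rpow (hU0 x) hx hp.le)
    refine ne_top_of_le_ne_top ?_ this
    rw [lintegral_const]
    exact ENNReal.mul_ne_top (by simp) (measure_ne_top _ _)
  have e1 := lintegral_rpow_eq_lintegral_meas_lt_mul μ (f := fun x => U x / 4)
    (ae_of_all _ fun x => by have := hU0 x; simp only [Pi.zero_apply]; positivity) (by fun_prop) hp
  have e2 := lintegral_rpow_eq_lintegral_meas_lt_mul μ (f := U) (ae_of_all _ hU0) (by fun_prop) hp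
  have e3 := lintegral_rpow_eq_lintegral_meas_lt_mul μ (f := fun x => V x / γ)
    (ae_of_all _ fun x => by have := hV0 x; simp only [Pi.zero_apply]; positivity) (by fun_prop) hp
  have l1 : ∫⁻ x, ENNReal.ofReal ((U x / 4) ^ p) ∂μ = ENNReal.ofReal (4 ^ (-p)) * I := by
    rw [hI, ← lintegral_const_mul _ (by fun_prop)]
    refine lintegral_congr fun x => ?_
    rw [← ENNReal.ofReal_mul (by positivity), Real.div_rpow (hU0 x) (by norm_num),
      Real.rpow_neg (by norm_num)]
    congr 1; ring
  have l3 : ∫⁻ x, ENNReal.ofReal ((V x / γ) ^ p) ∂μ = ENNReal.ofReal (γ ^ (-p)) * J := by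
    rw [hJ, ← lintegral_const_mul _ (by fun_prop)]
    refine lintegral_congr fun x => ?_
    rw [← ENNReal.ofReal_mul (by positivity), Real.div_rpow (hV0 x) hγ.le,
      Real.rpow_neg hγ.le]
    congr 1; ring
  have main : ENNReal.ofReal (4 ^ (-p)) * I ≤
      ENNReal.ofReal (4 ^ (-p) / 2) * I + ENNReal.ofReal (γ ^ (-p)) * J := by
    rw [← l1, ← l3, e1, hI, e2, e3, mul_left_comm, ← mul_add]
    gcongr
    rw [← lintegral_const_mul', ← lintegral_add_left']
    · refine setLIntegral_mono' measurableSet_Ioi fun t ht => ?_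
      rw [← mul_assoc, ← add_mul]
      gcongr
      have hsub : {x | t < U x / 4} ⊆ {x | 4 * t < U x ∧ V x ≤ γ * t} ∪ {x | t < V x / γ} := by
        intro x hx
        simp only [Set.mem_setOf_eq, Set.mem_union] at *
        rcases le_or_gt (V x) (γ * t) with h1 | h1
        · left; exact ⟨by linarith, h1⟩
        · right; rw [lt_div_iff₀ hγ]; linarith
      exact (measure_mono hsub).trans ((measure_union_le _ _).trans (by gcongr; exact h t ht))
    · refine AEMeasurable.const_mul (AEMeasurable.mul ?_ (by fun_prop)) _
      refine Measurable.aemeasurable ?_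
      exact Antitone.measurable fun s t hst => measure_mono fun x hx => lt_of_le_of_lt hst hx
    · simp
  set a := (4:ℝ) ^ (-p) with ha
  have ha0 : 0 < a := by positivity
  have hsplit : ENNReal.ofReal a * I = ENNReal.ofReal (a/2) * I + ENNReal.ofReal (a/2) * I := by
    rw [← add_mul, ← ENNReal.ofReal_add (by positivity) (by positivity)]; congr 2; ring
  rw [hsplit] at main
  have hne : ENNReal.ofReal (a/2) * I ≠ ⊤ := ENNReal.mul_ne_top (by simp) hIfin
  have m2 := (ENNReal.add_le_add_iff_left hne).mp main
  have h4 : (4:ℝ) ^ p = a⁻¹ := by rw [ha, Real.rpow_neg (by norm_num), inv_inv]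
  calc I = ENNReal.ofReal (2 * 4 ^ p) * (ENNReal.ofReal (a/2) * I) := by
        rw [← mul_assoc, ← ENNReal.ofReal_mul (by positivity), h4]
        have : 2 * a⁻¹ * (a/2) = 1 := by field_simp
        rw [this]; simp
    _ ≤ ENNReal.ofReal (2 * 4 ^ p) * (ENNReal.ofReal (γ ^ (-p)) * J) := by gcongr
    _ = _ := by rw [← mul_assoc, ← ENNReal.ofReal_mul (by positivity)]

/-! ### Fefferman-Stein on squares -/

def ISq (c : ℝ × ℝ) (r : ℝ) : Set (ℝ × ℝ) :=
  Set.Ico (c.1 - r) (c.1 + r) ×ˢ Set.Ico (c.2 - r) (c.2 + r)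

lemma ISq_ae (c : ℝ × ℝ) (r : ℝ) : ISq c r =ᵐ[volume] Metric.closedBall c r := by
  rw [cb_eq]; exact Measure.set_prod_ae_eq Ico_ae_eq_Icc Ico_ae_eq_Icc

lemma ISq_closure (c : ℝ × ℝ) (r : ℝ) (hr : 0 < r) : closure (ISq c r) = Metric.closedBall c r := by
  rw [cb_eq]; unfold ISq
  rw [closure_prod_eq, closure_Ico (by linarith), closure_Ico (by linarith)]

lemma ISq_sub (c : ℝ × ℝ) (r : ℝ) : ISq c r ⊆ Metric.closedBall c r := by
  rw [cb_eq]; exact Set.prod_mono Set.Ico_subset_Icc_self Set.Ico_subset_Icc_self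

lemma ISq_vol (c : ℝ × ℝ) (r : ℝ) (hr : 0 ≤ r) : volume (ISq c r) = ENNReal.ofReal ((2 * r) ^ 2) := by
  rw [measure_congr (ISq_ae c r), vol_cb c r hr]

def fl (α L : ℝ) (k : ℕ) (x : ℝ) : ℤ := ⌊(2:ℝ) ^ k * ((x - α) / L)⌋

lemma fl_sub (α L : ℝ) (k : ℕ) (x y : ℝ) (h : fl α L (k + 1) y = fl α L (k + 1) x) :
    fl α L k y = fl α L k x := by
  have key : ∀ z : ℝ, fl α L k z = fl α L (k + 1) z / 2 := by
    intro z
    unfold fl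
    have := Int.floor_div_natCast ((2:ℝ) ^ (k+1) * ((z - α) / L)) 2
    rw [show ((2:ℕ):ℤ) = 2 from rfl] at this
    rw [← this]
    congr 1
    push_cast
    ring
  rw [key, key, h]

def Dk (α : ℝ × ℝ) (L : ℝ) (k : ℕ) (x : ℝ × ℝ) : Set (ℝ × ℝ) :=
  {y | fl α.1 L k y.1 = fl α.1 L k x.1 ∧ fl α.2 L k y.2 = fl α.2 L k x.2}

def ctr (α : ℝ × ℝ) (L : ℝ) (k : ℕ) (x : ℝ × ℝ) : ℝ × ℝ :=
  (α.1 + L / 2 ^ k * (fl α.1 L k x.1 + 1/2), α.2 + L / 2 ^ k * (fl α.2 L k x.2 + 1/2))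

lemma fl_iff (α L : ℝ) (hL : 0 < L) (k : ℕ) (i : ℤ) (y : ℝ) : fl α L k y = i ↔
    y ∈ Set.Ico (α + L / 2 ^ k * (i + 1/2) - L / 2 ^ (k+1)) (α + L / 2 ^ k * (i + 1/2) + L / 2 ^ (k+1)) := by
  unfold fl
  rw [Int.floor_eq_iff, Set.mem_Ico]
  have h2 : (0:ℝ) < 2 ^ k := by positivity
  set w := (2:ℝ) ^ k * ((y - α) / L) with hw
  have hy : y = α + L / 2 ^ k * w := by rw [hw]; field_simp; ring
  have hk : L / 2 ^ (k+1) = L / 2 ^ k * (1/2) := by rw [pow_succ]; field_simp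
  rw [hy, hk]
  have hl : 0 < L / 2 ^ k := by positivity
  constructor
  · rintro ⟨h1, h2⟩; constructor <;> nlinarith
  · rintro ⟨h1, h2⟩; constructor
    · by_contra hh; nlinarith
    · by_contra hh; nlinarith

lemma Dk_eq (α : ℝ × ℝ) (L : ℝ) (hL : 0 < L) (k : ℕ) (x : ℝ × ℝ) :
    Dk α L k x = ISq (ctr α L k x) (L / 2 ^ (k+1)) := by
  ext y
  unfold Dk ISq ctr
  simp only [Set.mem_prod]
  rw [← fl_iff α.1 L hL, ← fl_iff α.2 L hL]
  rfl

def dy2 (α : ℝ × ℝ) (L : ℝ) (hL : 0 < L) : Dy (volume : Measure (ℝ × ℝ)) where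
  D := Dk α L
  mem k x := ⟨rfl, rfl⟩
  eq k x y h := by
    ext z
    unfold Dk
    simp only [Set.mem_setOf_eq]
    rw [h.1, h.2]
  sub k x y h := ⟨fl_sub _ _ _ _ _ h.1, fl_sub _ _ _ _ _ h.2⟩
  meas k x := by
    rw [Dk_eq _ _ hL]; exact measurableSet_Ico.prod measurableSet_Ico
  cnt k := by
    refine (Set.countable_range (fun i : ℤ × ℤ =>
      {y : ℝ × ℝ | fl α.1 L k y.1 = i.1 ∧ fl α.2 L k y.2 = i.2})).mono ?_
    rintro _ ⟨x, rfl⟩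
    exact ⟨(fl α.1 L k x.1, fl α.2 L k x.2), rfl⟩
  pos k x := by
    rw [Dk_eq _ _ hL, ISq_vol _ _ (by positivity)]
    have : 0 < (2 * (L / 2 ^ (k+1))) ^ 2 := by positivity
    simp only [ne_eq, ENNReal.ofReal_eq_zero, not_le]; exact this
  fin k x := by rw [Dk_eq _ _ hL, ISq_vol _ _ (by positivity)]; simp
  dbl k x := by
    rw [Dk_eq _ _ hL, ISq_vol _ _ (by positivity), Dk_eq _ _ hL, ISq_vol _ _ (by positivity)]
    rw [show (4:ENNReal) = ENNReal.ofReal 4 by simp, ← ENNReal.ofReal_mul (by norm_num)]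
    apply ENNReal.ofReal_le_ofReal
    rw [pow_succ 2 (k+1)]
    apply le_of_eq; field_simp; norm_num

lemma ofReal_int_cb {g : ℝ × ℝ → ℂ} (hg : Continuous g) (a : ℝ × ℝ) (r : ℝ) :
    ∫⁻ y in Metric.closedBall a r, ‖g y‖ₑ = ENNReal.ofReal (∫ y in Metric.closedBall a r, ‖g y‖) := by
  rw [ofReal_integral_norm_eq_lintegral_enorm (intg_cb hg a r)]

theorem FS (p : ℝ) (hp : 0 < p) : ∃ C : ℝ, 0 < C ∧ ∀ (a : ℝ × ℝ) (R : ℝ), 0 < R →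
    ∀ g : ℝ × ℝ → ℂ, Continuous g → ∀ v : ℝ × ℝ → ℝ, Measurable v → (∀ x, 0 ≤ v x) →
    (∀ z ∈ Metric.closedBall a R, ∫ y in Metric.closedBall a R, ‖g y‖ ≤ v z * (2 * R) ^ 2) →
    (∀ a' r, 0 < r → Metric.closedBall a' r ⊆ Metric.closedBall a R → ∃ c : ℂ,
      ∀ z ∈ Metric.closedBall a' r,
        ∫ y in Metric.closedBall a' r, ‖g y - c‖ ≤ v z * (2 * r) ^ 2) →
    ∫⁻ x in Metric.closedBall a R, ENNReal.ofReal (‖g x‖ ^ p) ≤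
      ENNReal.ofReal C * ∫⁻ x in Metric.closedBall a R, ENNReal.ofReal (v x ^ p) := by
  set γ : ℝ := 4 ^ (-p) / 4 with hγ
  have hγ0 : 0 < γ := by positivity
  have hγ1 : γ ≤ 1 := by
    have : (4:ℝ) ^ (-p) ≤ 1 := Real.rpow_le_one_of_one_le_of_nonpos (by norm_num) (by linarith)
    rw [hγ]; linarith
  refine ⟨2 * 4 ^ p * γ ^ (-p), by positivity, ?_⟩
  intro a R hR g hg v hvm hv0 H0 H
  set d := dy2 (a.1 - R, a.2 - R) (2 * R) (by positivity) with hd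
  have hD : ∀ k x, d.D k x = ISq (ctr (a.1 - R, a.2 - R) (2 * R) k x) (2 * R / 2 ^ (k+1)) :=
    fun k x => Dk_eq _ _ (by positivity) k x
  have hD0 : d.D 0 a = ISq a R := by
    rw [hD]
    have f1 : ∀ t : ℝ, fl (t - R) (2 * R) 0 t = 0 := by
      intro t; rw [fl_iff _ _ (by positivity)]
      constructor <;> norm_num <;> linarith
    unfold ctr
    simp only [f1]
    congr 1
    · ext <;> norm_num <;> ring
    · norm_num
  set Q := d.D 0 a with hQ
  have hQae : Q =ᵐ[volume] Metric.closedBall a R := by rw [hD0]; exact ISq_ae a R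
  have hQm : MeasurableSet Q := d.meas 0 a
  have hQsub : Q ⊆ Metric.closedBall a R := by rw [hD0]; exact ISq_sub a R
  have hQvol : volume Q = ENNReal.ofReal ((2 * R) ^ 2) := by rw [hD0]; exact ISq_vol a R hR.le
  obtain ⟨M, hM⟩ := (isCompact_closedBall a R).exists_bound_of_continuousOn hg.continuousOn
  set u : ℝ × ℝ → ENNReal := fun x => ⨆ k, d.A (fun y => ‖g y‖ₑ) k x with hu
  have hum : Measurable u := Measurable.iSup fun k => d.A_meas _ k
  have hsubQ : ∀ k, ∀ x ∈ Q, d.D k x ⊆ Q := fun k x hx => by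
    rw [hQ, ← d.eq 0 a x hx]; exact d.sub_le (Nat.zero_le k) x
  have hub : ∀ x ∈ Q, u x ≤ ENNReal.ofReal M := by
    intro x hx
    refine iSup_le fun k => ?_
    refine (ENNReal.mul_le_mul_iff_left (d.pos k x) (d.fin k x)).mp ?_
    rw [d.A_mul, ← setLIntegral_const]
    refine setLIntegral_mono' (d.meas k x) fun y hy => ?_
    rw [← ofReal_norm]
    exact ENNReal.ofReal_le_ofReal (hM y (hQsub (hsubQ k x hx hy)))
  have hgu : ∀ x ∈ Q, ‖g x‖ ≤ (u x).toReal := by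
    intro x hx
    have hfin : u x ≠ ⊤ := ne_top_of_le_ne_top (by simp) (hub x hx)
    refine le_of_forall_pos_le_add fun ε hε => ?_
    obtain ⟨δ, hδ, hball⟩ := Metric.continuousAt_iff.mp (hg.norm.continuousAt (x := x)) ε hε
    obtain ⟨k, hk⟩ := exists_pow_lt_of_lt_one (show 0 < δ / (2 * R) by positivity)
      (show (1/2 : ℝ) < 1 by norm_num)
    have hsmall : ∀ y ∈ d.D k x, ‖g x‖ - ε ≤ ‖g y‖ := by
      intro y hy
      have hxm := d.mem k x
      have hr : 2 * R / 2 ^ (k+1) + 2 * R / 2 ^ (k+1) < δ := by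
        rw [lt_div_iff₀ (by positivity)] at hk
        calc _ = (1/2)^k * (2 * R) := by rw [pow_succ, one_div_pow]; field_simp; norm_num
          _ < δ := hk
      rw [hD] at hy hxm
      have h1 := ISq_sub _ _ hy
      have h2 := ISq_sub _ _ hxm
      rw [Metric.mem_closedBall] at h1 h2
      have h3 : dist y x < δ := by
        refine (dist_triangle_right y x _).trans_lt (lt_of_le_of_lt (add_le_add h1 h2) hr)
      have := hball h3
      rw [Real.dist_eq, abs_lt] at this
      linarith [this.1]
    have h1 : ENNReal.ofReal (‖g x‖ - ε) ≤ u x := by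
      refine le_trans ?_ (le_iSup _ k)
      refine (ENNReal.mul_le_mul_iff_left (d.pos k x) (d.fin k x)).mp ?_
      rw [d.A_mul, ← setLIntegral_const]
      refine setLIntegral_mono' (d.meas k x) fun y hy => ?_
      rw [← ofReal_norm]
      exact ENNReal.ofReal_le_ofReal (hsmall y hy)
    have h2 := (ENNReal.ofReal_le_iff_le_toReal hfin).mp h1
    linarith
  have hfinite : IsFiniteMeasure (volume.restrict Q : Measure (ℝ × ℝ)) :=
    ⟨by rw [Measure.restrict_apply_univ, hQvol]; simp⟩
  have key := goodlam (volume.restrict Q) (fun x => (u x).toReal) v hum.ennreal_toReal hvm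
    (fun x => ENNReal.toReal_nonneg) hv0 (max M 0) ?_ p γ hp hγ0 ?_
  · rw [← setLIntegral_congr hQae, ← setLIntegral_congr hQae]
    refine le_trans ?_ key
    refine setLIntegral_mono' hQm fun x hx => ?_
    exact ENNReal.ofReal_le_ofReal (Real.rpow_le_rpow (norm_nonneg _) (hgu x hx) hp.le)
  · filter_upwards [ae_restrict_mem hQm] with x hx
    refine ENNReal.toReal_le_of_le_ofReal (le_max_right _ _) ((hub x hx).trans ?_)
    exact ENNReal.ofReal_le_ofReal (le_max_left _ _)
  · intro t ht
    have gl := d.goodl a g hg.measurable (fun x => ENNReal.ofReal (v x)) ?_ ?_ (ENNReal.ofReal t)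
      (ENNReal.ofReal γ) (by simpa using ht) (by simp) (by simpa using hγ1)
    · have hconst : ENNReal.ofReal (4 ^ (-p) / 2) = 2 * ENNReal.ofReal γ := by
        rw [show (2:ENNReal) = ENNReal.ofReal 2 by simp, ← ENNReal.ofReal_mul (by norm_num), hγ]
        congr 1; ring
      have m1 : MeasurableSet {x | 4 * t < (u x).toReal ∧ v x ≤ γ * t} :=
        (measurableSet_lt measurable_const hum.ennreal_toReal).inter
          (measurableSet_le hvm measurable_const)
      have m2 : MeasurableSet {x | t < (u x).toReal} :=
        measurableSet_lt measurable_const hum.ennreal_toReal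
      rw [Measure.restrict_apply m1, Measure.restrict_apply m2, hconst]
      refine le_trans (measure_mono ?_) (gl.trans ?_)
      · rintro x ⟨⟨h1, h2⟩, hx⟩
        refine ⟨hx, ?_, ?_⟩
        · have hfin : u x ≠ ⊤ := ne_top_of_le_ne_top (by simp) (hub x hx)
          rw [show (4:ENNReal) = ENNReal.ofReal 4 by simp, ← ENNReal.ofReal_mul (by norm_num)]
          exact (ENNReal.ofReal_lt_iff_lt_toReal (by positivity) hfin).mpr h1
        · rw [← ENNReal.ofReal_mul hγ0.le]
          exact ENNReal.ofReal_le_ofReal h2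
      · gcongr
        rintro x ⟨hx, h1⟩
        have hfin : u x ≠ ⊤ := ne_top_of_le_ne_top (by simp) (hub x hx)
        exact ⟨(ENNReal.ofReal_lt_iff_lt_toReal ht.le hfin).mp h1, hx⟩
    · intro z hz
      rw [← hQ, hQvol, setLIntegral_congr hQae, ofReal_int_cb hg, ← ENNReal.ofReal_mul (hv0 z)]
      exact ENNReal.ofReal_le_ofReal (H0 z (hQsub hz))
    · intro k x hx
      have hcb : Metric.closedBall (ctr (a.1 - R, a.2 - R) (2 * R) k x) (2 * R / 2 ^ (k+1)) ⊆
          Metric.closedBall a R := by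
        rw [← ISq_closure _ _ (by positivity), ← ISq_closure a R hR, ← hD, ← hD0]
        exact closure_mono (hsubQ k x hx)
      obtain ⟨c, hc⟩ := H _ _ (by positivity) hcb
      refine ⟨c, fun z hz => ?_⟩
      rw [hD] at hz ⊢
      have hz' := ISq_sub _ _ hz
      rw [ISq_vol _ _ (by positivity), setLIntegral_congr (ISq_ae _ _),
        ofReal_int_cb (g := fun y => g y - c) (by fun_prop), ← ENNReal.ofReal_mul (hv0 z)]
      exact ENNReal.ofReal_le_ofReal (hc z hz')

def MM (φ : ℝ × ℝ → ENNReal) (x : ℝ × ℝ) : ENNReal :=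
  ⨆ k : ℕ, (volume (Metric.closedBall x ((1/2 : ℝ)^k)))⁻¹ *
    ∫⁻ y in Metric.closedBall x ((1/2 : ℝ)^k), φ y

lemma cb_pos (x : ℝ × ℝ) {r : ℝ} (hr : 0 < r) : volume (Metric.closedBall x r) ≠ 0 := by
  rw [vol_cb x r hr.le]
  have : 0 < (2 * r)^2 := by positivity
  simp only [ne_eq, ENNReal.ofReal_eq_zero, not_le]; exact this

lemma cb_fin (x : ℝ × ℝ) {r : ℝ} : volume (Metric.closedBall x r) ≠ ⊤ :=
  measure_closedBall_lt_top.ne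

lemma MM_meas {φ : ℝ × ℝ → ENNReal} (hφ : Measurable φ) : Measurable (MM φ) := by
  unfold MM
  refine Measurable.iSup fun k => ?_
  have e : ∀ x : ℝ × ℝ, (volume (Metric.closedBall x ((1/2 : ℝ)^k)))⁻¹ =
      (ENNReal.ofReal ((2 * (1/2 : ℝ)^k)^2))⁻¹ := fun x => by rw [vol_cb x _ (by positivity)]
  simp_rw [e]
  refine Measurable.const_mul ?_ _
  have : ∀ x : ℝ × ℝ, ∫⁻ y in Metric.closedBall x ((1/2 : ℝ)^k), φ y =
      ∫⁻ y, (Set.indicator {q : (ℝ × ℝ) × (ℝ × ℝ) | dist q.2 q.1 ≤ (1/2 : ℝ)^k}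
        (fun q => φ q.2)) (x, y) := by
    intro x
    rw [← lintegral_indicator Metric.isClosed_closedBall.measurableSet]
    rfl
  simp_rw [this]
  refine Measurable.lintegral_prod_right ?_
  refine Measurable.indicator (hφ.comp measurable_snd) ?_
  exact (isClosed_le (by fun_prop) (by fun_prop)).measurableSet

lemma MM_le_one {φ : ℝ × ℝ → ENNReal} (x : ℝ × ℝ) (k : ℕ) :
    ∫⁻ y in Metric.closedBall x ((1/2 : ℝ)^k), φ y ≤
      volume (Metric.closedBall x ((1/2 : ℝ)^k)) * MM φ x := by
  have h : (volume (Metric.closedBall x ((1/2 : ℝ)^k)))⁻¹ *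
    ∫⁻ y in Metric.closedBall x ((1/2 : ℝ)^k), φ y ≤ MM φ x := le_iSup (fun k : ℕ =>
      (volume (Metric.closedBall x ((1/2 : ℝ)^k)))⁻¹ *
    ∫⁻ y in Metric.closedBall x ((1/2 : ℝ)^k), φ y) k
  calc _ = volume (Metric.closedBall x ((1/2 : ℝ)^k)) *
      ((volume (Metric.closedBall x ((1/2 : ℝ)^k)))⁻¹ *
    ∫⁻ y in Metric.closedBall x ((1/2 : ℝ)^k), φ y) := by
        rw [← mul_assoc, ENNReal.mul_inv_cancel (cb_pos x (by positivity)) (cb_fin x), one_mul]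
    _ ≤ _ := by gcongr

lemma MM_ball {φ : ℝ × ℝ → ENNReal} (hφ : Measurable φ) (hp : Per φ) (x : ℝ × ℝ) {r : ℝ}
    (hr : 0 < r) : ∫⁻ y in Metric.closedBall x r, φ y ≤ ENNReal.ofReal (4 * (2 * r)^2) * MM φ x := by
  rcases le_or_gt r 1 with h1 | h1
  · obtain ⟨k, hk1, hk2⟩ := exists_nat_pow_near_of_lt_one hr h1 (show (0:ℝ) < 1/2 by norm_num)
      (by norm_num)
    calc _ ≤ ∫⁻ y in Metric.closedBall x ((1/2 : ℝ)^k), φ y :=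
          lintegral_mono_set (Metric.closedBall_subset_closedBall hk2)
      _ ≤ _ := MM_le_one x k
      _ ≤ _ := by
        rw [vol_cb x _ (by positivity)]
        gcongr
        rw [pow_succ] at hk1
        have : 0 < (1/2 : ℝ)^k := by positivity
        nlinarith
  · have hm := Nat.ceil_lt_add_one hr.le
    have hm' := Nat.le_ceil r
    have h1 := MM_le_one (φ := φ) x 0
    rw [pow_zero] at h1
    have e1 := lint_cb_nat φ hφ hp x 1
    rw [Nat.cast_one] at e1
    rw [e1, vol_cb x 1 (by norm_num)] at h1
    have h2 : ∫⁻ x in Q2, φ x ≤ MM φ x := by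
      norm_num at h1
      exact (ENNReal.mul_le_mul_iff_right (by norm_num) (by norm_num)).mp h1
    calc _ ≤ ∫⁻ y in Metric.closedBall x (⌈r⌉₊ : ℝ), φ y :=
          lintegral_mono_set (Metric.closedBall_subset_closedBall hm')
      _ = _ := lint_cb_nat φ hφ hp x _
      _ ≤ ENNReal.ofReal (4 * (2 * r)^2) * MM φ x := by
        gcongr
        rw [show (4 * (⌈r⌉₊ : ENNReal)^2) = ENNReal.ofReal (4 * (⌈r⌉₊ : ℝ)^2) by
          rw [ENNReal.ofReal_mul (by norm_num), ENNReal.ofReal_pow (by positivity)]; simp]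
        apply ENNReal.ofReal_le_ofReal
        have : (⌈r⌉₊ : ℝ) ≤ 2 * r := by linarith
        have h0 : (0:ℝ) ≤ (⌈r⌉₊ : ℝ) := by positivity
        nlinarith

lemma MM_weak {φ : ℝ × ℝ → ENNReal} (hφ : Measurable φ) (hp : Per φ) (l : ENNReal)
    (hl : l ≠ 0) (hl' : l ≠ ⊤) :
    volume (Q2 ∩ {x | l < MM φ x}) ≤ 400 / l * ∫⁻ x in Q2, φ x := by
  let t : Set ((ℝ × ℝ) × ℕ) := {q | q.1 ∈ Q2 ∧ l * volume (Metric.closedBall q.1 ((1/2 : ℝ)^q.2)) ≤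
    ∫⁻ y in Metric.closedBall q.1 ((1/2 : ℝ)^q.2), φ y}
  obtain ⟨u, hut, hud, hcov⟩ := Vitali.exists_disjoint_subfamily_covering_enlargement_closedBall
    t (fun q => q.1) (fun q => (1/2 : ℝ)^q.2) 1
    (fun a _ => pow_le_one₀ (by norm_num) (by norm_num)) 5 (by norm_num)
  have hcnt : u.Countable := hud.countable_of_nonempty_interior (fun i _ => by
    have hpos : (0:ℝ) < (1/2)^i.2 := by positivity
    rw [interior_closedBall _ hpos.ne']
    exact ⟨i.1, Metric.mem_ball_self hpos⟩)
  have hsub : Q2 ∩ {x | l < MM φ x} ⊆ ⋃ b ∈ u, Metric.closedBall b.1 (5 * (1/2 : ℝ)^b.2) := by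
    rintro x ⟨hx, hl⟩
    have hl : l < MM φ x := hl
    unfold MM at hl
    obtain ⟨k, hk⟩ := lt_iSup_iff.mp hl
    have hxt : (x, k) ∈ t := by
      refine ⟨hx, ?_⟩
      have := mul_le_mul_left hk.le (volume (Metric.closedBall x ((1/2 : ℝ)^k)))
      refine this.trans ?_
      rw [mul_comm _ (lintegral _ _), mul_assoc,
        ENNReal.inv_mul_cancel (cb_pos x (by positivity)) (cb_fin x), mul_one]
    obtain ⟨b, hb, hbs⟩ := hcov _ hxt
    exact Set.mem_biUnion hb (hbs (Metric.mem_closedBall_self (by positivity)))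
  have hsub2 : (⋃ b ∈ u, Metric.closedBall b.1 ((1/2 : ℝ)^b.2)) ⊆
      Metric.closedBall ((1/2 : ℝ), (1/2 : ℝ)) ((2:ℕ):ℝ) := by
    intro y hy
    simp only [Set.mem_iUnion] at hy
    obtain ⟨b, hb, hy⟩ := hy
    have h1 := Q2_sub (hut hb).1
    rw [Metric.mem_closedBall] at *
    have h2 : (1/2 : ℝ)^b.2 ≤ 1 := pow_le_one₀ (by norm_num) (by norm_num)
    have := dist_triangle y b.1 (1/2, 1/2)
    push_cast
    linarith
  have key : l * volume (Q2 ∩ {x | l < MM φ x}) ≤ 400 * ∫⁻ x in Q2, φ x := by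
    calc _ ≤ l * volume (⋃ b ∈ u, Metric.closedBall b.1 (5 * (1/2 : ℝ)^b.2)) := by gcongr
      _ ≤ l * ∑' b : u, volume (Metric.closedBall b.1.1 (5 * (1/2 : ℝ)^b.1.2)) := by
        gcongr; exact measure_biUnion_le _ hcnt _
      _ ≤ ∑' b : u, 25 * ∫⁻ y in Metric.closedBall b.1.1 ((1/2 : ℝ)^b.1.2), φ y := by
        rw [← ENNReal.tsum_mul_left]
        refine ENNReal.tsum_le_tsum fun b => ?_
        have := (hut b.2).2
        calc _ = 25 * (l * volume (Metric.closedBall b.1.1 ((1/2 : ℝ)^b.1.2))) := by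
              rw [vol_cb _ _ (by positivity), vol_cb _ _ (by positivity),
                show (2 * (5 * (1/2 : ℝ)^b.1.2))^2 = 25 * (2 * (1/2 : ℝ)^b.1.2)^2 by ring,
                ENNReal.ofReal_mul (by norm_num)]
              rw [show ENNReal.ofReal 25 = 25 by simp]; ring
          _ ≤ _ := by gcongr
      _ = 25 * ∫⁻ y in (⋃ b ∈ u, Metric.closedBall b.1 ((1/2 : ℝ)^b.2)), φ y := by
        rw [ENNReal.tsum_mul_left, lintegral_biUnion hcnt
          (fun i _ => Metric.isClosed_closedBall.measurableSet) hud]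
      _ ≤ 25 * ∫⁻ y in Metric.closedBall ((1/2 : ℝ), (1/2 : ℝ)) ((2:ℕ):ℝ), φ y := by
        gcongr
      _ = _ := by
        rw [lint_cb_nat φ hφ hp, ← mul_assoc]; congr 1; norm_num
  rw [mul_comm] at key
  have := (ENNReal.le_div_iff_mul_le (Or.inl hl) (Or.inl hl')).mpr key
  rwa [ENNReal.mul_div_right_comm] at this

lemma MM_split {φ : ℝ × ℝ → ENNReal} (hφ : Measurable φ) (l : ENNReal) (x : ℝ × ℝ) :
    MM φ x ≤ MM (Set.indicator {y | l < φ y} φ) x + l := by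
  refine iSup_le fun k => ?_
  have hm : MeasurableSet {y | l < φ y} := measurableSet_lt measurable_const hφ
  calc _ ≤ (volume (Metric.closedBall x ((1/2 : ℝ)^k)))⁻¹ *
        (∫⁻ y in Metric.closedBall x ((1/2 : ℝ)^k), (Set.indicator {y | l < φ y} φ y + l)) := by
        gcongr with y
        by_cases h : l < φ y
        · rw [Set.indicator_of_mem (by exact h)]; exact le_self_add
        · rw [Set.indicator_of_notMem (by exact h)]; simpa using h
    _ = (volume (Metric.closedBall x ((1/2 : ℝ)^k)))⁻¹ *
        (∫⁻ y in Metric.closedBall x ((1/2 : ℝ)^k), (Set.indicator {y | l < φ y} φ y)) + l := by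
        rw [lintegral_add_right _ measurable_const, setLIntegral_const, mul_add, mul_comm l,
          ← mul_assoc, ENNReal.inv_mul_cancel (cb_pos x (by positivity)) (cb_fin x), one_mul]
    _ ≤ _ := by
        gcongr
        exact le_iSup (fun k : ℕ => (volume (Metric.closedBall x ((1/2 : ℝ)^k)))⁻¹ *
          ∫⁻ y in Metric.closedBall x ((1/2 : ℝ)^k), (Set.indicator {y | l < φ y} φ y)) k

def MR (h : ℝ × ℝ → ℝ) (x : ℝ × ℝ) : ℝ := (MM (fun y => ENNReal.ofReal (h y)) x).toReal

lemma MR_nonneg (h : ℝ × ℝ → ℝ) (x : ℝ × ℝ) : 0 ≤ MR h x := ENNReal.toReal_nonneg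

lemma MR_meas {h : ℝ × ℝ → ℝ} (hc : Continuous h) : Measurable (MR h) :=
  (MM_meas (by fun_prop)).ennreal_toReal

lemma MM_fin {h : ℝ × ℝ → ℝ} (hc : Continuous h) (hp : Per h) (x : ℝ × ℝ) :
    MM (fun y => ENNReal.ofReal (h y)) x ≠ ⊤ := by
  obtain ⟨B, hB0, hB⟩ := per_bdd hc hp
  refine ne_top_of_le_ne_top (ENNReal.ofReal_ne_top (r := B)) (iSup_le fun k => ?_)
  calc _ ≤ (volume (Metric.closedBall x ((1/2 : ℝ)^k)))⁻¹ *
      ∫⁻ y in Metric.closedBall x ((1/2 : ℝ)^k), ENNReal.ofReal B := by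
        gcongr with y; exact ENNReal.ofReal_le_ofReal ((le_abs_self _).trans (hB y))
    _ = _ := by
      rw [setLIntegral_const, mul_comm (ENNReal.ofReal B), ← mul_assoc,
        ENNReal.inv_mul_cancel (cb_pos x (by positivity)) (cb_fin x), one_mul]

lemma Per.comp {α β : Type*} {h : ℝ × ℝ → α} (hp : Per h) (F : α → β) : Per (fun x => F (h x)) :=
  ⟨fun x => congrArg F (hp.1 x), fun x => congrArg F (hp.2 x)⟩

lemma MR_ball {h : ℝ × ℝ → ℝ} (hc : Continuous h) (hp : Per h) (h0 : ∀ x, 0 ≤ h x)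
    (a : ℝ × ℝ) {r : ℝ} (hr : 0 < r) (z : ℝ × ℝ) (hz : z ∈ Metric.closedBall a r) :
    ∫ y in Metric.closedBall a r, h y ≤ 16 * (2 * r)^2 * MR h z := by
  have h1 : Metric.closedBall a r ⊆ Metric.closedBall z (2 * r) := by
    intro y hy
    rw [Metric.mem_closedBall] at *
    have := dist_triangle_right y z a
    linarith
  refine (int_cb_mono hc h0 h1).trans ?_
  rw [integral_eq_lintegral_of_nonneg_ae (ae_of_all _ h0) hc.aestronglyMeasurable]
  have h2 := MM_ball (φ := fun y => ENNReal.ofReal (h y)) (by fun_prop) (hp.comp _) z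
    (show 0 < 2 * r by positivity)
  refine (ENNReal.toReal_mono (ENNReal.mul_ne_top ENNReal.ofReal_ne_top (MM_fin hc hp z)) h2).trans ?_
  rw [ENNReal.toReal_mul, ENNReal.toReal_ofReal (by positivity)]
  apply le_of_eq; unfold MR; ring

theorem MR_strong (p : ℝ) (hp1 : 1 < p) : ∃ C : ℝ, 0 < C ∧ ∀ h : ℝ × ℝ → ℝ, Continuous h → Per h →
    (∀ x, 0 ≤ h x) → ∫⁻ x in Q2, ENNReal.ofReal (MR h x ^ p) ≤
      ENNReal.ofReal C * ∫⁻ x in Q2, ENNReal.ofReal (h x ^ p) := by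
  refine ⟨p * (800 * ((p-1)⁻¹ * 2 ^ (p-1))), by
    have : 0 < p - 1 := by linarith
    positivity, ?_⟩
  intro h hc hp h0
  have hp' : 0 < p - 1 := by linarith
  set φ : ℝ × ℝ → ENNReal := fun y => ENNReal.ofReal (h y) with hφ
  have hφm : Measurable φ := by fun_prop
  set μ : Measure (ℝ × ℝ) := volume.restrict Q2 with hμ
  set ν := μ.withDensity φ with hν
  have e1 := lintegral_rpow_eq_lintegral_meas_lt_mul μ (f := MR h)
    (Filter.Eventually.of_forall (MR_nonneg h)) (MR_meas hc).aemeasurable (show 0 < p by linarith)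
  have e2 := lintegral_rpow_eq_lintegral_meas_lt_mul ν (f := fun x => 2 * h x)
    (Filter.Eventually.of_forall (fun x => by have := h0 x; simp only [Pi.zero_apply]; positivity))
    (by fun_prop) hp'
  rw [e1]
  have step : ∀ t ∈ Set.Ioi (0:ℝ), μ {a | t < MR h a} * ENNReal.ofReal (t ^ (p-1)) ≤
      800 * (ν {a | t < 2 * h a} * ENNReal.ofReal (t ^ (p - 1 - 1))) := by
    intro t ht
    have ht : 0 < t := ht
    set S : Set (ℝ × ℝ) := {y | ENNReal.ofReal (t/2) < φ y} with hS
    have hSm : MeasurableSet S := measurableSet_lt measurable_const hφm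
    have hSe : S = {a | t < 2 * h a} := by
      ext y
      simp only [hS, hφ, Set.mem_ofPred_eq]
      rw [ENNReal.ofReal_lt_ofReal_iff_of_nonneg (by positivity)]
      constructor <;> intro h <;> linarith
    have hSp : Per (Set.indicator S φ) := by
      have : Per φ := hp.comp _
      have e : Set.indicator S φ = fun y => (fun a : ENNReal =>
          if ENNReal.ofReal (t/2) < a then a else 0) (φ y) := by
        ext y; simp [Set.indicator, hS]
      rw [e]; exact this.comp (fun a : ENNReal => if ENNReal.ofReal (t/2) < a then a else 0)
    have w := MM_weak (hφm.indicator hSm) hSp (ENNReal.ofReal (t/2))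
      (by simpa using ht) (by simp)
    have hm1 : MeasurableSet {a | t < MR h a} := measurableSet_lt measurable_const (MR_meas hc)
    have c1 : μ {a | t < MR h a} ≤ 400 / ENNReal.ofReal (t/2) * ν {a | t < 2 * h a} := by
      rw [hμ, Measure.restrict_apply hm1]
      refine (measure_mono ?_).trans (w.trans (le_of_eq ?_))
      · rintro x ⟨hx, hQ⟩
        refine ⟨hQ, ?_⟩
        have hx : t < MR h x := hx
        have h2 : ENNReal.ofReal t < MM φ x :=
          (ENNReal.ofReal_lt_iff_lt_toReal ht.le (MM_fin hc hp x)).mpr hx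
        have h3 := h2.trans_le (MM_split hφm (ENNReal.ofReal (t/2)) x)
        by_contra h4
        have h4 : MM (Set.indicator S φ) x ≤ ENNReal.ofReal (t/2) := by
          simpa using h4
        refine absurd h3 (not_lt.mpr ?_)
        calc _ ≤ ENNReal.ofReal (t/2) + ENNReal.ofReal (t/2) := by gcongr
          _ = ENNReal.ofReal t := by
            rw [← ENNReal.ofReal_add (by positivity) (by positivity)]; congr 1; ring
      · rw [← hSe, hν, withDensity_apply _ hSm, lintegral_indicator hSm]
    calc _ ≤ 400 / ENNReal.ofReal (t/2) * ν {a | t < 2 * h a} * ENNReal.ofReal (t ^ (p-1)) := by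
          gcongr
      _ = (400 / ENNReal.ofReal (t/2) * ENNReal.ofReal (t ^ (p-1))) * ν {a | t < 2 * h a} := by ring
      _ = (800 * ENNReal.ofReal (t ^ (p-1-1))) * ν {a | t < 2 * h a} := by
          congr 1
          rw [show (400:ENNReal) = ENNReal.ofReal 400 by simp,
            show (800:ENNReal) = ENNReal.ofReal 800 by simp,
            ← ENNReal.ofReal_div_of_pos (by positivity), ← ENNReal.ofReal_mul (by positivity),
            ← ENNReal.ofReal_mul (by positivity), Real.rpow_sub_one ht.ne' (p-1)]
          congr 1; field_simp; norm_num
      _ = _ := by ring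
  have step2 : ∫⁻ t in Set.Ioi (0:ℝ), μ {a | t < MR h a} * ENNReal.ofReal (t ^ (p-1)) ≤
      800 * ∫⁻ t in Set.Ioi (0:ℝ), (ν {a | t < 2 * h a} * ENNReal.ofReal (t ^ (p - 1 - 1))) := by
    rw [← lintegral_const_mul' _ _ (by norm_num)]
    exact setLIntegral_mono' measurableSet_Ioi step
  have e3 : ∫⁻ t in Set.Ioi (0:ℝ), (ν {a | t < 2 * h a} * ENNReal.ofReal (t ^ (p - 1 - 1))) =
      ENNReal.ofReal ((p-1)⁻¹) * ∫⁻ x, ENNReal.ofReal ((2 * h x)^(p-1)) ∂ν := by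
    rw [e2, ← mul_assoc, ← ENNReal.ofReal_mul (by positivity), inv_mul_cancel₀ hp'.ne']
    simp
  have e4 : ∫⁻ x, ENNReal.ofReal ((2 * h x)^(p-1)) ∂ν =
      ENNReal.ofReal (2^(p-1)) * ∫⁻ x in Q2, ENNReal.ofReal (h x ^ p) := by
    rw [hν, lintegral_withDensity_eq_lintegral_mul _ hφm (by fun_prop),
      ← lintegral_const_mul' _ _ (by simp)]
    refine lintegral_congr fun x => ?_
    simp only [Pi.mul_apply, hφ]
    rw [← ENNReal.ofReal_mul (h0 x), ← ENNReal.ofReal_mul (by positivity)]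
    congr 1
    rw [Real.mul_rpow (by norm_num) (h0 x)]
    rcases (h0 x).eq_or_lt with h | h
    · rw [← h, Real.zero_rpow (by linarith : p ≠ 0)]; ring
    · rw [Real.rpow_sub_one h.ne']; field_simp
  rw [e3, e4] at step2
  calc _ ≤ ENNReal.ofReal p * (800 * (ENNReal.ofReal ((p-1)⁻¹) *
        (ENNReal.ofReal (2^(p-1)) * ∫⁻ x in Q2, ENNReal.ofReal (h x ^ p)))) := by gcongr
    _ = _ := by
      rw [ENNReal.ofReal_mul (by linarith), ENNReal.ofReal_mul (by norm_num),
        ENNReal.ofReal_mul (by positivity)]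
      rw [show ENNReal.ofReal 800 = 800 by simp]; ring

def av (b : ℝ × ℝ → ℝ) (a : ℝ × ℝ) (r : ℝ) : ℝ := ((2 * r)^2)⁻¹ * ∫ y in Metric.closedBall a r, b y

def HB (b : ℝ × ℝ → ℝ) (β : ℝ) : Prop :=
  ∀ (a : ℝ × ℝ) (r : ℝ), 0 < r → ∫ y in Metric.closedBall a r, |b y - av b a r| ≤ β * (2 * r)^2

lemma int_const_cb (c : ℝ) (a : ℝ × ℝ) {r : ℝ} (hr : 0 ≤ r) :
    ∫ _y in Metric.closedBall a r, c = c * (2 * r)^2 := by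
  rw [setIntegral_const, vol_cb_real a r hr, smul_eq_mul, mul_comm]

lemma av_sub {b : ℝ × ℝ → ℝ} (hb : Continuous b) (a : ℝ × ℝ) {r : ℝ} (hr : 0 < r) (c : ℝ) :
    (av b a r - c) * (2 * r)^2 = ∫ y in Metric.closedBall a r, (b y - c) := by
  rw [integral_sub (intg_cb hb a r) (intg_cb continuous_const a r), int_const_cb c a hr.le]
  unfold av
  field_simp

lemma av_abs {b : ℝ × ℝ → ℝ} (hb : Continuous b) (a : ℝ × ℝ) {r : ℝ} (hr : 0 < r) (c : ℝ) :
    |av b a r - c| * (2 * r)^2 ≤ ∫ y in Metric.closedBall a r, |b y - c| := by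
  have := norm_integral_le_integral_norm (μ := volume.restrict (Metric.closedBall a r))
    (fun y => b y - c)
  rw [← av_sub hb a hr c, norm_mul, Real.norm_eq_abs, Real.norm_of_nonneg (by positivity)] at this
  exact this

lemma osc_le {b : ℝ × ℝ → ℝ} (hb : Continuous b) (a : ℝ × ℝ) {r : ℝ} (hr : 0 < r) (c : ℝ) :
    ∫ y in Metric.closedBall a r, |b y - av b a r| ≤ 2 * ∫ y in Metric.closedBall a r, |b y - c| := by
  calc _ ≤ ∫ y in Metric.closedBall a r, (|b y - c| + |av b a r - c|) := by
        refine setIntegral_mono (intg_cb (by fun_prop) a r) (intg_cb (by fun_prop) a r) fun y => ?_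
        have := abs_sub_le (b y) c (av b a r)
        rwa [abs_sub_comm c] at this
    _ = (∫ y in Metric.closedBall a r, |b y - c|) + |av b a r - c| * (2 * r)^2 := by
        rw [integral_add (intg_cb (by fun_prop) a r) (intg_cb (by fun_prop) a r),
          int_const_cb _ a hr.le]
    _ ≤ _ := by linarith [av_abs hb a hr c]

lemma bmo_fin {b : ℝ × ℝ → ℝ} (hb : Continuous b) (hp : Per b) : bmo b ≠ ⊤ := by
  obtain ⟨B, hB0, hB⟩ := per_bdd hb hp
  refine ne_top_of_le_ne_top (ENNReal.ofReal_ne_top (r := B + B)) ?_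
  unfold bmo
  refine iSup_le fun x => iSup_le fun r => ?_
  have hr : 0 < (r:ℝ) := r.2.1
  have hav : |⨍ z in Metric.ball x (r : ℝ), b z| ≤ B := by
    rw [setAverage_eq, smul_eq_mul, abs_mul]
    have h1 := norm_setIntegral_le_of_norm_le_const (f := b) (C := B)
      (measure_ball_lt_top (μ := volume) (x := x) (r := (r:ℝ))) (fun y _ => hB y)
    have h2 : 0 < volume.real (Metric.ball x (r:ℝ)) :=
      ENNReal.toReal_pos (Metric.measure_ball_pos _ _ hr).ne' measure_ball_lt_top.ne
    rw [abs_of_pos (by positivity), inv_mul_le_iff₀ h2, mul_comm]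
    exact h1
  calc _ ≤ (volume (Metric.ball x (r:ℝ)))⁻¹ * ∫⁻ y in Metric.ball x (r:ℝ), ENNReal.ofReal (B + B) := by
        gcongr with y
        exact (abs_sub _ _).trans (add_le_add (hB y) hav)
    _ = _ := by
      rw [setLIntegral_const, mul_comm (ENNReal.ofReal _), ← mul_assoc,
        ENNReal.inv_mul_cancel (Metric.measure_ball_pos _ _ hr).ne' measure_ball_lt_top.ne, one_mul]

lemma HB_small {b : ℝ × ℝ → ℝ} (hb : Continuous b) (hp : Per b) (a : ℝ × ℝ) {r : ℝ} (hr : 0 < r)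
    (hr2 : r ≤ 2) :
    ∫ y in Metric.closedBall a r, |b y - av b a r| ≤ (bmo b).toReal * (2 * r)^2 := by
  have h1 : (volume (Metric.ball a r))⁻¹ *
      ∫⁻ y in Metric.ball a r, ENNReal.ofReal |b y - ⨍ z in Metric.ball a r, b z| ≤ bmo b := by
    unfold bmo
    exact le_iSup_of_le a (le_iSup_of_le (⟨r, hr, hr2⟩ : Set.Ioc (0:ℝ) 2) le_rfl)
  have h2 : ⨍ z in Metric.ball a r, b z = av b a r := by
    rw [setAverage_eq, setIntegral_congr_set (cb_ball_ae a r), measureReal_congr (cb_ball_ae a r),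
      vol_cb_real a r hr.le]; rfl
  rw [h2, setLIntegral_congr (cb_ball_ae a r), measure_congr (cb_ball_ae a r), mul_comm,
    ← div_eq_mul_inv, ENNReal.div_le_iff (cb_pos a hr) (cb_fin a), vol_cb a r hr.le] at h1
  rw [integral_eq_lintegral_of_nonneg_ae (ae_of_all _ fun y => abs_nonneg _)
    (by fun_prop)]
  refine (ENNReal.toReal_mono (ENNReal.mul_ne_top (bmo_fin hb hp) ENNReal.ofReal_ne_top) h1).trans ?_
  rw [ENNReal.toReal_mul, ENNReal.toReal_ofReal (by positivity)]

lemma HB_bmo {b : ℝ × ℝ → ℝ} (hb : Continuous b) (hp : Per b) : HB b (8 * (bmo b).toReal) := by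
  intro a r hr
  have hβ : 0 ≤ (bmo b).toReal := ENNReal.toReal_nonneg
  rcases le_or_gt r 2 with h | h
  · refine (HB_small hb hp a hr h).trans ?_
    gcongr; linarith
  · have h1 := HB_small hb hp a (show (0:ℝ) < 2 by norm_num) le_rfl
    set c := av b a 2 with hc
    have hpc : Per (fun y => |b y - c|) := hp.comp (fun t => |t - c|)
    have e1 := int_cb_nat (h := fun y => |b y - c|) (by fun_prop) hpc (fun y => abs_nonneg _) a 2
    have e2 := int_cb_nat (h := fun y => |b y - c|) (by fun_prop) hpc (fun y => abs_nonneg _) a ⌈r⌉₊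
    push_cast at e1
    rw [e1] at h1
    set I := ∫ y in Q2, |b y - c| with hI
    have hI1 : I ≤ (bmo b).toReal := by linarith
    have hm := Nat.ceil_lt_add_one hr.le
    have hm' := Nat.le_ceil r
    have e3 := int_cb_mono (h := fun y => |b y - c|) (by fun_prop) (fun y => abs_nonneg _)
      (Metric.closedBall_subset_closedBall (x := a) hm')
    refine (osc_le hb a hr c).trans ?_
    have hI0 : 0 ≤ I := integral_nonneg fun y => abs_nonneg _
    have : (⌈r⌉₊ : ℝ)^2 ≤ (2 * r)^2 := by
      apply pow_le_pow_left₀ (by positivity); linarith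
    rw [e2] at e3
    calc _ ≤ 2 * (4 * (⌈r⌉₊ : ℝ)^2 * I) := by linarith
      _ ≤ 2 * (4 * (2 * r)^2 * (bmo b).toReal) := by gcongr
      _ = _ := by ring

lemma int_of_lint {s : Set (ℝ × ℝ)} {h : ℝ × ℝ → ℝ} (hm : AEStronglyMeasurable h (volume.restrict s))
    (h0 : ∀ x, 0 ≤ h x) {A : ℝ} (hA : 0 ≤ A)
    (H : ∫⁻ x in s, ENNReal.ofReal (h x) ≤ ENNReal.ofReal A) : ∫ x in s, h x ≤ A := by
  rw [integral_eq_lintegral_of_nonneg_ae (ae_of_all _ h0) hm]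
  exact ENNReal.toReal_le_of_le_ofReal hA H

theorem JN (q : ℝ) (hq : 0 < q) : ∃ C : ℝ, 0 < C ∧ ∀ (b : ℝ × ℝ → ℝ) (β : ℝ), Continuous b → 0 ≤ β →
    HB b β → ∀ (a : ℝ × ℝ) (r : ℝ), 0 < r →
    ∫ y in Metric.closedBall a r, |b y - av b a r| ^ q ≤ C * β ^ q * (2 * r)^2 := by
  obtain ⟨C, hC, H⟩ := FS q hq
  refine ⟨C, hC, ?_⟩
  intro b β hb hβ hB a r hr
  have nrm : ∀ t : ℝ, ‖((t : ℝ) : ℂ)‖ = |t| := fun t => by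
    rw [Complex.norm_real, Real.norm_eq_abs]
  have := H a r hr (fun y => ((b y - av b a r : ℝ) : ℂ)) (by fun_prop) (fun _ => β)
    measurable_const (fun _ => hβ) ?_ ?_
  · refine int_of_lint (Continuous.aestronglyMeasurable
      ((continuous_abs.comp (by fun_prop)).rpow_const fun y => Or.inr hq.le))
      (fun y => Real.rpow_nonneg (abs_nonneg _) q) (by positivity) ?_
    simp only [nrm] at this
    refine this.trans (le_of_eq ?_)
    rw [setLIntegral_const, vol_cb a r hr.le, ← ENNReal.ofReal_mul (by positivity),
      ← ENNReal.ofReal_mul (by positivity), mul_assoc]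
  · intro z _
    simp only [nrm]
    exact hB a r hr
  · intro a' r' hr' _
    refine ⟨((av b a' r' - av b a r : ℝ) : ℂ), fun z _ => ?_⟩
    refine le_trans (le_of_eq ?_) (hB a' r' hr')
    congr 1; ext y
    rw [← Complex.ofReal_sub, nrm]; congr 1; ring

lemma av_chain {b : ℝ × ℝ → ℝ} {β : ℝ} (hb : Continuous b) (hB : HB b β) (a : ℝ × ℝ)
    {r : ℝ} (hr : 0 < r) (k : ℕ) : |av b a (2^k * r) - av b a r| ≤ 4 * k * β := by
  induction k with
  | zero => simp
  | succ k ih =>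
    have h1 := av_abs hb a (show 0 < 2^k * r by positivity) (av b a (2^(k+1) * r))
    have h2 := hB a (2^(k+1) * r) (by positivity)
    have h3 := int_cb_mono (h := fun y => |b y - av b a (2^(k+1) * r)|) (by fun_prop)
      (fun y => abs_nonneg _) (Metric.closedBall_subset_closedBall (x := a)
        (show 2^k * r ≤ 2^(k+1) * r by gcongr <;> norm_num))
    have h4 : |av b a (2^k * r) - av b a (2^(k+1) * r)| ≤ 4 * β := by
      have h5 := h1.trans (h3.trans h2)
      have h6 : (2 * (2^(k+1) * r))^2 = 4 * (2 * (2^k * r))^2 := by ring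
      rw [h6] at h5
      have h7 : 0 < (2 * (2^k * r))^2 := by positivity
      refine le_of_mul_le_mul_right (h5.trans (le_of_eq ?_)) h7
      ring
    have h5 := abs_sub_le (av b a (2^(k+1) * r)) (av b a (2^k * r)) (av b a r)
    rw [abs_sub_comm] at h4
    push_cast
    linarith

theorem JNk (q : ℝ) (hq : 0 < q) : ∃ C : ℝ, 0 < C ∧ ∀ (b : ℝ × ℝ → ℝ) (β : ℝ), Continuous b → 0 ≤ β →
    HB b β → ∀ (a : ℝ × ℝ) (r : ℝ), 0 < r → ∀ k : ℕ,
    ∫ y in Metric.closedBall a (2^k * r), |b y - av b a r| ^ q ≤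
      C * (β * (1 + k)) ^ q * (2 * (2^k * r))^2 := by
  obtain ⟨C, hC, H⟩ := JN q hq
  refine ⟨2^q * (C + 4^q), by positivity, ?_⟩
  intro b β hb hβ hB a r hr k
  have hr' : 0 < 2^k * r := by positivity
  have h1 := H b β hb hβ hB a _ hr'
  have h2 := av_chain hb hB a hr k
  have hpt : ∀ x y : ℝ, 0 ≤ x → 0 ≤ y → (x + y)^q ≤ 2^q * (x^q + y^q) := by
    intro x y hx hy
    calc (x+y)^q ≤ (2 * max x y)^q := by
          apply Real.rpow_le_rpow (by positivity) _ hq.le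
          linarith [le_max_left x y, le_max_right x y]
      _ = 2^q * (max x y)^q := Real.mul_rpow (by norm_num) (le_max_of_le_left hx)
      _ ≤ _ := by
        gcongr
        rcases max_cases x y with ⟨h, _⟩ | ⟨h, _⟩ <;> rw [h]
        · have := Real.rpow_nonneg hy q; linarith
        · have := Real.rpow_nonneg hx q; linarith
  have cq : ∀ c : ℝ, Continuous fun y => |b y - c|^q := fun c =>
    ((continuous_abs.comp (by fun_prop)).rpow_const fun y => Or.inr hq.le)
  calc _ ≤ ∫ y in Metric.closedBall a (2^k * r),
        2^q * (|b y - av b a (2^k * r)|^q + (4 * k * β)^q) := by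
        refine setIntegral_mono (intg_cb (cq _) _ _)
          (intg_cb (continuous_const.mul ((cq _).add continuous_const)) _ _) fun y => ?_
        refine le_trans ?_ (hpt _ _ (abs_nonneg _) (by positivity))
        apply Real.rpow_le_rpow (abs_nonneg _) _ hq.le
        have := abs_sub_le (b y) (av b a (2^k * r)) (av b a r)
        linarith
    _ = 2^q * ((∫ y in Metric.closedBall a (2^k * r), |b y - av b a (2^k * r)|^q) +
          (4 * k * β)^q * (2 * (2^k * r))^2) := by
        rw [integral_const_mul, integral_add (intg_cb (cq _) _ _) (intg_cb continuous_const _ _),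
          int_const_cb _ _ hr'.le]
    _ ≤ 2^q * (C * (β * (1 + k))^q * (2 * (2^k * r))^2 +
          4^q * (β * (1 + k))^q * (2 * (2^k * r))^2) := by
        have hk : (0:ℝ) ≤ k := Nat.cast_nonneg k
        have e1 : β ≤ β * (1 + k) := by nlinarith
        have e2 : 4 * k * β ≤ 4 * (β * (1 + k)) := by nlinarith
        rw [← Real.mul_rpow (by norm_num) (by positivity)]
        gcongr
        refine h1.trans ?_
        gcongr
    _ = _ := by ring

theorem HJN (s : ℝ) (hs : 1 < s) (e : ℝ) (he : 0 < e) : ∃ C : ℝ, 0 < C ∧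
    ∀ (b : ℝ × ℝ → ℝ) (β : ℝ), Continuous b → 0 ≤ β →
    HB b β → ∀ (a : ℝ × ℝ) (r : ℝ), 0 < r → ∀ k : ℕ, ∀ w : ℝ × ℝ → ℝ, Continuous w → Per w →
    (∀ x, 0 ≤ w x) → ∀ z ∈ Metric.closedBall a (2^k * r),
    ∫ y in Metric.closedBall a (2^k * r), |b y - av b a r| ^ e * w y ≤
      C * (β * (1 + k)) ^ e * (2 * (2^k * r))^2 * (MR (fun y => w y ^ s) z)^(1/s) := by
  set q := s / (s - 1) with hq
  have hs1 : 0 < s - 1 := by linarith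
  have hq0 : 0 < q := by positivity
  have hqs : q.HolderConjugate s := by
    have := (Real.HolderConjugate.conjExponent hs).symm
    exact this
  obtain ⟨C, hC, H⟩ := JNk (e * q) (by positivity)
  refine ⟨C^(1/q) * 16^(1/s), by positivity, ?_⟩
  intro b β hb hβ hB a r hr k w hw hwp hw0 z hz
  have hr' : 0 < 2^k * r := by positivity
  have ce : Continuous fun y => |b y - av b a r|^e :=
    ((continuous_abs.comp (by fun_prop)).rpow_const fun y => Or.inr he.le)
  have cw : Continuous fun y => w y ^ s := hw.rpow_const fun y => Or.inr (by linarith)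
  have memLp : ∀ (h : ℝ × ℝ → ℝ) (t : ENNReal), Continuous h →
      MemLp h t (volume.restrict (Metric.closedBall a (2^k * r))) := by
    intro h t hc
    have : IsFiniteMeasure (volume.restrict (Metric.closedBall a (2^k * r))) :=
      ⟨by simpa using measure_closedBall_lt_top⟩
    obtain ⟨M, hM⟩ := (isCompact_closedBall a (2^k * r)).exists_bound_of_continuousOn hc.continuousOn
    refine MemLp.of_bound hc.aestronglyMeasurable M ?_
    filter_upwards [ae_restrict_mem Metric.isClosed_closedBall.measurableSet] with y hy
    exact hM y hy
  have h1 := integral_mul_le_Lp_mul_Lq_of_nonneg hqs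
    (μ := volume.restrict (Metric.closedBall a (2^k * r)))
    (f := fun y => |b y - av b a r|^e) (g := w) (ae_of_all _ fun y => by positivity)
    (ae_of_all _ hw0) (memLp _ _ ce) (memLp _ _ hw)
  refine h1.trans ?_
  have h2 := H b β hb hβ hB a r hr k
  simp_rw [← Real.rpow_mul (abs_nonneg _)]
  have h3 := MR_ball cw (hwp.comp fun t => t^s) (fun x => Real.rpow_nonneg (hw0 x) s) a hr' z hz
  set V := (2 * (2^k * r))^2 with hV
  have hV0 : 0 < V := by positivity
  have hk : (0:ℝ) ≤ β * (1 + k) := by positivity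
  have hM0 := MR_nonneg (fun y => w y ^ s) z
  calc _ ≤ (C * (β * (1 + k)) ^ (e * q) * V)^(1/q) * (16 * V * MR (fun y => w y ^ s) z)^(1/s) := by
        have i1 : 0 ≤ ∫ y in Metric.closedBall a (2^k * r), |b y - av b a r| ^ (e * q) :=
          integral_nonneg fun y => Real.rpow_nonneg (abs_nonneg _) _
        have i2 : 0 ≤ ∫ y in Metric.closedBall a (2^k * r), w y ^ s :=
          integral_nonneg fun y => Real.rpow_nonneg (hw0 y) _
        gcongr
    _ = (C^(1/q) * 16^(1/s)) * (((β * (1 + k)) ^ (e * q))^(1/q)) * (V^(1/q) * V^(1/s)) *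
          (MR (fun y => w y ^ s) z)^(1/s) := by
        rw [Real.mul_rpow (by positivity) hV0.le, Real.mul_rpow hC.le (by positivity),
          Real.mul_rpow (by positivity) hM0, Real.mul_rpow (by norm_num) hV0.le]
        ring
    _ = _ := by
        rw [← Real.rpow_add hV0, ← Real.rpow_mul hk]
        have e1 : 1/q + 1/s = 1 := by
          have := hqs.inv_add_inv_eq_one; simpa [one_div] using this
        have e2 : e * q * (1/q) = e := by field_simp
        rw [e1, e2, Real.rpow_one]

def hh : ℕ → ℝ → ℝ
  | 0, t => Real.exp (-(t^2/4))
  | 1, t => -(t/2) * Real.exp (-(t^2/4))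
  | 2, t => (t^2/4 - 1/2) * Real.exp (-(t^2/4))
  | 3, t => (3*t/4 - t^3/8) * Real.exp (-(t^2/4))
  | _, _ => 0

lemma hh_deriv {α : ℕ} (hα : α ≤ 2) (t : ℝ) : HasDerivAt (hh α) (hh (α+1) t) t := by
  have e : HasDerivAt (fun t : ℝ => Real.exp (-(t^2/4))) (Real.exp (-(t^2/4)) * (-(t/2))) t := by
    have h1 : HasDerivAt (fun t : ℝ => -(t^2/4)) (-(t/2)) t := by
      have := ((hasDerivAt_pow 2 t).div_const 4).neg
      exact this.congr_deriv (by push_cast; ring)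
    exact h1.exp
  interval_cases α
  · show HasDerivAt (fun t : ℝ => Real.exp (-(t^2/4))) _ t
    exact e.congr_deriv (by simp only [hh]; ring)
  · show HasDerivAt (fun t : ℝ => -(t/2) * Real.exp (-(t^2/4))) _ t
    exact (((hasDerivAt_id t).div_const 2).fun_neg.fun_mul e).congr_deriv (by simp only [hh, id]; ring)
  · show HasDerivAt (fun t : ℝ => (t^2/4 - 1/2) * Real.exp (-(t^2/4))) _ t
    exact ((((hasDerivAt_pow 2 t).div_const 4).sub_const (1/2)).fun_mul e).congr_deriv
      (by simp only [hh]; push_cast; ring)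

lemma hh_cont {α : ℕ} (hα : α ≤ 3) : Continuous (hh α) := by
  interval_cases α <;> unfold hh <;> fun_prop

lemma hh_bound {α : ℕ} (hα : α ≤ 3) (t : ℝ) : |hh α t| ≤ 100 * Real.exp (-(t^2/8)) := by
  have hE : Real.exp (-(t^2/4)) = Real.exp (-(t^2/8)) * Real.exp (-(t^2/8)) := by
    rw [← Real.exp_add]; congr 1; ring
  set E := Real.exp (-(t^2/8)) with hEd
  have hE0 : 0 < E := Real.exp_pos _
  have hq : E * (1 + t^2/8 + t^4/128) ≤ 1 := by
    have h1 := Real.quadratic_le_exp_of_nonneg (show 0 ≤ t^2/8 by positivity)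
    have h2 : E * Real.exp (t^2/8) = 1 := by rw [hEd, ← Real.exp_add]; simp
    rw [← h2]
    gcongr
    nlinarith
  have main : ∀ P : ℝ, |P| ≤ 100 * (1 + t^2/8 + t^4/128) → |P * Real.exp (-(t^2/4))| ≤ 100 * E := by
    intro P hP
    rw [hE, abs_mul, abs_of_pos (mul_pos hE0 hE0)]
    calc |P| * (E * E) ≤ 100 * (1 + t^2/8 + t^4/128) * (E * E) := by gcongr
      _ = 100 * E * (E * (1 + t^2/8 + t^4/128)) := by ring
      _ ≤ 100 * E * 1 := by gcongr
      _ = _ := by ring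
  interval_cases α
  · have := main 1 (by rw [abs_one]; nlinarith [sq_nonneg t, sq_nonneg (t^2)])
    simpa [hh] using this
  · refine main (-(t/2)) (abs_le.mpr ⟨?_, ?_⟩) <;> nlinarith [sq_nonneg (t-1), sq_nonneg (t+1), sq_nonneg (t^2)]
  · refine main (t^2/4 - 1/2) (abs_le.mpr ⟨?_, ?_⟩) <;> nlinarith [sq_nonneg t, sq_nonneg (t^2)]
  · refine main (3*t/4 - t^3/8) (abs_le.mpr ⟨?_, ?_⟩) <;>
      nlinarith [sq_nonneg (t-1), sq_nonneg (t+1), sq_nonneg (t^2-t), sq_nonneg (t^2+t), sq_nonneg (t^2)]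

lemma hh_neg {α : ℕ} (hα : α ≤ 2) (t : ℝ) : hh α (-t) = (-1)^α * hh α t := by
  interval_cases α <;> simp only [hh, neg_sq] <;> ring

/-- regularized kernel -/
def kk (α : ℕ) (z : ℝ × ℝ) (σ : ℝ) : ℝ := σ * (hh α (σ * z.1) * hh (2 - α) (σ * z.2))

def KK (α : ℕ) (δ N : ℝ) (z : ℝ × ℝ) : ℝ := (2 * π)⁻¹ * ∫ σ in δ..N, kk α z σ

lemma kk_cont {α : ℕ} (hα : α ≤ 2) : Continuous (fun q : (ℝ × ℝ) × ℝ => kk α q.1 q.2) := by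
  unfold kk
  have h1 := hh_cont (show α ≤ 3 by omega)
  have h2 := hh_cont (show 2 - α ≤ 3 by omega)
  fun_prop

lemma KK_cont {α : ℕ} (hα : α ≤ 2) (δ N : ℝ) : Continuous (KK α δ N) := by
  unfold KK
  refine continuous_const.mul ?_
  exact intervalIntegral.continuous_parametric_intervalIntegral_of_continuous' (kk_cont hα) δ N

lemma KK_even {α : ℕ} (hα : α ≤ 2) (δ N : ℝ) (z : ℝ × ℝ) : KK α δ N (-z) = KK α δ N z := by
  unfold KK kk
  congr 2; ext σ
  simp only [Prod.fst_neg, Prod.snd_neg, mul_neg]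
  rw [hh_neg hα, hh_neg (by omega)]
  have : (-1:ℝ)^α * (-1)^(2-α) = 1 := by rw [← pow_add, show α + (2 - α) = 2 by omega]; norm_num
  linear_combination (σ * hh α (σ * z.1) * hh (2-α) (σ * z.2)) * this

lemma kk_bound {α : ℕ} (hα : α ≤ 2) {δ N : ℝ} (hδ : 0 < δ) (z : ℝ × ℝ) {σ : ℝ} (h : σ ∈ Set.Icc δ N) :
    |kk α z σ| ≤ 10000 * N * (Real.exp (-(δ^2/8) * z.1^2) * Real.exp (-(δ^2/8) * z.2^2)) := by
  unfold kk
  have hσ : 0 < σ := hδ.trans_le h.1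
  have hδσ : δ^2 ≤ σ^2 := pow_le_pow_left₀ hδ.le h.1 2
  have hb : ∀ γ : ℕ, γ ≤ 3 → ∀ t : ℝ, |hh γ (σ * t)| ≤ 100 * Real.exp (-(δ^2/8) * t^2) := by
    intro γ hγ t
    refine (hh_bound hγ _).trans ?_
    gcongr
    rw [mul_pow]
    nlinarith [mul_le_mul_of_nonneg_right hδσ (sq_nonneg t)]
  rw [abs_mul, abs_mul, abs_of_pos hσ]
  calc _ ≤ N * ((100 * Real.exp (-(δ^2/8) * z.1^2)) * (100 * Real.exp (-(δ^2/8) * z.2^2))) := by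
        have := hb α (by omega) z.1
        have := hb (2 - α) (by omega) z.2
        have := h.2
        have : 0 ≤ N := hσ.le.trans h.2
        gcongr
    _ = _ := by ring

lemma gauss2_int {c : ℝ} (hc : 0 < c) :
    Integrable (fun z : ℝ × ℝ => Real.exp (-c * z.1^2) * Real.exp (-c * z.2^2)) :=
  (integrable_exp_neg_mul_sq hc).mul_prod (integrable_exp_neg_mul_sq hc)

lemma KK_int {α : ℕ} (hα : α ≤ 2) {δ N : ℝ} (hδ : 0 < δ) (hN : δ ≤ N) : Integrable (KK α δ N) := by
  have h1 := ((gauss2_int (show 0 < δ^2/8 by positivity)).const_mul (10000 * N)).const_mul (N - δ)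
    |>.const_mul (2*π)⁻¹
  refine h1.mono' (KK_cont hα δ N).aestronglyMeasurable (ae_of_all _ fun z => ?_)
  unfold KK
  rw [norm_mul, Real.norm_of_nonneg (show 0 ≤ (2*π)⁻¹ by positivity)]
  gcongr
  have := intervalIntegral.norm_integral_le_of_norm_le_const (a := δ) (b := N) (f := kk α z)
    (C := 10000 * N * (Real.exp (-(δ^2/8) * z.1^2) * Real.exp (-(δ^2/8) * z.2^2))) (by
      intro σ hσ
      rw [Set.uIoc_of_le hN] at hσ
      exact kk_bound hα hδ z ⟨hσ.1.le, hσ.2⟩)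
  rw [abs_of_nonneg (by linarith : 0 ≤ N - δ)] at this
  linarith

def cG : ℝ := ∫ u in Set.Ioi (0:ℝ), u^2 * Real.exp (-(1/8) * u^2)

lemma gInt : IntegrableOn (fun u : ℝ => u^2 * Real.exp (-(1/8) * u^2)) (Set.Ioi 0) := by
  have := integrable_rpow_mul_exp_neg_mul_sq (show (0:ℝ) < 1/8 by norm_num) (s := 2) (by norm_num)
  have h2 := this.integrableOn (s := Set.Ioi (0:ℝ))
  simpa using h2

lemma hh_lip {α : ℕ} (hα : α ≤ 2) {σ d c : ℝ} (hσ : 0 < σ) (u u' : ℝ)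
    (hB : ∀ ξ ∈ Set.uIcc u u', d^2 ≤ ξ^2 + c) :
    |hh α (σ * u) - hh α (σ * u')| * Real.exp (-(σ^2 * c/8)) ≤
      100 * σ * Real.exp (-(σ^2 * d^2/8)) * |u - u'| := by
  have h1 := (convex_uIcc u u').norm_image_sub_le_of_norm_hasDerivWithin_le
    (f := fun ξ => hh α (σ * ξ) * Real.exp (-(σ^2 * c/8)))
    (f' := fun ξ => hh (α+1) (σ * ξ) * σ * Real.exp (-(σ^2 * c/8)))
    (C := 100 * σ * Real.exp (-(σ^2 * d^2/8))) (x := u') (y := u)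
    (fun ξ _ => by
      have h2 := (hh_deriv hα (σ * ξ)).comp ξ ((hasDerivAt_id ξ).const_mul σ)
      have h3 := h2.mul_const (Real.exp (-(σ^2 * c/8)))
      simp only [mul_one] at h3
      exact h3.hasDerivWithinAt)
    (fun ξ hξ => by
      rw [norm_mul, norm_mul, Real.norm_of_nonneg hσ.le, Real.norm_of_nonneg (Real.exp_pos _).le,
        Real.norm_eq_abs]
      calc _ ≤ 100 * Real.exp (-((σ * ξ)^2/8)) * σ * Real.exp (-(σ^2 * c/8)) := by
            gcongr; exact hh_bound (by omega) _
        _ = 100 * σ * Real.exp (-((σ * ξ)^2/8) + -(σ^2 * c/8)) := by rw [Real.exp_add]; ring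
        _ ≤ _ := by
          gcongr
          have := hB ξ hξ
          nlinarith [mul_le_mul_of_nonneg_left this (sq_nonneg σ)])
    Set.right_mem_uIcc Set.left_mem_uIcc
  rw [← sub_mul, norm_mul, Real.norm_of_nonneg (Real.exp_pos _).le] at h1
  exact h1

lemma kk_lip {α : ℕ} (hα : α ≤ 2) {σ d r : ℝ} (hσ : 0 < σ) (hd : 0 < d) (a z z' : ℝ × ℝ)
    (hz : z ∈ Metric.closedBall a r) (hz' : z' ∈ Metric.closedBall a r)
    (hdist : d + r ≤ ‖a‖) :
    |kk α z σ - kk α z' σ| ≤ 40000 * σ^2 * r * Real.exp (-(σ^2 * d^2/8)) := by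
  rw [cb_eq] at hz hz'
  obtain ⟨⟨a1, a2⟩, ⟨a3, a4⟩⟩ := hz
  obtain ⟨⟨b1, b2⟩, ⟨b3, b4⟩⟩ := hz'
  have hlow : ∀ ξ η : ℝ, a.1 - r ≤ ξ → ξ ≤ a.1 + r → a.2 - r ≤ η → η ≤ a.2 + r → d^2 ≤ ξ^2 + η^2 := by
    intro ξ η h1 h2 h3 h4
    rw [Prod.norm_def, le_max_iff, Real.norm_eq_abs, Real.norm_eq_abs] at hdist
    have sq : ∀ t : ℝ, d ≤ |t| → d^2 ≤ t^2 := fun t ht => by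
      rw [← sq_abs t]; exact pow_le_pow_left₀ hd.le ht 2
    rcases hdist with h | h
    · have : d ≤ |ξ| := by
        have : |a.1 - ξ| ≤ r := abs_le.mpr ⟨by linarith, by linarith⟩
        have := abs_sub_abs_le_abs_sub a.1 ξ; linarith
      nlinarith [sq ξ this, sq_nonneg η]
    · have : d ≤ |η| := by
        have : |a.2 - η| ≤ r := abs_le.mpr ⟨by linarith, by linarith⟩
        have := abs_sub_abs_le_abs_sub a.2 η; linarith
      nlinarith [sq η this, sq_nonneg ξ]
  have s1 := hh_lip (α := α) hα (σ := σ) (d := d) (c := z.2^2) hσ z.1 z'.1 (fun ξ hξ => by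
    rcases Set.mem_uIcc.mp hξ with h | h <;>
    exact hlow ξ z.2 (by linarith [h.1]) (by linarith [h.2]) a3 a4)
  have s2 := hh_lip (α := 2 - α) (by omega) (σ := σ) (d := d) (c := z'.1^2) hσ z.2 z'.2 (fun ξ hξ => by
    have : d^2 ≤ z'.1^2 + ξ^2 := by
      rcases Set.mem_uIcc.mp hξ with h | h <;>
      exact hlow z'.1 ξ b1 b2 (by linarith [h.1]) (by linarith [h.2])
    linarith)
  have t1 := hh_bound (show 2 - α ≤ 3 by omega) (σ * z.2)
  have t2 := hh_bound (show α ≤ 3 by omega) (σ * z'.1)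
  have hu1 : |z.1 - z'.1| ≤ 2 * r := abs_le.mpr ⟨by linarith, by linarith⟩
  have hu2 : |z.2 - z'.2| ≤ 2 * r := abs_le.mpr ⟨by linarith, by linarith⟩
  have hdec : kk α z σ - kk α z' σ = σ * ((hh α (σ * z.1) - hh α (σ * z'.1)) * hh (2-α) (σ * z.2) +
      hh α (σ * z'.1) * (hh (2-α) (σ * z.2) - hh (2-α) (σ * z'.2))) := by unfold kk; ring
  rw [hdec, abs_mul, abs_of_pos hσ]
  set E := Real.exp (-(σ^2 * d^2/8))
  have p1 : |(hh α (σ * z.1) - hh α (σ * z'.1)) * hh (2-α) (σ * z.2)| ≤ 100 * (100 * σ * E * (2 * r)) := by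
    rw [abs_mul]
    calc _ ≤ |hh α (σ * z.1) - hh α (σ * z'.1)| * (100 * Real.exp (-((σ * z.2)^2/8))) := by gcongr
      _ = 100 * (|hh α (σ * z.1) - hh α (σ * z'.1)| * Real.exp (-(σ^2 * z.2^2/8))) := by
        rw [mul_pow]; ring
      _ ≤ 100 * (100 * σ * E * |z.1 - z'.1|) := by gcongr
      _ ≤ _ := by gcongr
  have p2 : |hh α (σ * z'.1) * (hh (2-α) (σ * z.2) - hh (2-α) (σ * z'.2))| ≤ 100 * (100 * σ * E * (2 * r)) := by
    rw [abs_mul]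
    calc _ ≤ (100 * Real.exp (-((σ * z'.1)^2/8))) * |hh (2-α) (σ * z.2) - hh (2-α) (σ * z'.2)| := by gcongr
      _ = 100 * (|hh (2-α) (σ * z.2) - hh (2-α) (σ * z'.2)| * Real.exp (-(σ^2 * z'.1^2/8))) := by
        rw [mul_pow]; ring
      _ ≤ 100 * (100 * σ * E * |z.2 - z'.2|) := by gcongr
      _ ≤ _ := by gcongr
  calc _ ≤ σ * (100 * (100 * σ * E * (2 * r)) + 100 * (100 * σ * E * (2 * r))) := by
        gcongr; exact (abs_add_le _ _).trans (add_le_add p1 p2)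
    _ = _ := by ring

lemma KK_smooth {α : ℕ} (hα : α ≤ 2) {δ N : ℝ} (hδ : 0 < δ) (hN : δ ≤ N) {d r : ℝ} (hd : 0 < d)
    (hr : 0 ≤ r) (a z z' : ℝ × ℝ)
    (hz : z ∈ Metric.closedBall a r) (hz' : z' ∈ Metric.closedBall a r) (hdist : d + r ≤ ‖a‖) :
    |KK α δ N z - KK α δ N z'| ≤ 40000 * cG * r / d^3 := by
  unfold KK
  have kc : ∀ z, Continuous (kk α z) := fun z => (kk_cont hα).comp (by fun_prop : Continuous fun σ : ℝ => (z, σ))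
  rw [← mul_sub, ← intervalIntegral.integral_sub ((kc z).intervalIntegrable _ _)
    ((kc z').intervalIntegrable _ _), abs_mul, abs_of_pos (by positivity)]
  have hscale : ∫ σ in Set.Ioi (0:ℝ), (d * σ)^2 * Real.exp (-(1/8) * (d * σ)^2) = d⁻¹ * cG := by
    have := integral_comp_mul_left_Ioi (fun u : ℝ => u^2 * Real.exp (-(1/8) * u^2)) 0 hd
    simpa [cG] using this
  have hsi : IntegrableOn (fun σ => (d * σ)^2 * Real.exp (-(1/8) * (d * σ)^2)) (Set.Ioi (0:ℝ)) := by
    have := (integrableOn_Ioi_comp_mul_left_iff (fun u : ℝ => u^2 * Real.exp (-(1/8) * u^2)) 0 hd).mpr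
      (by simpa using gInt)
    exact this
  have hcG : 0 ≤ cG := setIntegral_nonneg measurableSet_Ioi fun u _ => by positivity
  have h1 : |∫ σ in δ..N, (kk α z σ - kk α z' σ)| ≤ 40000 * r / d^2 * (d⁻¹ * cG) := by
    rw [← hscale, ← integral_const_mul, intervalIntegral.integral_of_le hN]
    rw [← Real.norm_eq_abs]
    refine (norm_integral_le_integral_norm _).trans ?_
    calc _ ≤ ∫ σ in Set.Ioc δ N, 40000 * r / d^2 * ((d * σ)^2 * Real.exp (-(1/8) * (d * σ)^2)) := by
          refine setIntegral_mono_on ?_ ?_ measurableSet_Ioc fun σ hσ => ?_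
          · exact (((kc z).sub (kc z')).norm.integrableOn_Icc).mono_set Set.Ioc_subset_Icc_self
          · exact IntegrableOn.mono_set (Integrable.const_mul hsi _) fun σ hσ => hδ.trans hσ.1
          · refine (kk_lip hα (hδ.trans hσ.1) hd a z z' hz hz' hdist).trans (le_of_eq ?_)
            rw [show -(1/8) * (d * σ)^2 = -(σ^2 * d^2/8) by ring]
            field_simp
      _ ≤ _ := by
          refine setIntegral_mono_set (hsi.const_mul _) ?_ ?_
          · exact ae_of_all _ fun σ => by simp only [Pi.zero_apply]; positivity
          · exact Filter.Eventually.of_forall fun σ hσ => hδ.trans hσ.1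
  calc _ ≤ 1 * |∫ σ in δ..N, (kk α z σ - kk α z' σ)| := by
        gcongr
        apply inv_le_one_of_one_le₀
        nlinarith [Real.pi_gt_three]
    _ ≤ 40000 * r / d^2 * (d⁻¹ * cG) := by rw [one_mul]; exact h1
    _ = _ := by field_simp

lemma hh_int {α : ℕ} (hα : α ≤ 3) : Integrable (fun x => (hh α x : ℂ)) := by
  have h1 := (integrable_exp_neg_mul_sq (show (0:ℝ) < 1/8 by norm_num)).const_mul 100
  refine h1.mono' ((Complex.continuous_ofReal.comp (hh_cont hα)).aestronglyMeasurable)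
    (ae_of_all _ fun x => ?_)
  rw [Complex.norm_real, Real.norm_eq_abs]
  refine (hh_bound hα x).trans (le_of_eq ?_)
  congr 2; ring

def JJ (α : ℕ) (τ : ℝ) : ℂ := ∫ x : ℝ, (hh α x : ℂ) * Complex.exp (Complex.I * τ * x)

lemma hhe_int {α : ℕ} (hα : α ≤ 3) (τ : ℝ) :
    Integrable (fun x : ℝ => (hh α x : ℂ) * Complex.exp (Complex.I * τ * x)) := by
  refine (hh_int hα).mul_bdd (c := 1) (Continuous.aestronglyMeasurable (by fun_prop)) (ae_of_all _ fun x => ?_)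
  rw [show Complex.I * τ * x = ((τ * x : ℝ) : ℂ) * Complex.I by push_cast; ring,
    Complex.norm_exp_ofReal_mul_I]

lemma JJ_succ {α : ℕ} (hα : α ≤ 1) (τ : ℝ) : JJ (α+1) τ = (-(Complex.I * τ)) * JJ α τ := by
  have h1 := integral_mul_deriv_eq_deriv_mul_of_integrable
    (u := fun x : ℝ => Complex.exp (Complex.I * τ * x))
    (u' := fun x : ℝ => Complex.exp (Complex.I * τ * x) * (Complex.I * τ))
    (v := fun x => (hh α x : ℂ)) (v' := fun x => (hh (α+1) x : ℂ))
    (fun x _ => by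
      have h : HasDerivAt (fun x : ℝ => Complex.I * τ * (x:ℂ)) (Complex.I * τ) x := by
        simpa using (Complex.ofRealCLM.hasDerivAt (x := x)).const_mul (Complex.I * (τ:ℂ))
      exact h.cexp)
    (fun x _ => (hh_deriv (show α ≤ 2 by omega) x).ofReal_comp)
    (by
      refine (hhe_int (show α + 1 ≤ 3 by omega) τ).congr (ae_of_all _ fun x => ?_)
      simp only [Pi.mul_apply]; ring)
    (by
      refine ((hhe_int (show α ≤ 3 by omega) τ).const_mul (Complex.I * τ)).congr (ae_of_all _ fun x => ?_)
      simp only [Pi.mul_apply]; ring)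
    (by
      refine (hhe_int (show α ≤ 3 by omega) τ).congr (ae_of_all _ fun x => ?_)
      simp only [Pi.mul_apply]; ring)
  unfold JJ
  rw [← integral_const_mul]
  calc _ = ∫ x : ℝ, Complex.exp (Complex.I * τ * x) * (hh (α+1) x : ℂ) := by
        congr 1; ext x; ring
    _ = _ := h1
    _ = _ := by rw [← integral_neg]; congr 1; ext x; ring

lemma JJ_zero (τ : ℝ) : JJ 0 τ = ((2 * Real.sqrt π * Real.exp (-τ^2) : ℝ) : ℂ) := by
  have h1 := fourierIntegral_gaussian (b := ((1/4 : ℝ) : ℂ)) (by rw [Complex.ofReal_re]; norm_num) τ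
  unfold JJ
  have : ∀ x : ℝ, (hh 0 x : ℂ) * Complex.exp (Complex.I * τ * x) =
      Complex.exp (Complex.I * τ * x) * Complex.exp (-((1/4:ℝ):ℂ) * (x:ℂ)^2) := by
    intro x
    simp only [hh]
    push_cast
    rw [mul_comm]; congr 2; ring
  simp_rw [this]
  rw [h1, ← Complex.ofReal_div, show (1/2 : ℂ) = ((1/2 : ℝ) : ℂ) by push_cast; ring,
    ← Complex.ofReal_cpow (by positivity), ← Real.sqrt_eq_rpow,
    show π / (1/4) = 2^2 * π by ring, Real.sqrt_mul (by norm_num), Real.sqrt_sq (by norm_num)]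
  push_cast
  congr 2; ring

lemma JJ_eq {α : ℕ} (hα : α ≤ 2) (τ : ℝ) :
    JJ α τ = (-(Complex.I * τ))^α * ((2 * Real.sqrt π * Real.exp (-τ^2) : ℝ) : ℂ) := by
  rw [← JJ_zero]
  interval_cases α
  · simp
  · rw [JJ_succ (le_refl _ |>.trans (by norm_num))]; simp
  · rw [JJ_succ (le_refl _), JJ_succ (by norm_num)]; ring

lemma JJ_scale (α : ℕ) (τ : ℝ) {σ : ℝ} (hσ : 0 < σ) :
    ∫ x : ℝ, (hh α (σ * x) : ℂ) * Complex.exp (Complex.I * τ * x) = (σ:ℂ)⁻¹ * JJ α (τ / σ) := by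
  have := Measure.integral_comp_mul_left
    (fun x : ℝ => (hh α x : ℂ) * Complex.exp (Complex.I * (τ/σ : ℝ) * x)) σ
  unfold JJ
  rw [abs_of_pos (by positivity), Complex.real_smul, Complex.ofReal_inv] at this
  rw [← this]
  congr 1; ext x
  have : (σ:ℂ) ≠ 0 := by exact_mod_cast hσ.ne'
  congr 2; push_cast; field_simp

def nsq (n : ℤ × ℤ) : ℝ := (n.1:ℝ)^2 + (n.2:ℝ)^2

def sy (α : ℕ) (n : ℤ × ℤ) : ℝ := -((n.1:ℝ)^α * (n.2:ℝ)^(2-α)) / nsq n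

def ro (δ N : ℝ) (n : ℤ × ℤ) : ℝ :=
  Real.exp (-(4 * π^2 * nsq n / N^2)) - Real.exp (-(4 * π^2 * nsq n / δ^2))

lemma conj_ch (n : ℤ × ℤ) (z : ℝ × ℝ) : (starRingEnd ℂ) (ch n z) =
    Complex.exp (Complex.I * (-2 * π * n.1 : ℝ) * z.1) * Complex.exp (Complex.I * (-2 * π * n.2 : ℝ) * z.2) := by
  unfold ch
  rw [← Complex.exp_conj, ← Complex.exp_add]
  congr 1
  simp only [map_mul, map_add, Complex.conj_I, Complex.conj_ofReal, map_ofNat, map_intCast]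
  push_cast; ring

lemma ch_norm (n : ℤ × ℤ) (z : ℝ × ℝ) : ‖ch n z‖ = 1 := by
  unfold ch
  rw [show (2 * π * Complex.I * ((n.1 : ℂ) * (z.1 : ℂ) + (n.2 : ℂ) * (z.2 : ℂ)) : ℂ) =
    ((2 * π * (n.1 * z.1 + n.2 * z.2) : ℝ) : ℂ) * Complex.I by push_cast; ring,
    Complex.norm_exp_ofReal_mul_I]

lemma ch_cont (n : ℤ × ℤ) : Continuous (ch n) := by unfold ch; fun_prop

lemma kk_four {α : ℕ} (hα : α ≤ 2) (n : ℤ × ℤ) {σ : ℝ} (hσ : 0 < σ) :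
    ∫ z : ℝ × ℝ, (kk α z σ : ℂ) * (starRingEnd ℂ) (ch n z) =
      (((2 * π)* (-((n.1:ℝ)^α * (n.2:ℝ)^(2-α)) *
        (8 * π^2 * (σ^3)⁻¹ * Real.exp (-(4 * π^2 * nsq n / σ^2)))) : ℝ) : ℂ) := by
  have h1 : ∀ z : ℝ × ℝ, (kk α z σ : ℂ) * (starRingEnd ℂ) (ch n z) =
      (σ : ℂ) * (((hh α (σ * z.1) : ℂ) * Complex.exp (Complex.I * (-2 * π * n.1 : ℝ) * z.1)) *
        ((hh (2-α) (σ * z.2) : ℂ) * Complex.exp (Complex.I * (-2 * π * n.2 : ℝ) * z.2))) := by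
    intro z; rw [conj_ch]; unfold kk; push_cast; ring
  simp_rw [h1]
  rw [integral_const_mul, Measure.volume_eq_prod, integral_prod_mul
    (fun x : ℝ => (hh α (σ * x) : ℂ) * Complex.exp (Complex.I * (-2 * π * n.1 : ℝ) * x))
    (fun x : ℝ => (hh (2-α) (σ * x) : ℂ) * Complex.exp (Complex.I * (-2 * π * n.2 : ℝ) * x)),
    JJ_scale _ _ hσ, JJ_scale _ _ hσ, JJ_eq hα, JJ_eq (by omega)]
  have e1 : ∀ m : ℤ, (-(Complex.I * ((-2 * π * m / σ : ℝ) : ℂ))) =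
      (Complex.I * (2 * π / σ : ℝ)) * (m : ℝ) := by intro m; push_cast; ring
  rw [e1, e1, mul_pow _ ((n.1:ℝ):ℂ), mul_pow _ ((n.2:ℝ):ℂ)]
  have e2 : (Complex.I * ((2 * π / σ : ℝ):ℂ))^α * (Complex.I * ((2 * π / σ : ℝ):ℂ))^(2-α) =
      ((-(2 * π / σ)^2 : ℝ) : ℂ) := by
    rw [← pow_add, show α + (2-α) = 2 by omega, mul_pow, Complex.I_sq]; push_cast; ring
  have e3 : Real.exp (-(4 * π^2 * nsq n / σ^2)) =
      Real.exp (-(-2 * π * n.1 / σ)^2) * Real.exp (-(-2 * π * n.2 / σ)^2) := by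
    rw [← Real.exp_add]; congr 1; unfold nsq; ring
  have e4 : Real.sqrt π * Real.sqrt π = π := Real.mul_self_sqrt Real.pi_pos.le
  rw [e3]
  set E1 := Real.exp (-(-2 * π * n.1 / σ)^2)
  set E2 := Real.exp (-(-2 * π * n.2 / σ)^2)
  have e5 : (σ:ℂ) * ((σ:ℂ)⁻¹ * ((Complex.I * ((2 * π / σ : ℝ):ℂ))^α * ((n.1:ℝ):ℂ)^α *
      ((2 * Real.sqrt π * E1 : ℝ):ℂ)) * ((σ:ℂ)⁻¹ * ((Complex.I * ((2 * π / σ : ℝ):ℂ))^(2-α) *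
      ((n.2:ℝ):ℂ)^(2-α) * ((2 * Real.sqrt π * E2 : ℝ):ℂ)))) =
      ((Complex.I * ((2 * π / σ : ℝ):ℂ))^α * (Complex.I * ((2 * π / σ : ℝ):ℂ))^(2-α)) *
      ((σ * (σ⁻¹ * σ⁻¹) * ((n.1:ℝ)^α * (n.2:ℝ)^(2-α)) * (4 * (Real.sqrt π * Real.sqrt π)) * (E1 * E2) : ℝ) : ℂ) := by
    push_cast; ring
  rw [e5, e2, e4, ← Complex.ofReal_mul]
  congr 1
  field_simp
  ring

lemma ro_int (n : ℤ × ℤ) (hn : nsq n ≠ 0) {δ N : ℝ} (hδ : 0 < δ) (hN : δ ≤ N) :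
    ∫ σ in δ..N, (8 * π^2 * (σ^3)⁻¹ * Real.exp (-(4 * π^2 * nsq n / σ^2))) = ro δ N n / nsq n := by
  have hpos : ∀ σ ∈ Set.uIcc δ N, 0 < σ := fun σ hσ => by
    rw [Set.uIcc_of_le hN] at hσ; exact hδ.trans_le hσ.1
  rw [intervalIntegral.integral_eq_sub_of_hasDerivAt
    (f := fun σ => Real.exp (-(4 * π^2 * nsq n / σ^2)) / nsq n)]
  · unfold ro; ring
  · intro σ hσ
    have h0 := hpos σ hσ
    have h1 : HasDerivAt (fun σ : ℝ => -(4 * π^2 * nsq n / σ^2)) (8 * π^2 * nsq n * (σ^3)⁻¹) σ := by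
      have := ((hasDerivAt_const σ (4 * π^2 * nsq n)).fun_div (hasDerivAt_pow 2 σ) (by positivity)).fun_neg
      refine this.congr_deriv ?_
      push_cast; field_simp; ring
    refine (h1.exp.div_const (nsq n)).congr_deriv ?_
    field_simp
  · apply ContinuousOn.intervalIntegrable
    refine ContinuousOn.mul (ContinuousOn.mul continuousOn_const ?_) ?_
    · exact ContinuousOn.inv₀ (by fun_prop) fun σ hσ => by have := hpos σ hσ; positivity
    · refine Real.continuous_exp.comp_continuousOn (ContinuousOn.neg (ContinuousOn.div₀ continuousOn_const (by fun_prop) ?_))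
      exact fun σ hσ => by have := hpos σ hσ; positivity

lemma nsq_zero {n : ℤ × ℤ} (h : nsq n = 0) : n = 0 := by
  unfold nsq at h
  have h1 : (n.1:ℝ) = 0 := by nlinarith [sq_nonneg (n.1:ℝ), sq_nonneg (n.2:ℝ)]
  have h2 : (n.2:ℝ) = 0 := by nlinarith [sq_nonneg (n.1:ℝ), sq_nonneg (n.2:ℝ)]
  ext <;> simp <;> assumption_mod_cast

lemma KK_four {α : ℕ} (hα : α ≤ 2) (n : ℤ × ℤ) {δ N : ℝ} (hδ : 0 < δ) (hN : δ ≤ N) :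
    ∫ z : ℝ × ℝ, (KK α δ N z : ℂ) * (starRingEnd ℂ) (ch n z) = ((sy α n * ro δ N n : ℝ) : ℂ) := by
  have hcc : Continuous (fun z => (starRingEnd ℂ) (ch n z)) := Complex.continuous_conj.comp (ch_cont n)
  have h1 : ∀ z : ℝ × ℝ, (KK α δ N z : ℂ) * (starRingEnd ℂ) (ch n z) =
      (2 * π : ℂ)⁻¹ * ∫ σ in Set.Ioc δ N, (kk α z σ : ℂ) * (starRingEnd ℂ) (ch n z) := by
    intro z
    unfold KK
    rw [integral_mul_const, ← intervalIntegral.integral_of_le hN, intervalIntegral.integral_ofReal]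
    push_cast; ring
  simp_rw [h1]
  rw [integral_const_mul, integral_integral_swap]
  · have h2 : ∫ σ in Set.Ioc δ N, ∫ z : ℝ × ℝ, (kk α z σ : ℂ) * (starRingEnd ℂ) (ch n z) =
        ∫ σ in Set.Ioc δ N, (((2 * π)* (-((n.1:ℝ)^α * (n.2:ℝ)^(2-α)) *
        (8 * π^2 * (σ^3)⁻¹ * Real.exp (-(4 * π^2 * nsq n / σ^2)))) : ℝ) : ℂ) :=
      setIntegral_congr_fun measurableSet_Ioc fun σ hσ => kk_four hα n (hδ.trans hσ.1)
    rw [h2, integral_complex_ofReal, integral_const_mul, integral_const_mul,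
      ← intervalIntegral.integral_of_le hN]
    by_cases hn : nsq n = 0
    · have := nsq_zero hn
      subst this
      have hz : ((0:ℤ×ℤ).1:ℝ)^α * ((0:ℤ×ℤ).2:ℝ)^(2-α) = 0 := by
        simp only [Prod.fst_zero, Prod.snd_zero, Int.cast_zero]
        rw [← pow_add, show α + (2-α) = 2 by omega]; norm_num
      unfold sy
      rw [hz]; simp
    · rw [ro_int n hn hδ hN]
      unfold sy
      have : (π:ℂ) ≠ 0 := by exact_mod_cast Real.pi_ne_zero
      push_cast
      field_simp
  · have g := (gauss2_int (show 0 < δ^2/8 by positivity)).const_mul (10000 * N)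
    have hfin : IsFiniteMeasure (volume.restrict (Set.Ioc δ N)) := ⟨by simp⟩
    have g2 := g.mul_prod (integrable_const (1:ℝ) (μ := volume.restrict (Set.Ioc δ N)))
    refine g2.mono' ?_ ?_
    · apply Continuous.aestronglyMeasurable
      exact (Complex.continuous_ofReal.comp (kk_cont hα)).mul (hcc.comp continuous_fst)
    · have : ∀ᵐ q : (ℝ × ℝ) × ℝ ∂(volume.prod (volume.restrict (Set.Ioc δ N))), q.2 ∈ Set.Ioc δ N := by
        have := (Measure.quasiMeasurePreserving_snd (μ := (volume : Measure (ℝ × ℝ)))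
          (ν := volume.restrict (Set.Ioc δ N))).ae (p := fun σ => σ ∈ Set.Ioc δ N)
          (ae_restrict_mem measurableSet_Ioc)
        exact this
      filter_upwards [this] with q hq
      simp only [Function.uncurry]
      rw [norm_mul, RCLike.norm_conj, ch_norm, mul_one, mul_one, Complex.norm_real]
      exact kk_bound hα hδ q.1 ⟨hq.1.le, hq.2⟩

lemma sy_abs {α : ℕ} (hα : α ≤ 2) (n : ℤ × ℤ) : |sy α n| ≤ 1 := by
  unfold sy
  rw [abs_div]
  have h0 : 0 ≤ nsq n := by unfold nsq; positivity
  rw [abs_of_nonneg h0]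
  refine div_le_one_of_le₀ ?_ h0
  unfold nsq
  rw [abs_neg]
  have : ∀ x y : ℝ, |x^α * y^(2-α)| ≤ x^2 + y^2 := by
    intro x y
    interval_cases α
    · rw [abs_le]; constructor <;> simp <;> nlinarith [sq_nonneg x, sq_nonneg y]
    · rw [abs_le]; constructor <;> simp <;> nlinarith [sq_nonneg (x-y), sq_nonneg (x+y)]
    · rw [abs_le]; constructor <;> simp <;> nlinarith [sq_nonneg x, sq_nonneg y]
  exact this _ _

lemma ro_mem (n : ℤ × ℤ) {δ N : ℝ} (hδ : 0 < δ) (hN : δ ≤ N) : 0 ≤ ro δ N n ∧ ro δ N n ≤ 1 := by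
  have h0 : 0 ≤ nsq n := by unfold nsq; positivity
  have hN0 : 0 < N := hδ.trans_le hN
  unfold ro
  constructor
  · rw [sub_nonneg]
    gcongr
  · have h1 : Real.exp (-(4 * π^2 * nsq n / N^2)) ≤ 1 := by
      rw [Real.exp_le_one_iff]
      have : 0 ≤ 4 * π^2 * nsq n / N^2 := by positivity
      linarith
    have := Real.exp_pos (-(4 * π^2 * nsq n / δ^2))
    linarith

lemma Per.map2 {α β γ : Type*} {f : ℝ × ℝ → α} {g : ℝ × ℝ → β} (hf : Per f) (hg : Per g)
    (F : α → β → γ) : Per (fun x => F (f x) (g x)) :=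
  ⟨fun x => by simp only [hf.1 x, hg.1 x], fun x => by simp only [hf.2 x, hg.2 x]⟩

lemma Per.shift {α : Type*} {f : ℝ × ℝ → α} (hf : Per f) (w : ℝ × ℝ) : Per (fun x => f (x + w)) := by
  constructor
  · intro x
    have := hf.1 (x + w)
    show f ((x.1 + 1, x.2) + w) = f (x + w)
    rw [← this]; congr 1; ext <;> simp; ring
  · intro x
    have := hf.2 (x + w)
    show f ((x.1, x.2 + 1) + w) = f (x + w)
    rw [← this]; congr 1; ext <;> simp; ring

lemma Per.shift_sub {α : Type*} {f : ℝ × ℝ → α} (hf : Per f) (w : ℝ × ℝ) : Per (fun x => f (x - w)) := by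
  have := hf.shift (-w)
  simpa [sub_eq_add_neg] using this

lemma ch_per (n : ℤ × ℤ) : Per (ch n) := by
  have h : ∀ m : ℤ, Complex.exp (2 * π * Complex.I * m) = 1 := fun m => by
    rw [show (2 * π * Complex.I * m : ℂ) = m * (2 * π * Complex.I) by ring]
    exact Complex.exp_int_mul_two_pi_mul_I m
  constructor <;> intro x <;> unfold ch
  · rw [show (2 * π * Complex.I * ((n.1 : ℂ) * ((x.1 + 1 : ℝ) : ℂ) + (n.2 : ℂ) * (x.2 : ℂ)) : ℂ) =
      2 * π * Complex.I * ((n.1 : ℂ) * (x.1 : ℂ) + (n.2 : ℂ) * (x.2 : ℂ)) + 2 * π * Complex.I * n.1 by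
        push_cast; ring, Complex.exp_add, h, mul_one]
  · rw [show (2 * π * Complex.I * ((n.1 : ℂ) * (x.1 : ℂ) + (n.2 : ℂ) * ((x.2 + 1 : ℝ) : ℂ)) : ℂ) =
      2 * π * Complex.I * ((n.1 : ℂ) * (x.1 : ℂ) + (n.2 : ℂ) * (x.2 : ℂ)) + 2 * π * Complex.I * n.2 by
        push_cast; ring, Complex.exp_add, h, mul_one]

lemma ch_add (n : ℤ × ℤ) (x y : ℝ × ℝ) : ch n (x + y) = ch n x * ch n y := by
  unfold ch
  rw [← Complex.exp_add]; congr 1; simp only [Prod.fst_add, Prod.snd_add]; push_cast; ring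

def TT (K : ℝ × ℝ → ℝ) (g : ℝ × ℝ → ℂ) (x : ℝ × ℝ) : ℂ := ∫ z, (K z : ℂ) * g (x - z)


lemma TT_int {K : ℝ × ℝ → ℝ} (hK : Integrable K) {g : ℝ × ℝ → ℂ} (hg : Continuous g) (hgp : Per g)
    (x : ℝ × ℝ) : Integrable (fun z => (K z : ℂ) * g (x - z)) := by
  obtain ⟨B, hB0, hB⟩ := per_bdd hg hgp
  exact hK.ofReal.mul_bdd (c := B) (Continuous.aestronglyMeasurable (by fun_prop))
    (ae_of_all _ fun z => hB _)

lemma TT_int' {K : ℝ × ℝ → ℝ} (hK : Integrable K) {g : ℝ × ℝ → ℂ} (hg : Continuous g) (hgp : Per g)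
    (x : ℝ × ℝ) : Integrable (fun y => (K (x - y) : ℂ) * g y) := by
  have := (TT_int hK hg hgp x).comp_sub_left x
  simpa using this

lemma TT_cont {K : ℝ × ℝ → ℝ} (hK : Integrable K) {g : ℝ × ℝ → ℂ} (hg : Continuous g) (hgp : Per g) :
    Continuous (TT K g) := by
  obtain ⟨B, hB0, hB⟩ := per_bdd hg hgp
  unfold TT
  refine continuous_of_dominated (bound := fun z => ‖K z‖ * B) ?_ ?_ (hK.norm.mul_const B) ?_
  · exact fun x => (TT_int hK hg hgp x).aestronglyMeasurable
  · intro x; refine ae_of_all _ fun z => ?_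
    rw [norm_mul, Complex.norm_real]; gcongr; exact hB _
  · exact ae_of_all _ fun z => by fun_prop

lemma fub {K : ℝ × ℝ → ℝ} (hK : Integrable K)
    {F : (ℝ × ℝ) × (ℝ × ℝ) → ℂ} (hF : Continuous F) {B : ℝ} (hB : ∀ q, ‖F q‖ ≤ B) :
    ∫ x in Q2, ∫ z, (K z : ℂ) * F (x, z) = ∫ z, (K z : ℂ) * ∫ x in Q2, F (x, z) := by
  rw [integral_integral_swap]
  · congr 1; ext z; rw [integral_const_mul]
  · have h1 : Integrable (fun q : (ℝ × ℝ) × (ℝ × ℝ) => (1:ℂ) * (K q.2 : ℂ))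
        ((volume.restrict Q2).prod volume) :=
      (integrable_const (1:ℂ)).mul_prod hK.ofReal
    simp only [one_mul] at h1
    exact h1.mul_bdd (c := B) hF.aestronglyMeasurable (ae_of_all _ hB)

lemma TT_per (K : ℝ × ℝ → ℝ) {g : ℝ × ℝ → ℂ} (hgp : Per g) : Per (TT K g) := by
  constructor <;> intro x <;> unfold TT <;> congr 1 <;> ext z <;> congr 1
  · exact (hgp.shift_sub z).1 x
  · exact (hgp.shift_sub z).2 x

lemma TT_swap (K : ℝ × ℝ → ℝ) (g : ℝ × ℝ → ℂ) (x : ℝ × ℝ) :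
    TT K g x = ∫ y, (K (x - y) : ℂ) * g y := by
  unfold TT
  rw [← integral_sub_left_eq_self (fun y => (K (x - y) : ℂ) * g y) volume x]
  simp

lemma TT_sub {K : ℝ × ℝ → ℝ} (hK : Integrable K) {g h : ℝ × ℝ → ℂ} (hg : Continuous g) (hgp : Per g)
    (hh : Continuous h) (hhp : Per h) (x : ℝ × ℝ) :
    TT K (fun y => g y - h y) x = TT K g x - TT K h x := by
  unfold TT
  rw [← integral_sub (TT_int hK hg hgp x) (TT_int hK hh hhp x)]
  congr 1; ext z; ring

lemma TT_add {K : ℝ × ℝ → ℝ} (hK : Integrable K) {g h : ℝ × ℝ → ℂ} (hg : Continuous g) (hgp : Per g)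
    (hh : Continuous h) (hhp : Per h) (x : ℝ × ℝ) :
    TT K (fun y => g y + h y) x = TT K g x + TT K h x := by
  unfold TT
  rw [← integral_add (TT_int hK hg hgp x) (TT_int hK hh hhp x)]
  congr 1; ext z; ring

lemma TT_smul (K : ℝ × ℝ → ℝ) (c : ℂ) (g : ℝ × ℝ → ℂ) (x : ℝ × ℝ) :
    TT K (fun y => c * g y) x = c * TT K g x := by
  unfold TT
  rw [← integral_const_mul]
  congr 1; ext z; ring

lemma TT_conj (K : ℝ × ℝ → ℝ) (g : ℝ × ℝ → ℂ) (x : ℝ × ℝ) :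
    TT K (fun y => (starRingEnd ℂ) (g y)) x = (starRingEnd ℂ) (TT K g x) := by
  unfold TT
  rw [← integral_conj]
  congr 1; ext z; simp

lemma intQ2_shift_sub {h : ℝ × ℝ → ℂ} (hc : Continuous h) (hp : Per h) (z : ℝ × ℝ) :
    ∫ x in Q2, h (x - z) = ∫ x in Q2, h x := by
  simpa [sub_eq_add_neg] using intQ2_shift hc hp (-z)

lemma fc_TT {K : ℝ × ℝ → ℝ} (hK : Integrable K) {g : ℝ × ℝ → ℂ} (hg : Continuous g) (hgp : Per g)
    (n : ℤ × ℤ) : fc (TT K g) n = (∫ z, (K z : ℂ) * (starRingEnd ℂ) (ch n z)) * fc g n := by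
  obtain ⟨B, hB0, hB⟩ := per_bdd hg hgp
  have hcc : Continuous (fun z => (starRingEnd ℂ) (ch n z)) := Complex.continuous_conj.comp (ch_cont n)
  have h1 := fub hK (F := fun q => g (q.1 - q.2) * (starRingEnd ℂ) (ch n q.1))
    ((hg.comp (by fun_prop)).mul (hcc.comp continuous_fst)) (B := B) (fun q => by
      rw [norm_mul, RCLike.norm_conj, ch_norm, mul_one]; exact hB _)
  unfold fc TT
  rw [← integral_mul_const]
  calc _ = ∫ x in Q2, ∫ z, (K z : ℂ) * (g (x - z) * (starRingEnd ℂ) (ch n x)) := by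
        congr 1; ext x; rw [← integral_mul_const]; congr 1; ext z; ring
    _ = _ := h1
    _ = _ := by
      congr 1; ext z
      have h2 := intQ2_shift_sub (h := fun y => g y * (starRingEnd ℂ) (ch n y)) (by fun_prop)
        (hgp.map2 (ch_per n) fun a b => a * (starRingEnd ℂ) b) z
      rw [← h2, ← integral_const_mul, ← integral_const_mul]
      congr 1; ext x
      dsimp only
      have : ch n x = ch n (x - z) * ch n z := by rw [← ch_add]; simp
      rw [this, map_mul]; ring

lemma TT_symm {K : ℝ × ℝ → ℝ} (hK : Integrable K) (hev : ∀ z, K (-z) = K z) {f g : ℝ × ℝ → ℂ}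
    (hf : Continuous f) (hfp : Per f) (hg : Continuous g) (hgp : Per g) :
    ∫ x in Q2, TT K f x * g x = ∫ x in Q2, f x * TT K g x := by
  obtain ⟨B, hB0, hB⟩ := per_bdd hg hgp
  obtain ⟨A, hA0, hA⟩ := per_bdd hf hfp
  have h1 := fub hK (F := fun q => f (q.1 - q.2) * g q.1) (by fun_prop) (B := A * B) (fun q => by
      rw [norm_mul]; gcongr; exacts [hA _, hB _])
  have h2 := fub hK (F := fun q => f q.1 * g (q.1 + q.2)) (by fun_prop) (B := A * B) (fun q => by
      rw [norm_mul]; gcongr; exacts [hA _, hB _])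
  have e1 : ∀ x, TT K g x = ∫ z, (K z : ℂ) * g (x + z) := by
    intro x; unfold TT
    rw [← integral_neg_eq_self]
    congr 1; ext z; rw [hev]; simp
  calc _ = ∫ x in Q2, ∫ z, (K z : ℂ) * (f (x - z) * g x) := by
        congr 1; ext x; unfold TT; rw [← integral_mul_const]; congr 1; ext z; ring
    _ = _ := h1
    _ = ∫ z, (K z : ℂ) * ∫ x in Q2, f x * g (x + z) := by
        congr 1; ext z
        have h3 := intQ2_shift_sub (h := fun y => f y * g (y + z)) (by fun_prop)
          (hfp.map2 (hgp.shift z) fun a b => a * b) z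
        rw [← h3]; simp
    _ = _ := h2.symm
    _ = _ := by
        congr 1; ext x; rw [e1, ← integral_const_mul]; congr 1; ext z; ring

section torus
attribute [local instance] instMeasureSpaceUnitAddCircle
local instance : IsProbabilityMeasure (volume : Measure UnitAddCircle) :=
  inferInstanceAs (IsProbabilityMeasure AddCircle.haarAddCircle)

lemma torus_int {E : Type*} [NormedAddCommGroup E] [NormedSpace ℝ E]
    (F : UnitAddTorus (Fin 2) → E) (φ : ℝ × ℝ → E)
    (h : ∀ y : Fin 2 → ℝ, F (fun i => (y i : UnitAddCircle)) = φ (y 0, y 1)) :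
    ∫ t, F t = ∫ x in Q2, φ x := by
  rw [UnitAddTorus.integral_preimage F 0, setIntegral_congr_set Q2_ae,
    ← (volume_preserving_finTwoArrow ℝ).setIntegral_preimage_emb
      MeasurableEquiv.finTwoArrow.measurableEmbedding]
  have : (MeasurableEquiv.finTwoArrow (α := ℝ)) ⁻¹' (Sq 0 1) =
      {x : Fin 2 → ℝ | ∀ i, x i ∈ Set.Ioc ((0 : Fin 2 → ℝ) i) ((0 : Fin 2 → ℝ) i + 1)} := by
    ext x
    simp [Sq, MeasurableEquiv.finTwoArrow, Fin.forall_fin_two]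
  rw [this]
  simp only [h]
  rfl

lemma torus_lift {f : ℝ × ℝ → ℂ} (hc : Continuous f) (hp : Per f) :
    ∃ G : C(UnitAddTorus (Fin 2), ℂ), ∀ y : Fin 2 → ℝ,
      G (fun i => (y i : UnitAddCircle)) = f (y 0, y 1) := by
  have key : ∀ y : Fin 2 → ℝ, f (Quotient.out (y 0 : UnitAddCircle), Quotient.out (y 1 : UnitAddCircle)) =
      f (y 0, y 1) := by
    intro y
    have h1 : ∀ a : ℝ, Int.fract (Quotient.out (a : UnitAddCircle)) = Int.fract a := by
      intro a
      have h2 : ((Quotient.out (a : UnitAddCircle) - a : ℝ) : UnitAddCircle) = 0 := by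
        have := QuotientAddGroup.out_eq' (a : UnitAddCircle)
        rw [AddCircle.coe_sub, sub_eq_zero]
        exact this
      rw [AddCircle.coe_eq_zero_iff] at h2
      obtain ⟨n, hn⟩ := h2
      rw [Int.fract_eq_fract]
      exact ⟨n, by rw [← hn]; simp⟩
    rw [per_reduce hp, per_reduce hp (y 0, y 1)]
    simp only [h1]
  refine ⟨⟨fun t => f (Quotient.out (t 0), Quotient.out (t 1)), ?_⟩, key⟩
  have hq : IsOpenQuotientMap (Pi.map (fun (i : Fin 2) (a : ℝ) => (a : UnitAddCircle))) :=
    IsOpenQuotientMap.piMap fun i => QuotientAddGroup.isOpenQuotientMap_mk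
  rw [← hq.continuous_comp_iff]
  have : Continuous (fun y : Fin 2 → ℝ => f (y 0, y 1)) := by fun_prop
  refine this.congr fun y => (key y).symm

lemma mF_eq (n : Fin 2 → ℤ) (y : Fin 2 → ℝ) :
    UnitAddTorus.mFourier n (fun i => (y i : UnitAddCircle)) = ch (n 0, n 1) (y 0, y 1) := by
  simp only [UnitAddTorus.mFourier, ContinuousMap.coe_mk, Fin.prod_univ_two, fourier_coe_apply, ch]
  rw [← Complex.exp_add]; congr 1; push_cast; ring

lemma mFC_eq {f : ℝ × ℝ → ℂ} (G : C(UnitAddTorus (Fin 2), ℂ)) (hG : ∀ y : Fin 2 → ℝ,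
      G (fun i => (y i : UnitAddCircle)) = f (y 0, y 1)) (n : Fin 2 → ℤ) :
    UnitAddTorus.mFourierCoeff G n = fc f (n 0, n 1) := by
  unfold UnitAddTorus.mFourierCoeff fc
  apply torus_int
  intro y
  rw [hG, UnitAddTorus.mFourier_neg, mF_eq, smul_eq_mul, mul_comm]

lemma parseval {f : ℝ × ℝ → ℂ} (hc : Continuous f) (hp : Per f) :
    HasSum (fun n => ‖fc f n‖ ^ 2) (∫ x in Q2, ‖f x‖ ^ 2) := by
  obtain ⟨G, hG⟩ := torus_lift hc hp
  have h := UnitAddTorus.hasSum_sq_mFourierCoeff (G.toLp 2 volume ℂ)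
  have e : ∫ t, ‖(G.toLp 2 volume ℂ : UnitAddTorus (Fin 2) → ℂ) t‖ ^ 2 = ∫ x in Q2, ‖f x‖ ^ 2 := by
    rw [← torus_int (fun t => ‖G t‖ ^ 2) (fun x => ‖f x‖ ^ 2) (fun y => by simp only [hG])]
    refine integral_congr_ae ?_
    filter_upwards [ContinuousMap.coeFn_toLp (p := 2) (𝕜 := ℂ) volume G] with t ht
    rw [ht]
  rw [e] at h
  simp only [UnitAddTorus.mFourierCoeff_toLp, mFC_eq G hG] at h
  rw [← (finTwoArrowEquiv ℤ).hasSum_iff]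
  exact h

lemma inversion {f : ℝ × ℝ → ℂ} (hc : Continuous f) (hp : Per f) (hs : Summable (fc f)) (x : ℝ × ℝ) :
    HasSum (fun n => fc f n * ch n x) (f x) := by
  obtain ⟨G, hG⟩ := torus_lift hc hp
  have hs' : Summable (UnitAddTorus.mFourierCoeff G) := by
    rw [← (finTwoArrowEquiv ℤ).summable_iff] at hs
    exact hs.congr fun n => (mFC_eq G hG n).symm
  have h := UnitAddTorus.hasSum_mFourier_series_apply_of_summable hs'
    (fun i => ((![x.1, x.2] i : ℝ) : UnitAddCircle))
  simp only [mFC_eq G hG, hG, mF_eq] at h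
  rw [← (finTwoArrowEquiv ℤ).hasSum_iff]
  exact h

end torus

lemma TT_L2 {K : ℝ × ℝ → ℝ} (hK : Integrable K)
    (hm : ∀ n, ‖∫ z, (K z : ℂ) * (starRingEnd ℂ) (ch n z)‖ ≤ 1)
    {g : ℝ × ℝ → ℂ} (hg : Continuous g) (hgp : Per g) :
    ∫ x in Q2, ‖TT K g x‖ ^ 2 ≤ ∫ x in Q2, ‖g x‖ ^ 2 := by
  refine hasSum_le (fun n => ?_) (parseval (TT_cont hK hg hgp) (TT_per K hgp)) (parseval hg hgp)
  rw [fc_TT hK hg hgp]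
  gcongr
  rw [norm_mul]
  exact mul_le_of_le_one_left (norm_nonneg _) (hm n)

lemma fc_bdd {f : ℝ × ℝ → ℂ} (hc : Continuous f) (hp : Per f) : ∃ B, 0 ≤ B ∧ ∀ n, ‖fc f n‖ ≤ B := by
  obtain ⟨B, hB0, hB⟩ := per_bdd hc hp
  refine ⟨B, hB0, fun n => ?_⟩
  unfold fc
  refine (norm_integral_le_of_norm_le_const (C := B) (ae_of_all _ fun x => ?_)).trans ?_
  · rw [norm_mul, RCLike.norm_conj, ch_norm, mul_one]; exact hB x
  · simp

lemma intQ2_swap (h : ℝ × ℝ → ℂ) : ∫ x in Q2, h x.swap = ∫ x in Q2, h x := by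
  have := (Measure.measurePreserving_swap (μ := (volume : Measure ℝ)) (ν := (volume : Measure ℝ))).setIntegral_preimage_emb
    MeasurableEquiv.prodComm.measurableEmbedding h Q2
  have e : Prod.swap ⁻¹' Q2 = Q2 := by ext x; simp [Q2]
  rw [e] at this
  exact this

lemma fc_swap (f : ℝ × ℝ → ℂ) (n : ℤ × ℤ) : fc (fun x => f x.swap) n = fc f n.swap := by
  unfold fc
  rw [← intQ2_swap (fun x => f x * (starRingEnd ℂ) (ch n.swap x))]
  congr 1; ext x; unfold ch; simp only [Prod.fst_swap, Prod.snd_swap]; ring_nf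

lemma Per.swap {α : Type*} {f : ℝ × ℝ → α} (hp : Per f) : Per (fun x => f x.swap) :=
  ⟨fun x => hp.2 x.swap, fun x => hp.1 x.swap⟩

def D2 (f : ℝ × ℝ → ℂ) (x : ℝ × ℝ) : ℂ := fderiv ℝ f x (0, 1)

lemma D2_smooth {f : ℝ × ℝ → ℂ} (hf : ContDiff ℝ (⊤ : ℕ∞) f) : ContDiff ℝ (⊤ : ℕ∞) (D2 f) := by
  unfold D2
  exact (hf.fderiv_right (m := (⊤ : ℕ∞)) (by simp)).clm_apply contDiff_const

lemma D2_per {f : ℝ × ℝ → ℂ} (hp : Per f) : Per (D2 f) := by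
  have key : ∀ w : ℝ × ℝ, (∀ x, f (x + w) = f x) → ∀ x, D2 f (x + w) = D2 f x := by
    intro w hw x
    unfold D2
    rw [← fderiv_comp_add_right w]
    simp only [hw]
  constructor
  · intro x
    have := key (1, 0) (fun x => by rw [← hp.1 x]; congr 1; ext <;> simp) x
    rw [← this]; congr 1; ext <;> simp
  · intro x
    have := key (0, 1) (fun x => by rw [← hp.2 x]; congr 1; ext <;> simp) x
    rw [← this]; congr 1; ext <;> simp

lemma fc_D2 {f : ℝ × ℝ → ℂ} (hf : ContDiff ℝ (⊤ : ℕ∞) f) (hp : Per f) (n : ℤ × ℤ) :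
    fc (D2 f) n = 2 * π * Complex.I * n.2 * fc f n := by
  have hc := hf.continuous
  have hc2 := (D2_smooth hf).continuous
  have hcc : Continuous (fun z => (starRingEnd ℂ) (ch n z)) := Complex.continuous_conj.comp (ch_cont n)
  unfold fc
  rw [← integral_const_mul, ← sub_eq_zero, ← integral_sub (intg_Q2 (by fun_prop)) (intg_Q2 (by fun_prop)),
    intQ2_eq (by fun_prop)]
  have : ∀ x : ℝ, ∫ y in (0:ℝ)..1, (D2 f (x, y) * (starRingEnd ℂ) (ch n (x, y)) -
      2 * π * Complex.I * n.2 * (f (x, y) * (starRingEnd ℂ) (ch n (x, y)))) = 0 := by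
    intro x
    rw [intervalIntegral.integral_eq_sub_of_hasDerivAt (f := fun y => f (x, y) * (starRingEnd ℂ) (ch n (x, y)))]
    · have h1 := hp.2 (x, 0)
      have h2 := (ch_per n).2 (x, 0)
      simp only [zero_add] at h1 h2
      rw [h1, h2, sub_self]
    · intro y _
      have hl : HasDerivAt (fun y : ℝ => (x, y)) ((0:ℝ), (1:ℝ)) y :=
        (hasDerivAt_const y x).prodMk (hasDerivAt_id y)
      have h1 : HasDerivAt (fun y => f (x, y)) (D2 f (x, y)) y :=
        ((hf.differentiable (by simp)) (x, y)).hasFDerivAt.comp_hasDerivAt y hl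
      have h2 : HasDerivAt (fun y : ℝ => (starRingEnd ℂ) (ch n (x, y)))
          (-(2 * π * Complex.I * n.2) * (starRingEnd ℂ) (ch n (x, y))) y := by
        have e : ∀ y : ℝ, (starRingEnd ℂ) (ch n (x, y)) =
            Complex.exp (-(2 * π * Complex.I * n.1 * x) + (-(2 * π * Complex.I * n.2)) * (y : ℂ)) := by
          intro y; unfold ch; rw [← Complex.exp_conj]; congr 1; simp [Complex.conj_ofNat]; ring
        simp only [e]
        have h3 : HasDerivAt (fun y : ℝ => (y : ℂ)) 1 y := Complex.ofRealCLM.hasDerivAt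
        exact ((h3.const_mul (-(2 * π * Complex.I * n.2))).const_add
          (-(2 * π * Complex.I * n.1 * x))).cexp.congr_deriv (by ring)
      exact (h1.fun_mul h2).congr_deriv (by ring)
    · have hcx : Continuous (fun y => (starRingEnd ℂ) (ch n (x, y))) := hcc.comp (by fun_prop)
      exact Continuous.intervalIntegrable (by fun_prop) _ _
  simp only [this]; simp

lemma fc_lin {f g : ℝ × ℝ → ℂ} (hf : Continuous f) (hg : Continuous g) (c : ℂ) (n : ℤ × ℤ) :
    fc (fun x => f x - c * g x) n = fc f n - c * fc g n := by
  have hcc : Continuous (fun z => (starRingEnd ℂ) (ch n z)) := Complex.continuous_conj.comp (ch_cont n)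
  unfold fc
  rw [← integral_const_mul, ← integral_sub (intg_Q2 (by fun_prop)) (intg_Q2 (by fun_prop))]
  congr 1; ext x; ring

lemma E2_ex {f : ℝ × ℝ → ℂ} (hf : ContDiff ℝ (⊤ : ℕ∞) f) (hp : Per f) :
    ∃ g : ℝ × ℝ → ℂ, ContDiff ℝ (⊤ : ℕ∞) g ∧ Per g ∧ ∀ n, fc g n = (1 + (n.2:ℂ) ^ 2) * fc f n := by
  have s2 := D2_smooth (D2_smooth hf)
  refine ⟨fun x => f x - (4 * π ^ 2 : ℂ)⁻¹ * D2 (D2 f) x, hf.sub (contDiff_const.mul s2),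
    hp.map2 (D2_per (D2_per hp)) fun a b => a - (4 * π ^ 2 : ℂ)⁻¹ * b, fun n => ?_⟩
  rw [fc_lin hf.continuous s2.continuous, fc_D2 (D2_smooth hf) (D2_per hp), fc_D2 hf hp]
  have : (π : ℂ) ≠ 0 := by exact_mod_cast pi_ne_zero
  field_simp
  linear_combination (-(n.2:ℂ)^2 * fc f n * 4) * Complex.I_sq

lemma fc_summable {f : ℝ × ℝ → ℂ} (hf : ContDiff ℝ (⊤ : ℕ∞) f) (hp : Per f) : Summable (fc f) := by
  obtain ⟨g, hg, hgp, hgf⟩ := E2_ex hf hp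
  obtain ⟨k, hk, hkp, hkf⟩ := E2_ex (f := fun x => g x.swap)
    (hg.comp (contDiff_snd.prodMk contDiff_fst)) hgp.swap
  obtain ⟨B, hB0, hB⟩ := fc_bdd hk.continuous hkp
  have h1 : Summable (fun n : ℤ => (1 + (n:ℝ) ^ 2)⁻¹) := by
    have := (Real.summable_one_div_int_pow (p := 2)).2 (by norm_num)
    refine Summable.of_norm_bounded_eventually this ?_
    have hfin : Set.Finite {n : ℤ | ¬ (‖(1 + (n:ℝ) ^ 2)⁻¹‖ ≤ 1 / (n:ℝ) ^ 2)} := by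
      refine (Set.finite_singleton (0:ℤ)).subset fun n hn => ?_
      by_contra h
      apply hn
      have h0 : (n:ℝ) ≠ 0 := by exact_mod_cast h
      have : 0 < (n:ℝ) ^ 2 := by positivity
      rw [norm_of_nonneg (by positivity), ← one_div]
      gcongr; linarith
    exact hfin
  have h2 := (h1.mul_of_nonneg h1 (fun n => by positivity) (fun n => by positivity)).mul_left B
  refine Summable.of_norm_bounded h2 fun n => ?_
  have e := hkf n.swap
  rw [fc_swap, Prod.swap_swap, hgf] at e
  have e2 := hB n.swap
  rw [e, norm_mul, norm_mul] at e2
  have c : ∀ m : ℤ, ‖1 + (m:ℂ) ^ 2‖ = 1 + (m:ℝ) ^ 2 := by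
    intro m
    rw [show (1 + (m:ℂ) ^ 2) = ((1 + (m:ℝ) ^ 2 : ℝ) : ℂ) by push_cast; rfl, Complex.norm_real,
      norm_of_nonneg (by positivity)]
  rw [c, c] at e2
  simp only [Prod.snd_swap] at e2
  rw [← mul_inv, ← div_eq_mul_inv, le_div_iff₀ (by positivity)]
  linarith

structure CZ (A : ℝ) (K : ℝ × ℝ → ℝ) : Prop where
  pos : 0 ≤ A
  int : Integrable K
  even : ∀ z, K (-z) = K z
  mult : ∀ n, ‖∫ z, (K z : ℂ) * (starRingEnd ℂ) (ch n z)‖ ≤ 1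
  smooth : ∀ a z z' : ℝ × ℝ, ∀ d r : ℝ, 0 < d → 0 ≤ r → z ∈ Metric.closedBall a r →
    z' ∈ Metric.closedBall a r → d + r ≤ ‖a‖ → |K z - K z'| ≤ A * r / d ^ 3

lemma CSq {h : ℝ × ℝ → ℂ} (hc : Continuous h) (a : ℝ × ℝ) {r W : ℝ} (hr : 0 ≤ r) (hW : 0 ≤ W)
    (H : ∫ y in Metric.closedBall a r, ‖h y‖ ^ 2 ≤ W ^ 2 * (2 * r) ^ 2) :
    ∫ y in Metric.closedBall a r, ‖h y‖ ≤ W * (2 * r) ^ 2 := by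
  have key : ∀ l : ℝ, 0 < l → ∫ y in Metric.closedBall a r, ‖h y‖ ≤
      (2 * l)⁻¹ * (W ^ 2 * (2 * r) ^ 2) + l / 2 * (2 * r) ^ 2 := by
    intro l hl
    calc _ ≤ ∫ y in Metric.closedBall a r, ((2 * l)⁻¹ * ‖h y‖ ^ 2 + l / 2) := by
          refine setIntegral_mono (intg_cb (by fun_prop) _ _) (intg_cb (by fun_prop) _ _) fun y => ?_
          have : 0 ≤ (2 * l)⁻¹ * (‖h y‖ - l) ^ 2 := by positivity
          have e : (2 * l)⁻¹ * (‖h y‖ - l) ^ 2 = (2 * l)⁻¹ * ‖h y‖ ^ 2 + l / 2 - ‖h y‖ := by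
            field_simp; ring
          dsimp only
          linarith
      _ = (2 * l)⁻¹ * (∫ y in Metric.closedBall a r, ‖h y‖ ^ 2) + l / 2 * (2 * r) ^ 2 := by
          rw [integral_add (intg_cb (by fun_prop) _ _) (intg_cb (by fun_prop) _ _),
            integral_const_mul, setIntegral_const, vol_cb_real a r hr, smul_eq_mul]; ring
      _ ≤ _ := by gcongr
  refine le_of_forall_pos_le_add fun ε hε => ?_
  set l := W + ε / (1 + (2 * r) ^ 2) with hl
  have h1 : 0 < ε / (1 + (2 * r) ^ 2) := by positivity
  have hl0 : 0 < l := by linarith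
  refine (key l hl0).trans ?_
  have h2 : (2 * l)⁻¹ * W ^ 2 ≤ W / 2 := by
    rw [inv_mul_le_iff₀ (by positivity)]
    nlinarith
  have h3 : ε / (1 + (2 * r) ^ 2) * (2 * r) ^ 2 ≤ ε := by
    rw [div_mul_eq_mul_div, div_le_iff₀ (by positivity)]
    nlinarith
  have h4 := mul_le_mul_of_nonneg_right h2 (sq_nonneg (2 * r))
  have h5 : l / 2 * (2 * r) ^ 2 = W / 2 * (2 * r) ^ 2 + (ε / (1 + (2 * r) ^ 2) * (2 * r) ^ 2) / 2 := by
    rw [hl]; ring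
  rw [h5]
  linarith

/-- torus distance to the origin -/
def dT (x : ℝ × ℝ) : ℝ := max ‖((x.1 : ℝ) : UnitAddCircle)‖ ‖((x.2 : ℝ) : UnitAddCircle)‖

lemma dT_cont : Continuous dT := by
  unfold dT
  have : Continuous (fun t : ℝ => ‖(t : UnitAddCircle)‖) := continuous_norm.comp (AddCircle.continuous_mk' 1)
  exact (this.comp continuous_fst).max (this.comp continuous_snd)

lemma dT_per : Per dT := by
  constructor <;> intro x <;> simp [dT]

lemma dT_le (x : ℝ × ℝ) : dT x ≤ ‖x‖ := by
  have : ∀ t : ℝ, ‖(t : UnitAddCircle)‖ ≤ |t| := fun t => by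
    rw [UnitAddCircle.norm_eq]
    simpa using round_le t 0
  rw [Prod.norm_def]
  exact max_le_max (this _) (this _)

lemma dT_eq (x : ℝ × ℝ) (hx : ‖x‖ ≤ 1 / 2) : dT x = ‖x‖ := by
  have : ∀ t : ℝ, |t| ≤ 1 / 2 → ‖(t : UnitAddCircle)‖ = |t| := fun t ht => by
    have := (AddCircle.norm_coe_eq_abs_iff (p := (1:ℝ)) (x := t) one_ne_zero).2 (by simpa using ht)
    exact this
  rw [Prod.norm_def] at hx ⊢
  unfold dT
  rw [this _ ((le_max_left _ _).trans hx), this _ ((le_max_right _ _).trans hx)]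
  rfl

def eta (a : ℝ × ℝ) (r : ℝ) (y : ℝ × ℝ) : ℝ := max 0 (min 1 (2 - dT (y - a) / (2 * r)))

lemma eta_cont (a : ℝ × ℝ) (r : ℝ) : Continuous (eta a r) := by
  unfold eta
  have := dT_cont
  fun_prop

lemma eta_per (a : ℝ × ℝ) (r : ℝ) : Per (eta a r) :=
  (dT_per.shift_sub a).comp fun t => max 0 (min 1 (2 - t / (2 * r)))

lemma eta_mem (a : ℝ × ℝ) (r : ℝ) (y : ℝ × ℝ) : 0 ≤ eta a r y ∧ eta a r y ≤ 1 :=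
  ⟨le_max_left _ _, max_le zero_le_one (min_le_left _ _)⟩

lemma eta_one (a : ℝ × ℝ) {r : ℝ} (hr : 0 < r) (y : ℝ × ℝ) (hy : ‖y - a‖ ≤ 2 * r) : eta a r y = 1 := by
  have h1 := (dT_le (y - a)).trans hy
  have : dT (y - a) / (2 * r) ≤ 1 := by rw [div_le_one (by positivity)]; exact h1
  unfold eta
  rw [min_eq_left (by linarith), max_eq_right zero_le_one]

lemma eta_zero (a : ℝ × ℝ) {r : ℝ} (hr : 0 < r) (y : ℝ × ℝ) (hy : ‖y - a‖ ≤ 1 / 2) (hy2 : 4 * r ≤ ‖y - a‖) :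
    eta a r y = 0 := by
  have : 2 ≤ dT (y - a) / (2 * r) := by
    rw [dT_eq _ hy, le_div_iff₀ (by positivity)]; linarith
  unfold eta
  rw [max_eq_left]
  exact (min_le_right _ _).trans (by linarith)

/-- local part -/
lemma loc_part {A : ℝ} {K : ℝ × ℝ → ℝ} (hK : CZ A K) {g : ℝ × ℝ → ℂ} (hg : Continuous g) (hgp : Per g)
    (a : ℝ × ℝ) {r W : ℝ} (hr : 0 < r) (hr2 : r ≤ 1 / 2) (hW : 0 ≤ W)
    (H : ∫ y in Q2, ‖g y‖ ^ 2 ≤ W ^ 2 * (2 * r) ^ 2) :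
    ∫ y in Metric.closedBall a r, ‖TT K g y‖ ≤ W * (2 * r) ^ 2 := by
  have hT := TT_cont hK.int hg hgp
  refine CSq hT a hr.le hW ?_
  refine le_trans ?_ ((TT_L2 hK.int hK.mult hg hgp).trans H)
  rw [← int_cb_half (h := fun y => ‖TT K g y‖ ^ 2) (by fun_prop)
    ((TT_per K hgp).comp fun t => ‖t‖ ^ 2) (fun y => by positivity) a]
  exact int_cb_mono (by fun_prop) (fun y => by positivity) (Metric.closedBall_subset_closedBall hr2)

def ZZ : ℝ := ∑' k : ℕ, (1 + (k:ℝ)) * (1 / 2) ^ k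

lemma ZZ_sum : Summable (fun k : ℕ => (1 + (k:ℝ)) * (1 / 2 : ℝ) ^ k) := by
  have h1 := summable_geometric_of_lt_one (r := (1/2:ℝ)) (by norm_num) (by norm_num)
  have h2 := summable_pow_mul_geometric_of_norm_lt_one 1 (r := (1/2:ℝ)) (by norm_num)
  refine (h1.add h2).congr fun k => by simp; ring

lemma ZZ_nn : 0 ≤ ZZ := tsum_nonneg fun k => by positivity

/-- far part -/
lemma far_part {A : ℝ} {K : ℝ × ℝ → ℝ} (hK : CZ A K) {g h : ℝ × ℝ → ℂ} (hg : Continuous g)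
    (hh : Continuous h) (hhp : Per h) (hhg : ∀ y, ‖h y‖ ≤ ‖g y‖)
    (a : ℝ × ℝ) {r V : ℝ} (hr : 0 < r) (hV : 0 ≤ V) (hh0 : ∀ y, ‖y - a‖ ≤ 2 * r → h y = 0)
    (H : ∀ k : ℕ, ∫ y in Metric.closedBall a (2 ^ k * r), ‖g y‖ ≤ V * (1 + k) * (2 * (2 ^ k * r)) ^ 2)
    (x : ℝ × ℝ) (hx : x ∈ Metric.closedBall a r) :
    ‖TT K h x - TT K h a‖ ≤ 256 * A * ZZ * V := by
  have hA := hK.pos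
  have hZ := ZZ_nn
  set c : ℕ → ℝ := fun k => 64 * A * (1 / 8) ^ k / r ^ 2 with hc
  have e8 : ∀ k : ℕ, (8:ℝ) ^ k = (2 ^ k) ^ 3 := fun k => by
    rw [show (8:ℝ) = 2 ^ 3 by norm_num, ← pow_mul, mul_comm 3 k, pow_mul]
  have hc0 : ∀ k, 0 ≤ c k := fun k => by simp only [hc]; positivity
  rw [TT_swap, TT_swap, ← integral_sub (TT_int' hK.int hh hhp x) (TT_int' hK.int hh hhp a)]
  have hpt : ∀ y, ENNReal.ofReal ‖(K (x - y) : ℂ) * h y - (K (a - y) : ℂ) * h y‖ ≤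
      ∑' k : ℕ, ENNReal.ofReal (c k) * (Metric.closedBall a (2 ^ k * r)).indicator
        (fun y => ENNReal.ofReal ‖g y‖) y := by
    intro y
    by_cases hy : ‖y - a‖ ≤ 2 * r
    · rw [hh0 y hy]; simp
    push Not at hy
    -- choose k
    obtain ⟨k, hk1, hk2⟩ : ∃ k : ℕ, 2 ^ k * r < ‖y - a‖ ∧ ‖y - a‖ ≤ 2 ^ (k + 1) * r := by
      have hex : ∃ k : ℕ, ‖y - a‖ ≤ 2 ^ k * r := by
        obtain ⟨k, hk⟩ := pow_unbounded_of_one_lt (‖y - a‖ / r) (one_lt_two)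
        exact ⟨k, by rw [div_lt_iff₀ hr] at hk; exact hk.le⟩
      classical
      have hm := Nat.find_spec hex
      have hn : Nat.find hex ≠ 0 := by
        intro h0; rw [h0] at hm; simp at hm; linarith
      obtain ⟨k, hk⟩ := Nat.exists_eq_succ_of_ne_zero hn
      refine ⟨k, ?_, by rw [hk] at hm; exact hm⟩
      have := Nat.find_min hex (m := k) (by omega)
      push Not at this; exact this
    have hk0 : 1 ≤ k := by
      by_contra h0
      have : k = 0 := by omega
      rw [this] at hk2; simp at hk2; linarith
    have h2k : (2:ℝ) ≤ 2 ^ k := by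
      calc (2:ℝ) = 2 ^ 1 := by norm_num
        _ ≤ 2 ^ k := pow_le_pow_right₀ (by norm_num) hk0
    refine le_trans ?_ (ENNReal.le_tsum (k + 1))
    have hmem : y ∈ Metric.closedBall a (2 ^ (k + 1) * r) := by
      rw [mem_closedBall_iff_norm]; exact hk2
    rw [Set.indicator_of_mem hmem, ← ENNReal.ofReal_mul (hc0 _)]
    apply ENNReal.ofReal_le_ofReal
    rw [← sub_mul, norm_mul, ← Complex.ofReal_sub, Complex.norm_real]
    refine mul_le_mul ?_ (hhg y) (norm_nonneg _) (hc0 _)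
    have h1 := hK.smooth (a - y) (x - y) (a - y) (2 ^ k * r / 2) r (by positivity) hr.le
      (by rw [mem_closedBall_iff_norm] at hx ⊢; simpa using hx) (Metric.mem_closedBall_self hr.le)
      (by rw [norm_sub_rev]; nlinarith)
    refine h1.trans (le_of_eq ?_)
    simp only [hc]
    rw [one_div_pow, pow_succ 8, e8]
    field_simp
    ring
  have hL : ∫⁻ y, ENNReal.ofReal ‖(K (x - y) : ℂ) * h y - (K (a - y) : ℂ) * h y‖ ≤
      ENNReal.ofReal (256 * A * ZZ * V) := by
    calc _ ≤ ∫⁻ y, ∑' k : ℕ, ENNReal.ofReal (c k) * (Metric.closedBall a (2 ^ k * r)).indicator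
              (fun y => ENNReal.ofReal ‖g y‖) y := lintegral_mono hpt
      _ = ∑' k : ℕ, ENNReal.ofReal (c k) * ∫⁻ y in Metric.closedBall a (2 ^ k * r), ENNReal.ofReal ‖g y‖ := by
        rw [lintegral_tsum]
        · congr 1; ext k
          rw [lintegral_const_mul' _ _ ENNReal.ofReal_ne_top, lintegral_indicator Metric.isClosed_closedBall.measurableSet]
        · intro k
          refine AEMeasurable.const_mul (Measurable.aemeasurable ?_) _
          exact Measurable.indicator (by fun_prop) Metric.isClosed_closedBall.measurableSet
      _ ≤ ∑' k : ℕ, ENNReal.ofReal (256 * A * V * ((1 + (k:ℝ)) * (1 / 2) ^ k)) := by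
        refine ENNReal.tsum_le_tsum fun k => ?_
        rw [← ofReal_integral_eq_lintegral_ofReal (intg_cb (by fun_prop) _ _)
          (ae_of_all _ fun y => norm_nonneg _), ← ENNReal.ofReal_mul (hc0 _)]
        apply ENNReal.ofReal_le_ofReal
        refine (mul_le_mul_of_nonneg_left (H k) (hc0 k)).trans (le_of_eq ?_)
        simp only [hc]
        rw [one_div_pow, one_div_pow, e8]
        field_simp
        ring
      _ = _ := by
        rw [← ENNReal.ofReal_tsum_of_nonneg (fun k => by positivity) (ZZ_sum.mul_left _), tsum_mul_left]
        congr 1; unfold ZZ; ring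
  refine (norm_integral_le_lintegral_norm _).trans ?_
  exact ENNReal.toReal_le_of_le_ofReal (by positivity) hL

theorem CZlem {A : ℝ} {K : ℝ × ℝ → ℝ} (hK : CZ A K) {g : ℝ × ℝ → ℂ} (hg : Continuous g) (hgp : Per g)
    (a : ℝ × ℝ) {r : ℝ} (hr : 0 < r) (hr2 : r ≤ 1 / 2) :
    ∃ c : ℂ, (r = 1 / 2 → c = 0) ∧ ∀ V : ℝ, 0 ≤ V →
      (∀ k : ℕ, ∫ y in Metric.closedBall a (2 ^ k * r), ‖g y‖ ≤ V * (1 + k) * (2 * (2 ^ k * r)) ^ 2) →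
      (∫ y in Metric.closedBall a (2 ^ 2 * r), ‖g y‖ ^ 2 ≤ V ^ 2 * (2 * (2 ^ 2 * r)) ^ 2) →
      ∫ y in Metric.closedBall a r, ‖TT K g y - c‖ ≤ (4 + 256 * A * ZZ) * V * (2 * r) ^ 2 := by
  have hA := hK.pos
  have hZ := ZZ_nn
  by_cases hr8 : 1 / 8 ≤ r
  · refine ⟨0, fun _ => rfl, fun V hV H H2 => ?_⟩
    simp only [sub_zero]
    have h1 := loc_part hK hg hgp a hr hr2 (W := 4 * V) (by positivity) (by
      rw [← int_cb_half (h := fun y => ‖g y‖ ^ 2) (by fun_prop)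
        (hgp.comp fun t => ‖t‖ ^ 2) (fun y => by positivity) a]
      refine (int_cb_mono (by fun_prop) (fun y => by positivity)
        (Metric.closedBall_subset_closedBall (by linarith))).trans (H2.trans (le_of_eq ?_))
      ring)
    have : 0 ≤ 256 * A * ZZ * V * (2 * r) ^ 2 := by positivity
    nlinarith
  push Not at hr8
  have hec := eta_cont a r
  have hep := eta_per a r
  set g1 : ℝ × ℝ → ℂ := fun y => (eta a r y : ℂ) * g y with hg1
  set g2 : ℝ × ℝ → ℂ := fun y => ((1 - eta a r y : ℝ) : ℂ) * g y with hg2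
  have c1 : Continuous g1 := by fun_prop
  have c2 : Continuous g2 := by fun_prop
  have p1 : Per g1 := hep.map2 hgp fun s t => (s : ℂ) * t
  have p2 : Per g2 := hep.map2 hgp fun s t => ((1 - s : ℝ) : ℂ) * t
  have hsum : ∀ x, TT K g x = TT K g1 x + TT K g2 x := by
    intro x
    rw [← TT_add hK.int c1 p1 c2 p2]
    congr 1; ext y; simp only [hg1, hg2]; push_cast; ring
  have t1 := TT_cont hK.int c1 p1
  have t2 := TT_cont hK.int c2 p2
  refine ⟨TT K g2 a, fun h => by linarith, fun V hV H H2 => ?_⟩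
  have hl := loc_part hK c1 p1 a hr hr2 (W := 4 * V) (by positivity) (by
      rw [← int_cb_half (h := fun y => ‖g1 y‖ ^ 2) (by fun_prop)
        (p1.comp fun t => ‖t‖ ^ 2) (fun y => by positivity) a]
      calc ∫ y in Metric.closedBall a (1 / 2), ‖g1 y‖ ^ 2
          = ∫ y in Metric.closedBall a (2 ^ 2 * r), ‖g1 y‖ ^ 2 := by
            refine (setIntegral_eq_of_subset_of_forall_sdiff_eq_zero Metric.isClosed_closedBall.measurableSet
              (Metric.closedBall_subset_closedBall (by linarith)) fun y hy => ?_)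
            have h1 := hy.1
            have h2 := hy.2
            rw [mem_closedBall_iff_norm] at h1 h2
            simp only [hg1, eta_zero a hr y h1 (by linarith)]
            simp
        _ ≤ ∫ y in Metric.closedBall a (2 ^ 2 * r), ‖g y‖ ^ 2 := by
            refine setIntegral_mono (intg_cb (by fun_prop) _ _) (intg_cb (by fun_prop) _ _) fun y => ?_
            simp only [hg1, norm_mul, Complex.norm_real]
            have h := eta_mem a r y
            rw [norm_of_nonneg h.1]
            exact pow_le_pow_left₀ (mul_nonneg h.1 (norm_nonneg _))
              (mul_le_of_le_one_left (norm_nonneg (g y)) h.2) 2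
        _ ≤ _ := H2
        _ = _ := by ring)
  have hf := far_part hK hg c2 p2 (fun y => by
      simp only [hg2, norm_mul, Complex.norm_real]
      have h := eta_mem a r y
      rw [norm_of_nonneg (show (0:ℝ) ≤ 1 - eta a r y by linarith)]
      exact mul_le_of_le_one_left (norm_nonneg _) (by linarith)) a hr hV (fun y hy => by
      simp only [hg2, eta_one a hr y hy]; simp) H
  calc ∫ y in Metric.closedBall a r, ‖TT K g y - TT K g2 a‖
      ≤ ∫ y in Metric.closedBall a r, (‖TT K g1 y‖ + 256 * A * ZZ * V) := by
        have := TT_cont hK.int hg hgp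
        refine setIntegral_mono_on (intg_cb (by fun_prop) _ _) (intg_cb (by fun_prop) _ _)
          Metric.isClosed_closedBall.measurableSet fun y hy => ?_
        rw [hsum, add_sub_assoc]
        exact (norm_add_le _ _).trans (by gcongr; exact hf y hy)
    _ = (∫ y in Metric.closedBall a r, ‖TT K g1 y‖) + 256 * A * ZZ * V * (2 * r) ^ 2 := by
        rw [integral_add (intg_cb (by fun_prop) _ _) (intg_cb (by fun_prop) _ _),
            setIntegral_const, vol_cb_real a r hr.le, smul_eq_mul]; ring
    _ ≤ _ := by nlinarith

def Nn (p : ℝ) (f : ℝ × ℝ → ℂ) : ENNReal := ∫⁻ x in Q2, ENNReal.ofReal (‖f x‖ ^ p)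

def Ms (s : ℝ) (h : ℝ × ℝ → ℂ) (z : ℝ × ℝ) : ℝ := (MR (fun y => ‖h y‖ ^ s) z) ^ (1 / s)

lemma Ms_nn (s : ℝ) (h : ℝ × ℝ → ℂ) (z : ℝ × ℝ) : 0 ≤ Ms s h z := rpow_nonneg (MR_nonneg _ _) _

lemma cont_rpow {h : ℝ × ℝ → ℂ} (hc : Continuous h) {s : ℝ} (hs : 0 ≤ s) :
    Continuous (fun y => ‖h y‖ ^ s) := hc.norm.rpow_const fun _ => Or.inr hs

lemma Ms_meas {s : ℝ} (hs : 0 ≤ s) {h : ℝ × ℝ → ℂ} (hc : Continuous h) : Measurable (Ms s h) :=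
  (MR_meas (cont_rpow hc hs)).pow_const _

lemma Ms_strong {s p : ℝ} (hs : 1 < s) (hp : s < p) : ∃ C : ℝ, 0 < C ∧ ∀ h : ℝ × ℝ → ℂ, Continuous h →
    Per h → ∫⁻ x in Q2, ENNReal.ofReal (Ms s h x ^ p) ≤ ENNReal.ofReal C * Nn p h := by
  have hs0 : 0 < s := by linarith
  obtain ⟨C, hC, H⟩ := MR_strong (p / s) (by rw [lt_div_iff₀ hs0]; linarith)
  refine ⟨C, hC, fun h hc hp => ?_⟩
  have := H (fun y => ‖h y‖ ^ s) (cont_rpow hc hs0.le) (hp.comp fun t => ‖t‖ ^ s) (fun x => by positivity)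
  unfold Nn Ms
  convert this using 4 with x
  · rw [← rpow_mul (MR_nonneg _ _)]; congr 1; ring
  · rw [← rpow_mul (norm_nonneg _)]; congr 1; field_simp

lemma cell_ae : Q2 =ᵐ[volume] Metric.closedBall ((1/2, 1/2) : ℝ × ℝ) (1/2) := by
  refine Q2_ae.trans ?_
  have := cb_ae ((1/2, 1/2) : ℝ × ℝ) (1/2)
  refine Filter.EventuallyEq.trans ?_ this.symm
  norm_num
  rfl

lemma FScell {p : ℝ} (hp : 0 < p) : ∃ C : ℝ, 0 < C ∧ ∀ g : ℝ × ℝ → ℂ, Continuous g →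
    ∀ v : ℝ × ℝ → ℝ, Measurable v → (∀ x, 0 ≤ v x) →
    (∀ a r, 0 < r → r ≤ 1 / 2 → ∃ c : ℂ, (r = 1 / 2 → c = 0) ∧ ∀ z ∈ Metric.closedBall a r,
      ∫ y in Metric.closedBall a r, ‖g y - c‖ ≤ v z * (2 * r) ^ 2) →
    Nn p g ≤ ENNReal.ofReal C * ∫⁻ x in Q2, ENNReal.ofReal (v x ^ p) := by
  obtain ⟨C, hC, H⟩ := FS p hp
  refine ⟨C, hC, fun g hg v hv hv0 h => ?_⟩
  unfold Nn
  rw [setLIntegral_congr cell_ae, setLIntegral_congr cell_ae]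
  refine H (1/2, 1/2) (1/2) (by norm_num) g hg v hv hv0 ?_ ?_
  · obtain ⟨c, hc, hh⟩ := h (1/2, 1/2) (1/2) (by norm_num) le_rfl
    rw [hc rfl] at hh
    simpa using hh
  · intro a' r hr hsub
    have hr2 : r ≤ 1 / 2 := by
      have := measure_mono (μ := volume) hsub
      rw [vol_cb _ _ hr.le, vol_cb _ _ (by norm_num), ENNReal.ofReal_le_ofReal_iff (by norm_num)] at this
      nlinarith
    obtain ⟨c, hc, hh⟩ := h a' r hr hr2
    exact ⟨c, hh⟩

lemma T_Lp {A p : ℝ} (hA : 0 ≤ A) (hp : 2 < p) : ∃ C : ℝ, 0 < C ∧ ∀ K, CZ A K → ∀ f : ℝ × ℝ → ℂ,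
    Continuous f → Per f → Nn p (TT K f) ≤ ENNReal.ofReal C * Nn p f := by
  obtain ⟨C1, hC1, H1⟩ := FScell (p := p) (by linarith)
  obtain ⟨C2, hC2, H2⟩ := Ms_strong (s := 2) (p := p) (by norm_num) hp
  have hZ := ZZ_nn
  set D : ℝ := (4 + 256 * A * ZZ) * 4 with hD
  have hD0 : 0 < D := by positivity
  refine ⟨C1 * (D ^ p * C2), by positivity, fun K hK f hf hfp => ?_⟩
  have h1 := H1 (TT K f) (TT_cont hK.int hf hfp) (fun z => D * Ms 2 f z)
    ((Ms_meas (by norm_num) hf).const_mul D) (fun x => mul_nonneg hD0.le (Ms_nn _ _ _)) (by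
      intro a r hr hr2
      obtain ⟨c, hc, hh⟩ := CZlem hK hf hfp a hr hr2
      refine ⟨c, hc, fun z hz => ?_⟩
      have hM := Ms_nn 2 f z
      have hsq : Ms 2 f z ^ 2 = MR (fun y => ‖f y‖ ^ 2) z := by
        unfold Ms
        rw [← rpow_two, ← rpow_mul (MR_nonneg _ _)]
        norm_num
      have hball : ∀ k : ℕ, ∫ y in Metric.closedBall a (2 ^ k * r), ‖f y‖ ^ 2 ≤
          (4 * Ms 2 f z) ^ 2 * (2 * (2 ^ k * r)) ^ 2 := by
        intro k
        have hk : (1:ℝ) ≤ 2 ^ k := one_le_pow₀ (by norm_num)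
        refine (MR_ball (h := fun y => ‖f y‖ ^ 2) (by fun_prop) (hfp.comp fun t => ‖t‖ ^ 2)
          (fun x => by positivity) a (by positivity) z
          (Metric.closedBall_subset_closedBall (by nlinarith) hz)).trans (le_of_eq ?_)
        rw [mul_pow 4, hsq]; ring
      have h3 := hh (4 * Ms 2 f z) (by positivity) (fun k => by
        refine (CSq hf a (by positivity) (by positivity) (hball k)).trans ?_
        have : 0 ≤ 4 * Ms 2 f z * k * (2 * (2 ^ k * r)) ^ 2 := by positivity
        calc 4 * Ms 2 f z * (2 * (2 ^ k * r)) ^ 2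
            ≤ 4 * Ms 2 f z * (2 * (2 ^ k * r)) ^ 2 + 4 * Ms 2 f z * k * (2 * (2 ^ k * r)) ^ 2 :=
              le_add_of_nonneg_right this
          _ = _ := by ring) (hball 2)
      refine h3.trans (le_of_eq ?_)
      rw [hD]; ring)
  refine h1.trans ?_
  rw [ENNReal.ofReal_mul hC1.le, mul_assoc]
  gcongr
  calc ∫⁻ x in Q2, ENNReal.ofReal ((D * Ms 2 f x) ^ p)
      = ENNReal.ofReal (D ^ p) * ∫⁻ x in Q2, ENNReal.ofReal (Ms 2 f x ^ p) := by
        rw [← lintegral_const_mul' _ _ ENNReal.ofReal_ne_top]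
        congr 1; ext x
        rw [mul_rpow hD0.le (Ms_nn _ _ _), ENNReal.ofReal_mul (by positivity)]
    _ ≤ _ := by
        rw [ENNReal.ofReal_mul (by positivity), mul_assoc]
        gcongr
        exact H2 f hf hfp

def SS (K b : ℝ × ℝ → ℝ) (f : ℝ × ℝ → ℂ) (x : ℝ × ℝ) : ℂ :=
  (b x : ℂ) * TT K f x - TT K (fun y => (b y : ℂ) * f y) x

lemma SS_eq {K : ℝ × ℝ → ℝ} (hK : Integrable K) {b : ℝ × ℝ → ℝ} (hb : Continuous b) (hbp : Per b)
    {f : ℝ × ℝ → ℂ} (hf : Continuous f) (hfp : Per f) (c : ℝ) (x : ℝ × ℝ) :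
    SS K b f x = ((b x - c : ℝ) : ℂ) * TT K f x - TT K (fun y => ((b y - c : ℝ) : ℂ) * f y) x := by
  have e : (fun y => ((b y - c : ℝ) : ℂ) * f y) = fun y => (b y : ℂ) * f y - (c : ℂ) * f y := by
    ext y; push_cast; ring
  rw [e, TT_sub hK (by fun_prop) (hbp.map2 hfp fun s t => (s : ℂ) * t) (by fun_prop)
    (hfp.comp fun t => (c : ℂ) * t), TT_smul]
  unfold SS; push_cast; ring

lemma SS_cont {K : ℝ × ℝ → ℝ} (hK : Integrable K) {b : ℝ × ℝ → ℝ} (hb : Continuous b) (hbp : Per b)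
    {f : ℝ × ℝ → ℂ} (hf : Continuous f) (hfp : Per f) : Continuous (SS K b f) := by
  have h1 := TT_cont hK hf hfp
  have h2 := TT_cont hK (g := fun y => (b y : ℂ) * f y) (by fun_prop)
    (hbp.map2 hfp fun s t => (s : ℂ) * t)
  unfold SS; fun_prop

lemma SS_per {K : ℝ × ℝ → ℝ} {b : ℝ × ℝ → ℝ} (hbp : Per b)
    {f : ℝ × ℝ → ℂ} (hfp : Per f) : Per (SS K b f) :=
  (hbp.map2 (TT_per K hfp) fun s t => (s : ℂ) * t).map2
    (TT_per K (hbp.map2 hfp fun s t => (s : ℂ) * t)) fun s t => s - t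

lemma rpow_add_le' {x y p : ℝ} (hx : 0 ≤ x) (hy : 0 ≤ y) (hp : 0 ≤ p) :
    (x + y) ^ p ≤ 2 ^ p * (x ^ p + y ^ p) := by
  have h1 : x + y ≤ 2 * max x y := by linarith [le_max_left x y, le_max_right x y]
  refine (rpow_le_rpow (by positivity) h1 hp).trans ?_
  rw [mul_rpow (by norm_num) (by positivity)]
  gcongr
  rcases max_choice x y with h | h <;> rw [h]
  · linarith [rpow_nonneg hy p]
  · linarith [rpow_nonneg hx p]

theorem comm_big {A p : ℝ} (hA : 0 ≤ A) (hp : 2 < p) : ∃ C : ℝ, 0 < C ∧ ∀ K, CZ A K →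
    ∀ (b : ℝ × ℝ → ℝ) (β : ℝ), Continuous b → Per b → 0 ≤ β → HB b β → ∀ f : ℝ × ℝ → ℂ,
    Continuous f → Per f → Nn p (SS K b f) ≤ ENNReal.ofReal (C * β ^ p) * Nn p f := by
  obtain ⟨C1, hC1, H1⟩ := FScell (p := p) (by linarith)
  set s : ℝ := (p + 2) / 2 with hs
  have hs2 : 2 < s := by rw [hs]; linarith
  have hsp : s < p := by rw [hs]; linarith
  obtain ⟨C2, hC2, H2⟩ := Ms_strong (s := s) (p := p) (by linarith) hsp
  obtain ⟨C3, hC3, H3⟩ := HJN s (by linarith) 1 one_pos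
  obtain ⟨C4, hC4, H4⟩ := HJN (s / 2) (by linarith) 2 two_pos
  obtain ⟨C5, hC5, H5⟩ := T_Lp hA hp
  have hZ := ZZ_nn
  set D : ℝ := (4 + 256 * A * ZZ) * (C3 + 9 * C4 + 1) + C3 with hD
  have hD0 : 0 < D := by positivity
  refine ⟨C1 * (D ^ p * 2 ^ p * (C2 * C5 + C2)), by positivity, fun K hK b β hb hbp hβ hHB f hf hfp => ?_⟩
  have hTc := TT_cont hK.int hf hfp
  have hTp := TT_per K hfp
  have h1 := H1 (SS K b f) (SS_cont hK.int hb hbp hf hfp)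
    (fun z => D * β * (Ms s (TT K f) z + Ms s f z))
    (((Ms_meas (by linarith) hTc).add (Ms_meas (by linarith) hf)).const_mul _)
    (fun x => mul_nonneg (by positivity) (add_nonneg (Ms_nn _ _ _) (Ms_nn _ _ _))) (by
      intro a r hr hr2
      set c := av b a r with hc
      have hgc : Continuous (fun y => ((b y - c : ℝ) : ℂ) * f y) := by fun_prop
      have hgp : Per (fun y => ((b y - c : ℝ) : ℂ) * f y) := hbp.map2 hfp fun s t => ((s - c : ℝ) : ℂ) * t
      have hgn : ∀ y, ‖((b y - c : ℝ) : ℂ) * f y‖ = |b y - c| * ‖f y‖ := fun y => by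
        rw [norm_mul, Complex.norm_real, norm_eq_abs]
      obtain ⟨c', hc', hh⟩ := CZlem hK hgc hgp a hr hr2
      refine ⟨-c', fun h => by rw [hc' h, neg_zero], fun z hz => ?_⟩
      have hMf := Ms_nn s f z
      have hMT := Ms_nn s (TT K f) z
      have hzk : ∀ k : ℕ, z ∈ Metric.closedBall a (2 ^ k * r) := fun k => by
        have hk : (1:ℝ) ≤ 2 ^ k := one_le_pow₀ (by norm_num)
        exact Metric.closedBall_subset_closedBall (by nlinarith) hz
      have e1 : ∫ y in Metric.closedBall a r, |b y - c| * ‖TT K f y‖ ≤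
          C3 * β * (2 * r) ^ 2 * Ms s (TT K f) z := by
        have := H3 b β hb hβ hHB a r hr 0 (fun y => ‖TT K f y‖) (by fun_prop)
          (hTp.comp fun t => ‖t‖) (fun x => norm_nonneg _) z (hzk 0)
        simpa [Ms] using this
      set V := (C3 + 9 * C4 + 1) * β * Ms s f z with hV
      have e2 := hh V (by positivity) (fun k => by
        have := H3 b β hb hβ hHB a r hr k (fun y => ‖f y‖) (by fun_prop)
          (hfp.comp fun t => ‖t‖) (fun x => norm_nonneg _) z (hzk k)
        simp only [rpow_one] at this
        simp only [hgn]
        refine this.trans ?_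
        have e : C3 * (β * (1 + k)) * (2 * (2 ^ k * r)) ^ 2 * MR (fun y => ‖f y‖ ^ s) z ^ (1 / s) =
          (C3 * β * Ms s f z) * (1 + k) * (2 * (2 ^ k * r)) ^ 2 := by unfold Ms; ring
        rw [e, hV]
        gcongr
        linarith) (by
        have := H4 b β hb hβ hHB a r hr 2 (fun y => ‖f y‖ ^ 2) (by fun_prop)
          (hfp.comp fun t => ‖t‖ ^ 2) (fun x => by positivity) z (hzk 2)
        have e4 : MR (fun y => (‖f y‖ ^ 2) ^ (s / 2)) z ^ (1 / (s / 2)) = Ms s f z ^ 2 := by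
          unfold Ms
          rw [← rpow_two (_ ^ _), ← rpow_mul (MR_nonneg _ _)]
          congr 2
          · ext y; rw [← rpow_two, ← rpow_mul (norm_nonneg _)]; congr 1; ring
          · field_simp
        rw [e4] at this
        simp only [rpow_two] at this
        simp only [hgn, mul_pow |_|]
        refine this.trans ?_
        have e7 : V ^ 2 = (C3 + 9 * C4 + 1) ^ 2 * β ^ 2 * Ms s f z ^ 2 := by rw [hV]; ring
        rw [e7]
        push_cast
        have e5 : C4 * (β * (1 + 2)) ^ 2 * (2 * (2 ^ 2 * r)) ^ 2 * Ms s f z ^ 2 =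
          9 * C4 * β ^ 2 * Ms s f z ^ 2 * (2 * (2 ^ 2 * r)) ^ 2 := by ring
        rw [e5]
        have e8 : 9 * C4 ≤ (C3 + 9 * C4 + 1) ^ 2 := by nlinarith
        gcongr)
      calc ∫ y in Metric.closedBall a r, ‖SS K b f y - -c'‖
          ≤ ∫ y in Metric.closedBall a r, (|b y - c| * ‖TT K f y‖ +
              ‖TT K (fun y => ((b y - c : ℝ) : ℂ) * f y) y - c'‖) := by
            have h6 := SS_cont hK.int hb hbp hf hfp
            have h7 := TT_cont hK.int hgc hgp
            refine setIntegral_mono (intg_cb (by fun_prop) _ _) (intg_cb (by fun_prop) _ _) fun y => ?_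
            dsimp only
            rw [SS_eq hK.int hb hbp hf hfp c, sub_neg_eq_add, sub_add]
            refine (norm_sub_le _ _).trans ?_
            rw [norm_mul, Complex.norm_real, norm_eq_abs]
        _ ≤ C3 * β * (2 * r) ^ 2 * Ms s (TT K f) z + (4 + 256 * A * ZZ) * V * (2 * r) ^ 2 := by
            have h7 := TT_cont hK.int hgc hgp
            rw [integral_add (intg_cb (by fun_prop) _ _) (intg_cb (by fun_prop) _ _)]
            exact add_le_add e1 e2
        _ ≤ _ := by
            rw [hV, hD]
            have q1 : 0 ≤ (4 + 256 * A * ZZ) * (C3 + 9 * C4 + 1) * β * Ms s (TT K f) z * (2 * r) ^ 2 := by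
              positivity
            have q2 : 0 ≤ C3 * β * Ms s f z * (2 * r) ^ 2 := by positivity
            linarith)
  refine h1.trans ?_
  have hint : ∫⁻ x in Q2, ENNReal.ofReal ((D * β * (Ms s (TT K f) x + Ms s f x)) ^ p) ≤
      ENNReal.ofReal (D ^ p * 2 ^ p * β ^ p) * (∫⁻ x in Q2, ENNReal.ofReal (Ms s (TT K f) x ^ p) +
        ENNReal.ofReal (Ms s f x ^ p)) := by
    rw [← lintegral_const_mul' _ _ ENNReal.ofReal_ne_top]
    refine lintegral_mono fun x => ?_
    dsimp only
    have n1 := Ms_nn s (TT K f) x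
    have n2 := Ms_nn s f x
    rw [← ENNReal.ofReal_add (by positivity) (by positivity), ← ENNReal.ofReal_mul (by positivity)]
    apply ENNReal.ofReal_le_ofReal
    rw [mul_rpow (by positivity) (by positivity), mul_rpow hD0.le hβ]
    have := rpow_add_le' n1 n2 (p := p) (by linarith)
    calc _ ≤ D ^ p * β ^ p * (2 ^ p * (Ms s (TT K f) x ^ p + Ms s f x ^ p)) := by gcongr
      _ = _ := by ring
  rw [lintegral_add_left ((Ms_meas (by linarith) hTc).pow_const p).ennreal_ofReal] at hint
  calc _ ≤ ENNReal.ofReal C1 * (ENNReal.ofReal (D ^ p * 2 ^ p * β ^ p) *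
        (ENNReal.ofReal C2 * (ENNReal.ofReal C5 * Nn p f) + ENNReal.ofReal C2 * Nn p f)) := by
        refine mul_le_mul_right (hint.trans ?_) _
        gcongr
        · exact (H2 _ hTc hTp).trans (by gcongr; exact H5 K hK f hf hfp)
        · exact H2 _ hf hfp
    _ = _ := by
        rw [← mul_assoc (ENNReal.ofReal C2), ← add_mul, ← ENNReal.ofReal_mul hC2.le,
          ← ENNReal.ofReal_add (by positivity) hC2.le, ← mul_assoc, ← mul_assoc,
          ← ENNReal.ofReal_mul hC1.le, ← ENNReal.ofReal_mul (by positivity)]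
        congr 2; ring

lemma Nn_eq {p : ℝ} (hp : 0 < p) {f : ℝ × ℝ → ℂ} (hf : Continuous f) :
    Nn p f = ENNReal.ofReal (∫ x in Q2, ‖f x‖ ^ p) := by
  unfold Nn
  have hc : Continuous fun x => ‖f x‖ ^ p := hf.norm.rpow_const fun x => Or.inr hp.le
  rw [ofReal_integral_eq_lintegral_ofReal (intg_Q2 hc)]
  exact Filter.Eventually.of_forall fun x => by positivity

def CB (A p C : ℝ) : Prop := ∀ K, CZ A K → ∀ b β, Continuous b → Per b → 0 ≤ β → HB b β →
  ∀ f : ℝ × ℝ → ℂ, Continuous f → Per f →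
    ∫ x in Q2, ‖SS K b f x‖ ^ p ≤ C * β ^ p * ∫ x in Q2, ‖f x‖ ^ p

lemma comm_big_real {A p : ℝ} (hA : 0 ≤ A) (hp : 2 < p) : ∃ C > 0, CB A p C := by
  obtain ⟨C, hC, H⟩ := comm_big hA hp
  refine ⟨C, hC, fun K hK b β hb hbp hβ hHB f hf hfp => ?_⟩
  have := H K hK b β hb hbp hβ hHB f hf hfp
  rw [Nn_eq (by linarith) hf, Nn_eq (by linarith) (SS_cont hK.int hb hbp hf hfp),
    ← ENNReal.ofReal_mul (by positivity)] at this
  exact (ENNReal.ofReal_le_ofReal_iff (mul_nonneg (by positivity)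
    (integral_nonneg fun x => by positivity))).1 this

lemma SS_anti {A : ℝ} {K b : ℝ × ℝ → ℝ} (hK : CZ A K) (hb : Continuous b) (hbp : Per b)
    {f g : ℝ × ℝ → ℂ} (hf : Continuous f) (hfp : Per f) (hg : Continuous g) (hgp : Per g) :
    ∫ x in Q2, SS K b f x * g x = -∫ x in Q2, f x * SS K b g x := by
  have hbf : Continuous fun y => (b y : ℂ) * f y := by fun_prop
  have hbfp : Per fun y => (b y : ℂ) * f y := hbp.map2 hfp fun s t => (s : ℂ) * t
  have hbg : Continuous fun y => (b y : ℂ) * g y := by fun_prop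
  have hbgp : Per fun y => (b y : ℂ) * g y := hbp.map2 hgp fun s t => (s : ℂ) * t
  have c1 := TT_cont hK.int hf hfp
  have c2 := TT_cont hK.int hg hgp
  have c3 := TT_cont hK.int hbf hbfp
  have c4 := TT_cont hK.int hbg hbgp
  have s1 := TT_symm hK.int hK.even hf hfp hbg hbgp
  have s2 := TT_symm hK.int hK.even hbf hbfp hg hgp
  have e1 : ∫ x in Q2, SS K b f x * g x = (∫ x in Q2, TT K f x * ((b x : ℂ) * g x)) -
      ∫ x in Q2, TT K (fun y => (b y : ℂ) * f y) x * g x := by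
    rw [← integral_sub (intg_Q2 (by fun_prop)) (intg_Q2 (by fun_prop))]
    congr 1; ext x; unfold SS; ring
  have e2 : ∫ x in Q2, f x * SS K b g x = (∫ x in Q2, (b x : ℂ) * f x * TT K g x) -
      ∫ x in Q2, f x * TT K (fun y => (b y : ℂ) * g y) x := by
    rw [← integral_sub (intg_Q2 (by fun_prop)) (intg_Q2 (by fun_prop))]
    congr 1; ext x; unfold SS; ring
  rw [e1, e2, s1, s2]; ring

lemma holder_Q2 {p q : ℝ} (hpq : p.HolderConjugate q) {f g : ℝ × ℝ → ℂ} (hf : Continuous f)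
    (hg : Continuous g) : ‖∫ x in Q2, f x * g x‖ ≤
      (∫ x in Q2, ‖f x‖ ^ p) ^ (1 / p) * (∫ x in Q2, ‖g x‖ ^ q) ^ (1 / q) := by
  have hm : ∀ {h : ℝ × ℝ → ℂ}, Continuous h → ∀ {r : ℝ}, 0 < r →
      MemLp (fun x => ‖h x‖) (ENNReal.ofReal r) (volume.restrict Q2) := by
    intro h hh r hr
    rw [← integrable_norm_rpow_iff (by fun_prop) (by simpa using hr) (by simp)]
    rw [ENNReal.toReal_ofReal hr.le]
    have hc : Continuous fun x => ‖‖h x‖‖ ^ r := hh.norm.norm.rpow_const fun x => Or.inr hr.le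
    exact intg_Q2 hc
  have := integral_mul_le_Lp_mul_Lq_of_nonneg hpq (μ := volume.restrict Q2)
    (f := fun x => ‖f x‖) (g := fun x => ‖g x‖) (Filter.Eventually.of_forall fun x => norm_nonneg _)
    (Filter.Eventually.of_forall fun x => norm_nonneg _) (hm hf hpq.pos) (hm hg hpq.symm.pos)
  refine le_trans ?_ this
  refine (norm_integral_le_integral_norm _).trans (le_of_eq ?_)
  simp

def ph (p : ℝ) (z : ℂ) : ℂ := ((‖z‖ ^ (p - 2) : ℝ) : ℂ) * (starRingEnd ℂ) z

lemma ph_norm {p : ℝ} (hp : 1 < p) (z : ℂ) : ‖ph p z‖ = ‖z‖ ^ (p - 1) := by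
  unfold ph
  rcases eq_or_ne z 0 with rfl | hz
  · simp [zero_rpow (by linarith : p - 1 ≠ 0)]
  · have : 0 < ‖z‖ := by simpa using hz
    rw [norm_mul, Complex.norm_real, norm_of_nonneg (by positivity), RCLike.norm_conj,
      ← rpow_add_one this.ne']
    congr 1; ring

lemma ph_mul {p : ℝ} (hp : 1 < p) (z : ℂ) : z * ph p z = ((‖z‖ ^ p : ℝ) : ℂ) := by
  unfold ph
  rcases eq_or_ne z 0 with rfl | hz
  · simp [zero_rpow (by linarith : p ≠ 0)]
  · have : 0 < ‖z‖ := by simpa using hz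
    have e : z * (((‖z‖ ^ (p - 2) : ℝ) : ℂ) * (starRingEnd ℂ) z) =
      ((‖z‖ ^ (p - 2) : ℝ) : ℂ) * (z * (starRingEnd ℂ) z) := by ring
    rw [e, Complex.mul_conj, ← Complex.ofReal_mul, Complex.normSq_eq_norm_sq, ← rpow_two,
      ← rpow_add this]
    congr 2; ring

lemma ph_cont {p : ℝ} (hp : 1 < p) : Continuous (ph p) := by
  rw [continuous_iff_continuousAt]
  intro z
  rcases eq_or_ne z 0 with rfl | hz
  · have h0 : ph p 0 = 0 := by simp [ph]
    unfold ContinuousAt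
    rw [h0, tendsto_zero_iff_norm_tendsto_zero]
    simp only [ph_norm hp]
    have hc : Continuous fun z : ℂ => ‖z‖ ^ (p - 1) :=
      continuous_norm.rpow_const fun x => Or.inr (by linarith)
    have := hc.tendsto 0
    simpa [zero_rpow (by linarith : p - 1 ≠ 0)] using this
  · unfold ph
    have h1 : ContinuousAt (fun z : ℂ => ‖z‖ ^ (p - 2)) z :=
      continuous_norm.continuousAt.rpow_const (Or.inl (by simpa using hz))
    exact (Complex.continuous_ofReal.continuousAt.comp h1).mul Complex.continuous_conj.continuousAt

lemma comm_small {A p : ℝ} (hA : 0 ≤ A) (hp1 : 1 < p) (hp : p < 2) : ∃ C > 0, CB A p C := by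
  set q := p / (p - 1) with hq
  have hp0 : 0 < p - 1 := by linarith
  have hpq : p.HolderConjugate q := Real.HolderConjugate.conjExponent hp1
  have hq2 : 2 < q := by rw [hq, lt_div_iff₀ hp0]; linarith
  obtain ⟨C, hC, H⟩ := comm_big_real hA hq2
  refine ⟨(C ^ (1 / q)) ^ p, by positivity, fun K hK b β hb hbp hβ hHB f hf hfp => ?_⟩
  set h := SS K b f with hh
  have hhc : Continuous h := SS_cont hK.int hb hbp hf hfp
  have hhp : Per h := SS_per hbp hfp
  have hgc : Continuous fun x => ph p (h x) := (ph_cont hp1).comp hhc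
  have hgp : Per fun x => ph p (h x) := hhp.comp (ph p)
  have h1 := SS_anti hK hb hbp hf hfp hgc hgp
  have h2 := holder_Q2 hpq hf (SS_cont hK.int hb hbp hgc hgp)
  have h3 := H K hK b β hb hbp hβ hHB _ hgc hgp
  have e1 : ∀ x, ‖ph p (h x)‖ ^ q = ‖h x‖ ^ p := fun x => by
    rw [ph_norm hp1, ← rpow_mul (norm_nonneg _)]
    congr 1; rw [hq]; field_simp
  simp only [e1] at h3
  rw [← hh] at h1
  simp only [ph_mul hp1] at h1
  rw [integral_complex_ofReal] at h1
  set I := ∫ x in Q2, ‖h x‖ ^ p with hI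
  set F := ∫ x in Q2, ‖f x‖ ^ p with hF
  have hI0 : 0 ≤ I := integral_nonneg fun x => by positivity
  have hF0 : 0 ≤ F := integral_nonneg fun x => by positivity
  have h4 : I ≤ F ^ (1 / p) * (C * β ^ q * I) ^ (1 / q) := by
    have : I = ‖∫ x in Q2, f x * SS K b (fun x => ph p (h x)) x‖ := by
      rw [← norm_neg, ← h1, Complex.norm_real, norm_of_nonneg hI0]
    rw [this] 
    nth_rw 2 [← this]
    refine h2.trans ?_
    have h5 : (0:ℝ) ≤ ∫ x in Q2, ‖SS K b (fun x => ph p (h x)) x‖ ^ q :=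
      integral_nonneg fun x => by positivity
    have h6 : (0:ℝ) ≤ 1 / q := by positivity
    exact mul_le_mul_of_nonneg_left (rpow_le_rpow h5 h3 h6) (by positivity)
  have hq0 : 0 < q := by linarith
  rw [mul_rpow (by positivity) hI0, mul_rpow hC.le (by positivity), ← rpow_mul hβ,
    mul_one_div_cancel hq0.ne', rpow_one] at h4
  rcases hI0.eq_or_lt with h0 | h0
  · rw [← h0]; positivity
  have h7 : I ^ (1 / p) ≤ F ^ (1 / p) * (C ^ (1 / q) * β) := by
    have e : I = I ^ (1 / p) * I ^ (1 / q) := by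
      rw [← rpow_add h0]
      have := hpq.inv_add_inv_eq_one
      rw [one_div, one_div, this, rpow_one]
    have h8 : 0 < I ^ (1 / q) := by positivity
    refine le_of_mul_le_mul_right ?_ h8
    rw [← e]
    refine h4.trans (le_of_eq (by ring))
  have h9 := rpow_le_rpow (by positivity) h7 (by linarith : 0 ≤ p)
  rw [← rpow_mul hI0, one_div_mul_cancel (by linarith), rpow_one, mul_rpow (by positivity) (by positivity),
    ← rpow_mul hF0, one_div_mul_cancel (by linarith), rpow_one, mul_rpow (by positivity) hβ] at h9
  linarith

lemma logconv {a : ℕ → ℝ} {B M : ℝ} (h0 : ∀ k, 0 ≤ a k) (hM : 0 ≤ M)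
    (h1 : ∀ k, a (k + 1) ^ 2 ≤ a k * a (k + 2)) (h2 : ∀ k, a k ≤ B * M ^ k) : a 1 ≤ M * a 0 := by
  by_contra hc
  push Not at hc
  have ha0 : 0 < a 0 := by
    rcases (h0 0).eq_or_lt with h | h
    · have := h1 0
      rw [← h, zero_mul] at this
      have h3 : a 1 = 0 := by simpa using pow_eq_zero_iff (two_ne_zero) |>.1 (le_antisymm this (by positivity))
      rw [h3, ← h] at hc; simp at hc
    · exact h
  have ha1 : 0 < a 1 := lt_of_le_of_lt (mul_nonneg hM ha0.le) hc
  set q := a 1 / a 0 with hq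
  have hq0 : 0 < q := by positivity
  have hqM : M < q := by rw [hq, lt_div_iff₀ ha0]; exact hc
  have h3 : ∀ k, 0 < a k ∧ q * a k ≤ a (k + 1) := by
    intro k
    induction k with
    | zero => exact ⟨ha0, by rw [hq]; field_simp; simp⟩
    | succ k ih =>
      have hk : 0 < a (k + 1) := lt_of_lt_of_le (mul_pos hq0 ih.1) ih.2
      refine ⟨hk, ?_⟩
      have := h1 k
      refine le_of_mul_le_mul_left ?_ ih.1
      calc a k * (q * a (k + 1)) = (q * a k) * a (k + 1) := by ring
        _ ≤ a (k + 1) * a (k + 1) := mul_le_mul_of_nonneg_right ih.2 hk.le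
        _ ≤ _ := by rw [← sq]; exact this
  have h4 : ∀ k, q ^ k * a 0 ≤ a k := by
    intro k
    induction k with
    | zero => simp
    | succ k ih =>
      refine le_trans ?_ (h3 k).2
      rw [pow_succ']
      nlinarith
  have hM0 : 0 < M := by
    rcases hM.eq_or_lt with h | h
    · have := h2 1
      rw [← h] at this; simp at this; linarith
    · exact h
  have h5 : ∀ k : ℕ, (q / M) ^ k ≤ B / a 0 := fun k => by
    rw [div_pow, div_le_div_iff₀ (by positivity) ha0]
    exact (h4 k).trans (h2 k)
  have h6 : 1 < q / M := by rw [one_lt_div hM0]; exact hqM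
  obtain ⟨n, hn⟩ := pow_unbounded_of_one_lt (B / a 0) h6
  exact absurd (h5 n) (not_le.2 hn)

lemma SS_conj (K b : ℝ × ℝ → ℝ) (f : ℝ × ℝ → ℂ) (x : ℝ × ℝ) :
    (starRingEnd ℂ) (SS K b f x) = SS K b (fun y => (starRingEnd ℂ) (f y)) x := by
  unfold SS
  have e : (fun y => (b y : ℂ) * (starRingEnd ℂ) (f y)) =
      fun y => (starRingEnd ℂ) ((b y : ℂ) * f y) := by
    ext y; rw [map_mul, Complex.conj_ofReal]
  dsimp only
  rw [map_sub, map_mul, e, TT_conj, TT_conj, Complex.conj_ofReal]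

lemma comm_two {A : ℝ} (hA : 0 ≤ A) : ∃ C > 0, CB A 2 C := by
  obtain ⟨C, hC, H⟩ := comm_big_real hA (by norm_num : (2:ℝ) < 3)
  refine ⟨C ^ (2 / 3 : ℝ), by positivity, fun K hK b β hb hbp hβ hHB f hf hfp => ?_⟩
  let g : ℕ → ℝ × ℝ → ℂ := fun k => (SS K b)^[k] f
  have hgs : ∀ k, g (k + 1) = SS K b (g k) := fun k => Function.iterate_succ_apply' _ _ _
  have hgc : ∀ k, Continuous (g k) ∧ Per (g k) := by
    intro k
    induction k with
    | zero => exact ⟨hf, hfp⟩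
    | succ k ih => rw [hgs]; exact ⟨SS_cont hK.int hb hbp ih.1 ih.2, SS_per hbp ih.2⟩
  let a : ℕ → ℝ := fun k => ∫ x in Q2, ‖g k x‖ ^ (2:ℝ)
  have h0 : ∀ k, 0 ≤ a k := fun k => integral_nonneg fun x => by positivity
  set F := ∫ x in Q2, ‖f x‖ ^ (3:ℝ) with hF
  have hF0 : 0 ≤ F := integral_nonneg fun x => by positivity
  have hgF : ∀ k, ∫ x in Q2, ‖g k x‖ ^ (3:ℝ) ≤ (C * β ^ (3:ℝ)) ^ k * F := by
    intro k
    induction k with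
    | zero => simp [g, hF]
    | succ k ih =>
      rw [hgs]
      refine (H K hK b β hb hbp hβ hHB _ (hgc k).1 (hgc k).2).trans ?_
      rw [pow_succ', mul_assoc (C * β ^ (3:ℝ))]
      exact mul_le_mul_of_nonneg_left ih (by positivity)
  have h1 : ∀ k, a (k + 1) ^ 2 ≤ a k * a (k + 2) := by
    intro k
    have c := hgc (k + 1)
    have e := SS_anti hK hb hbp (hgc k).1 (hgc k).2 (g := fun x => (starRingEnd ℂ) (g (k + 1) x))
      (Complex.continuous_conj.comp c.1) (c.2.comp _)
    rw [← hgs] at e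
    have e1 : ∀ x, g (k + 1) x * (starRingEnd ℂ) (g (k + 1) x) = ((‖g (k + 1) x‖ ^ (2:ℝ) : ℝ) : ℂ) :=
      fun x => by rw [Complex.mul_conj, Complex.normSq_eq_norm_sq, rpow_two]
    simp only [e1] at e
    rw [integral_complex_ofReal] at e
    have e2 : ∀ x, SS K b (fun x => (starRingEnd ℂ) (g (k + 1) x)) x = (starRingEnd ℂ) (g (k + 2) x) :=
      fun x => by rw [← SS_conj, ← hgs]
    simp only [e2] at e
    have hh := holder_Q2 (p := 2) (q := 2) Real.HolderConjugate.two_two (hgc k).1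
      (g := fun x => (starRingEnd ℂ) (g (k + 2) x)) (Complex.continuous_conj.comp (hgc (k+2)).1)
    have e3 : a (k + 1) ≤ (a k) ^ (1 / 2 : ℝ) * (a (k + 2)) ^ (1 / 2 : ℝ) := by
      have : a (k + 1) = ‖∫ x in Q2, g k x * (starRingEnd ℂ) (g (k + 2) x)‖ := by
        rw [← norm_neg, ← e, Complex.norm_real, norm_of_nonneg (h0 (k + 1))]
      rw [this]
      simpa only [RCLike.norm_conj] using hh
    rw [← mul_rpow (h0 k) (h0 _), ← sqrt_eq_rpow] at e3
    exact (le_sqrt (h0 _) (mul_nonneg (h0 _) (h0 _))).1 e3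
  have hpq : (3/2 : ℝ).HolderConjugate 3 := by
    rw [Real.holderConjugate_iff]; norm_num
  have h2 : ∀ k, a k ≤ F ^ (2 / 3 : ℝ) * ((C * β ^ (3:ℝ)) ^ (2 / 3 : ℝ)) ^ k := by
    intro k
    have c : Continuous fun x => (((‖g k x‖ ^ (2:ℝ) : ℝ)) : ℂ) :=
      Complex.continuous_ofReal.comp ((hgc k).1.norm.rpow_const fun x => Or.inr (by norm_num))
    have hh := holder_Q2 hpq c (g := fun _ => 1) continuous_const
    have e1 : ∀ x, ‖(((‖g k x‖ ^ (2:ℝ) : ℝ)) : ℂ)‖ ^ (3 / 2 : ℝ) = ‖g k x‖ ^ (3:ℝ) := fun x => by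
      rw [Complex.norm_real, norm_of_nonneg (by positivity), ← rpow_mul (norm_nonneg _)]; norm_num
    simp only [e1, mul_one] at hh
    rw [integral_complex_ofReal, Complex.norm_real, norm_of_nonneg (h0 k)] at hh
    have e2 : ∫ x in Q2, ‖(1:ℂ)‖ ^ (3:ℝ) = 1 := by simp [Measure.real, vol_Q2]
    rw [e2, one_rpow, mul_one] at hh
    refine hh.trans ?_
    rw [show (1 / (3 / 2) : ℝ) = 2 / 3 by norm_num]
    refine (rpow_le_rpow (integral_nonneg fun x => by positivity) (hgF k) (by norm_num)).trans ?_
    rw [mul_rpow (by positivity) hF0, mul_comm, ← rpow_natCast, ← rpow_natCast, ← rpow_mul (by positivity),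
      ← rpow_mul (by positivity), mul_comm (k : ℝ)]
  have h3 := logconv h0 (by positivity) h1 h2
  have e : (C * β ^ (3:ℝ)) ^ (2 / 3 : ℝ) = C ^ (2 / 3 : ℝ) * β ^ (2:ℝ) := by
    rw [mul_rpow hC.le (by positivity), ← rpow_mul hβ]; norm_num
  rw [e] at h3
  have e5 : a 1 = ∫ x in Q2, ‖SS K b f x‖ ^ (2:ℝ) := by simp only [a, hgs]; rfl
  rw [← e5]
  exact h3

lemma comm_all {A p : ℝ} (hA : 0 ≤ A) (hp : 1 < p) : ∃ C > 0, CB A p C := by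
  rcases lt_trichotomy p 2 with h | h | h
  · exact comm_small hA hp h
  · rw [h]; exact comm_two hA
  · exact comm_big_real hA h

def aij (i j : Fin 2) : ℕ := (if i = 0 then 1 else 0) + (if j = 0 then 1 else 0)

lemma aij_le (i j : Fin 2) : aij i j ≤ 2 := by
  unfold aij; split_ifs <;> norm_num

lemma sy_nc (i j : Fin 2) (n : ℤ × ℤ) :
    -(nc n i * nc n j) / ((((n.1 : ℝ) ^ 2 + (n.2 : ℝ) ^ 2 : ℝ)) : ℂ) = ((sy (aij i j) n : ℝ) : ℂ) := by
  fin_cases i <;> fin_cases j <;> simp [nc, aij, sy, nsq] <;> ring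

lemma cG_nn : 0 ≤ cG := by
  unfold cG
  exact setIntegral_nonneg measurableSet_Ioi fun x hx => by positivity

lemma KK_CZ {α : ℕ} (hα : α ≤ 2) {δ N : ℝ} (hδ : 0 < δ) (hN : δ ≤ N) : CZ (40000 * cG) (KK α δ N) where
  pos := mul_nonneg (by norm_num) cG_nn
  int := KK_int hα hδ hN
  even := KK_even hα δ N
  mult := fun n => by
    rw [KK_four hα n hδ hN, Complex.norm_real, norm_eq_abs, abs_mul]
    have h1 := sy_abs hα n
    have h2 := ro_mem n hδ hN
    rw [abs_of_nonneg h2.1]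
    exact mul_le_one₀ h1 h2.1 h2.2
  smooth := fun a z z' d r hd hr hz hz' hdist => KK_smooth hα hδ hN hd hr a z z' hz hz' hdist

lemma TT_ser {α : ℕ} (hα : α ≤ 2) {δ N : ℝ} (hδ : 0 < δ) (hN : δ ≤ N) {f : ℝ × ℝ → ℂ}
    (hf : ContDiff ℝ (⊤ : ℕ∞) f) (hp : Per f) (x : ℝ × ℝ) :
    TT (KK α δ N) f x = ∑' n, ((sy α n * ro δ N n : ℝ) : ℂ) * fc f n * ch n x := by
  have hK := KK_CZ hα hδ hN
  have e : ∀ n, fc (TT (KK α δ N) f) n = ((sy α n * ro δ N n : ℝ) : ℂ) * fc f n := fun n => by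
    rw [fc_TT hK.int hf.continuous hp, KK_four hα n hδ hN]
  have hs : Summable (fc (TT (KK α δ N) f)) := by
    refine Summable.of_norm_bounded (fc_summable hf hp).norm fun n => ?_
    rw [e, norm_mul, ← KK_four hα n hδ hN]
    exact mul_le_of_le_one_left (norm_nonneg _) (hK.mult n)
  rw [← (inversion (TT_cont hK.int hf.continuous hp) (TT_per _ hp) hs x).tsum_eq]
  simp only [e]

lemma ro_lim {n : ℤ × ℤ} (hn : n ≠ 0) :
    Filter.Tendsto (fun k : ℕ => ro (1 / ((k : ℝ) + 1)) ((k : ℝ) + 1) n) Filter.atTop (nhds 1) := by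
  have hpos : 0 < nsq n := by
    unfold nsq
    have : n.1 ≠ 0 ∨ n.2 ≠ 0 := by
      by_contra h
      push Not at h
      exact hn (Prod.ext h.1 h.2)
    rcases this with h | h
    · have : (n.1 : ℝ) ≠ 0 := by exact_mod_cast h
      positivity
    · have : (n.2 : ℝ) ≠ 0 := by exact_mod_cast h
      positivity
  have hc : 0 < 4 * π ^ 2 * nsq n := by positivity
  set c := 4 * π ^ 2 * nsq n with hcd
  have ht : Filter.Tendsto (fun k : ℕ => ((k : ℝ) + 1) ^ 2) Filter.atTop Filter.atTop :=
    (Filter.tendsto_pow_atTop two_ne_zero).comp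
      (Filter.tendsto_atTop_add_const_right _ _ tendsto_natCast_atTop_atTop)
  have h1 : Filter.Tendsto (fun k : ℕ => Real.exp (-(c / ((k : ℝ) + 1) ^ 2))) Filter.atTop (nhds 1) := by
    have := (ht.const_div_atTop c).neg
    have h := (Real.continuous_exp.tendsto _).comp this
    simpa [Function.comp_def] using h
  have h2 : Filter.Tendsto (fun k : ℕ => Real.exp (-(c * ((k : ℝ) + 1) ^ 2))) Filter.atTop (nhds 0) :=
    Real.tendsto_exp_neg_atTop_nhds_zero.comp (ht.const_mul_atTop hc)
  have h3 := h1.sub h2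
  rw [sub_zero] at h3
  refine h3.congr fun k => ?_
  unfold ro
  rw [← hcd]
  congr 3
  rw [one_div, inv_pow, div_inv_eq_mul]

lemma TT_lim (i j : Fin 2) {f : ℝ × ℝ → ℂ}
    (hf : ContDiff ℝ (⊤ : ℕ∞) f) (hp : Per f) (x : ℝ × ℝ) :
    Filter.Tendsto (fun k : ℕ => TT (KK (aij i j) (1 / ((k : ℝ) + 1)) ((k : ℝ) + 1)) f x) Filter.atTop
      (nhds (RRz i j f x)) := by
  have hα := aij_le i j
  have hδ : ∀ k : ℕ, 0 < 1 / ((k : ℝ) + 1) := fun k => by positivity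
  have hN : ∀ k : ℕ, 1 / ((k : ℝ) + 1) ≤ (k : ℝ) + 1 := fun k => by
    rw [div_le_iff₀ (by positivity)]
    have : (0:ℝ) ≤ k := by positivity
    nlinarith
  simp only [fun k : ℕ => TT_ser hα (hδ k) (hN k) hf hp x]
  unfold RRz
  refine tendsto_tsum_of_dominated_convergence (bound := fun n => ‖fc f n‖) (fc_summable hf hp).norm ?_ ?_
  · intro n
    split_ifs with h
    · have e : ∀ k : ℕ, sy (aij i j) n * ro (1 / ((k : ℝ) + 1)) ((k : ℝ) + 1) n = 0 := fun k => by
        rw [h]; simp [ro, nsq]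
      simp only [e]
      simp
    · rw [sy_nc]
      have h1 : Filter.Tendsto (fun k : ℕ => ((sy (aij i j) n * ro (1 / ((k : ℝ) + 1)) ((k : ℝ) + 1) n : ℝ) : ℂ))
          Filter.atTop (nhds ((sy (aij i j) n : ℝ) : ℂ)) := by
        refine (Complex.continuous_ofReal.tendsto _).comp ?_
        simpa using (ro_lim h).const_mul (sy (aij i j) n)
      exact (h1.mul_const _).mul_const _
  · refine Filter.Eventually.of_forall fun k n => ?_
    rw [norm_mul, norm_mul, ch_norm, mul_one, ← KK_four hα n (hδ k) (hN k)]
    exact mul_le_of_le_one_left (norm_nonneg _) ((KK_CZ hα (hδ k) (hN k)).mult n)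

lemma final_bound {p C : ℝ} (hp : 1 < p) (hC : 0 < C) (H : CB (40000 * cG) p C) {b f : ℝ × ℝ → ℝ}
    (hbp : Per b) (hfp : Per f)
    (hb : ContDiff ℝ (⊤ : ℕ∞) b) (hf : ContDiff ℝ (⊤ : ℕ∞) f) (i j : Fin 2) :
    ∫⁻ x in Q2, ENNReal.ofReal (‖commRR (fun x => (b x : ℂ)) (fun x => (f x : ℂ)) i j x‖ ^ p) ≤
      ENNReal.ofReal (C * (8 * (bmo b).toReal) ^ p) * ∫⁻ x in Q2, ENNReal.ofReal (‖(f x : ℂ)‖ ^ p) := by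
  have hbC : ContDiff ℝ (⊤ : ℕ∞) (fun x => (b x : ℂ)) := Complex.ofRealCLM.contDiff.comp hb
  have hfC : ContDiff ℝ (⊤ : ℕ∞) (fun x => (f x : ℂ)) := Complex.ofRealCLM.contDiff.comp hf
  have hfCp : Per (fun x => (f x : ℂ)) := hfp.comp _
  have hbfp : Per (fun x => (b x : ℂ) * (f x : ℂ)) := hbp.map2 hfp fun s t => (s : ℂ) * t
  have hα := aij_le i j
  have hδ : ∀ k : ℕ, 0 < 1 / ((k : ℝ) + 1) := fun k => by positivity
  have hN : ∀ k : ℕ, 1 / ((k : ℝ) + 1) ≤ (k : ℝ) + 1 := fun k => by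
    rw [div_le_iff₀ (by positivity)]
    have : (0:ℝ) ≤ k := by positivity
    nlinarith
  set K : ℕ → ℝ × ℝ → ℝ := fun k => KK (aij i j) (1 / ((k : ℝ) + 1)) ((k : ℝ) + 1) with hK
  have hCZ : ∀ k, CZ (40000 * cG) (K k) := fun k => KK_CZ hα (hδ k) (hN k)
  have hlim : ∀ x, Filter.Tendsto (fun k : ℕ => SS (K k) b (fun x => (f x : ℂ)) x) Filter.atTop
      (nhds (commRR (fun x => (b x : ℂ)) (fun x => (f x : ℂ)) i j x)) := fun x =>
    ((TT_lim i j hfC hfCp x).const_mul _).sub (TT_lim i j (hbC.mul hfC) hbfp x)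
  have hSc : ∀ k, Continuous (SS (K k) b (fun x => (f x : ℂ))) := fun k =>
    SS_cont (hCZ k).int hb.continuous hbp hfC.continuous hfCp
  have hb0 : 0 ≤ 8 * (bmo b).toReal := by positivity
  have hbd : ∀ k, ∫⁻ x in Q2, ENNReal.ofReal (‖SS (K k) b (fun x => (f x : ℂ)) x‖ ^ p) ≤
      ENNReal.ofReal (C * (8 * (bmo b).toReal) ^ p) * ∫⁻ x in Q2, ENNReal.ofReal (‖(f x : ℂ)‖ ^ p) := by
    intro k
    have h1 := H (K k) (hCZ k) b _ hb.continuous hbp hb0 (HB_bmo hb.continuous hbp) _ hfC.continuous hfCp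
    have h2 := Nn_eq (p := p) (by linarith) (hSc k)
    have h3 := Nn_eq (p := p) (by linarith) hfC.continuous
    unfold Nn at h2 h3
    rw [h2, h3, ← ENNReal.ofReal_mul (by positivity)]
    exact ENNReal.ofReal_le_ofReal h1
  have hc : Continuous fun t : ℂ => ENNReal.ofReal (‖t‖ ^ p) :=
    ENNReal.continuous_ofReal.comp (continuous_norm.rpow_const fun x => Or.inr (by linarith))
  calc _ = ∫⁻ x in Q2, Filter.liminf (fun k => ENNReal.ofReal (‖SS (K k) b (fun x => (f x : ℂ)) x‖ ^ p))
        Filter.atTop := by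
        congr 1; ext x
        exact (((hc.tendsto _).comp (hlim x)).liminf_eq).symm
    _ ≤ Filter.liminf (fun k => ∫⁻ x in Q2, ENNReal.ofReal (‖SS (K k) b (fun x => (f x : ℂ)) x‖ ^ p))
        Filter.atTop := lintegral_liminf_le fun k => (hc.comp (hSc k)).measurable
    _ ≤ Filter.liminf (fun _ : ℕ => ENNReal.ofReal (C * (8 * (bmo b).toReal) ^ p) *
        ∫⁻ x in Q2, ENNReal.ofReal (‖(f x : ℂ)‖ ^ p)) Filter.atTop :=
        Filter.liminf_le_liminf (Filter.Eventually.of_forall hbd)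
    _ = _ := Filter.liminf_const _

/-- Coifman–Rochberg–Weiss commutator estimate. For `1 < p < ∞`
there is `C(p)` with `‖[b, R_iR_j](f)‖_{L^p} ≤ C(p) ‖b‖_BMO ‖f‖_{L^p}`. -/
theorem stmt7 (p : ℝ) (hp : 1 < p) :
    ∃ C > 0, ∀ b f : ℝ × ℝ → ℝ, Per b → Per f → ContDiff ℝ (⊤ : ℕ∞) b → ContDiff ℝ (⊤ : ℕ∞) f →
      ∀ i j : Fin 2,
        MeasureTheory.eLpNorm (commRR (fun x => (b x : ℂ)) (fun x => (f x : ℂ)) i j)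
            (ENNReal.ofReal p) μΩ ≤
          ENNReal.ofReal C * bmo b *
            MeasureTheory.eLpNorm (fun x => (f x : ℂ)) (ENNReal.ofReal p) μΩ := by
  obtain ⟨C, hC, H⟩ := comm_all (A := 40000 * cG) (mul_nonneg (by norm_num) cG_nn) hp
  refine ⟨C ^ (1 / p) * 8, by positivity, fun b f hbp hfp hb hf i j => ?_⟩
  have hp0 : 0 < p := by linarith
  have hF := final_bound hp hC H hbp hfp hb hf i j
  have hN : ∀ g : ℝ × ℝ → ℂ, eLpNorm g (ENNReal.ofReal p) μΩ =
      (∫⁻ x in Q2, ENNReal.ofReal (‖g x‖ ^ p)) ^ (1 / p) := fun g => by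
    rw [eLpNorm_eq_lintegral_rpow_enorm_toReal (by simpa using hp0) (by simp), ENNReal.toReal_ofReal hp0.le]
    unfold μΩ
    congr 2; ext x
    rw [← ENNReal.ofReal_rpow_of_nonneg (norm_nonneg _) hp0.le, ofReal_norm]
  rw [hN, hN]
  refine (ENNReal.rpow_le_rpow hF (by positivity : 0 ≤ 1 / p)).trans (le_of_eq ?_)
  rw [ENNReal.mul_rpow_of_nonneg _ _ (by positivity)]
  congr 1
  have hb0 : 0 ≤ (bmo b).toReal := ENNReal.toReal_nonneg
  rw [ENNReal.ofReal_rpow_of_nonneg (by positivity) (by positivity), mul_rpow hC.le (by positivity),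
    ← rpow_mul (by positivity), mul_one_div_cancel hp0.ne', rpow_one, ← mul_assoc,
    ENNReal.ofReal_mul (by positivity), ENNReal.ofReal_toReal (bmo_fin hb.continuous hbp)]
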